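/- Assume (T1) α|μ| > |1−αδ|, (T2) μ² > 4(1−αδ), (T3) μ > 0, and let x < x_c := arctanh(T_c). Let 𝔷(x) be the unique root with positive imaginary part of χ(x;z) := (4z−1+αu₀(x))² + 16α²z·ρ₀(x), where ρ₀(x) := sech²x and u₀(x) := δ + μ·tanh(x). Then q = 𝔷(x) solves the endpoint equations at t = 0: M₀(q, conj q; x, 0) = 0 and M₁(q, conj q; x, 0) = 0; equivalently, I₀(𝔷(x), conj 𝔷(x)) = −2πx/α and I₁(𝔷(x), conj 𝔷(x)) = −(2πx/α)·Re 𝔷(x). -/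

import Mathlib

open Complex Real Filter Set MeasureTheory ComplexConjugate Topology

noncomputable section

/-- The inverse hyperbolic tangent. -/
def arctanh (x : ℝ) : ℝ := Real.log ((1 + x) / (1 - x)) / 2

/-- The hyperbolic secant. -/
def sech (x : ℝ) : ℝ := 1 / Real.cosh x

/-- The point `z_P = (1-αδ+αμ)/4`. -/
def zP (α δ μ : ℝ) : ℝ := (1 - α*δ + α*μ)/4

/-- The point `z_∞ = (1-αδ-αμ)/4`. -/
def zInf (α δ μ : ℝ) : ℝ := (1 - α*δ - α*μ)/4

/-- The discriminant `α⁴ + α²μ²/4 − α²(1−αδ)`. -/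
def discrm (α δ μ : ℝ) : ℝ := α^4 + α^2*μ^2/4 - α^2*(1 - α*δ)

/-- The point `z⁺`. -/
def zplus (α δ μ : ℝ) : ℝ := (1/2)*((1 - α*δ)/2 - α^2 + Real.sqrt (discrm α δ μ))

/-- The point `z⁻ = z_L`. -/
def zminus (α δ μ : ℝ) : ℝ := (1/2)*((1 - α*δ)/2 - α^2 - Real.sqrt (discrm α δ μ))

/-- `Ω(z) = (2/(iα))(z − (1−αδ)/4)`. -/
def Omg (α δ : ℝ) (z : ℂ) : ℂ := (2 / (Complex.I * α)) * (z - (1 - α * δ) / 4)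

/-- `R(z) = e^{iπ/4}(−i(16z−μ²))^{1/2}` (principal branch). -/
def Rf (μ : ℝ) (z : ℂ) : ℂ :=
  Complex.exp (Complex.I * (π : ℂ) / 4) * (-Complex.I * (16 * z - (μ:ℂ)^2)) ^ ((1:ℂ)/2)

/-- The reflection coefficient `s(z)` (Gamma-function formula). -/
def sRef (α δ μ ε : ℝ) (z : ℂ) : ℂ :=
  -(((2:ℂ) ^ (-(Complex.I * (μ:ℂ)) / (ε:ℂ)) * Complex.I * (ε:ℂ)) /
      (2 * Complex.exp (Complex.I * (π : ℂ) / 4) * (-Complex.I * z) ^ ((1:ℂ)/2))) *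
    (Complex.Gamma (1/2 - Complex.I * (μ:ℂ) / (2*ε) - Omg α δ z / ε) /
      Complex.Gamma (1/2 + Complex.I * (μ:ℂ) / (2*ε) + Omg α δ z / ε)) *
    ((Complex.Gamma (1/2 + Omg α δ z / ε - Rf μ z / (2*ε)) *
      Complex.Gamma (1/2 + Omg α δ z / ε + Rf μ z / (2*ε))) /
      (Complex.Gamma (-(Complex.I * (μ:ℂ)) / (2*ε) - Rf μ z / (2*ε)) *
        Complex.Gamma (-(Complex.I * (μ:ℂ)) / (2*ε) + Rf μ z / (2*ε))))

/-- The phase function `Φ(z)` obtained from Stirling asymptotics (principal branches). -/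
def Phi (α δ μ : ℝ) (z : ℂ) : ℂ :=
  -(μ:ℂ) * Complex.log 2
  + (4/(α:ℂ)) * (z - (zP α δ μ : ℂ)) * Complex.log ((2/(α:ℂ)) * ((zP α δ μ : ℂ) - z))
  + (((μ:ℂ) - Complex.I * Rf μ z)/2) * Complex.log ((-Complex.I * (μ:ℂ) - Rf μ z)/2)
  + (((μ:ℂ) + Complex.I * Rf μ z)/2) * Complex.log ((-Complex.I * (μ:ℂ) + Rf μ z)/2)
  - Complex.I * (Omg α δ z - Rf μ z / 2) * Complex.log (Omg α δ z - Rf μ z / 2)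
  - Complex.I * (Omg α δ z + Rf μ z / 2) * Complex.log (Omg α δ z + Rf μ z / 2)

/-- `A = (1−αδ)/(4α²)`. -/
def Acoef (α δ : ℝ) : ℝ := (1 - α*δ)/(4*α^2)

/-- `B = μ/(4α)`. -/
def Bcoef (α μ : ℝ) : ℝ := μ/(4*α)

/-- `T_c = 2B − √(4B²−4A+1)`. -/
def Tcrit (α δ μ : ℝ) : ℝ :=
  2*Bcoef α μ - Real.sqrt (4*(Bcoef α μ)^2 - 4*Acoef α δ + 1)

/-- The initial Madelung density `ρ₀ = sech² x`. -/
def rho0 (x : ℝ) : ℝ := (sech x)^2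

/-- The initial Madelung velocity `u₀ = δ + μ tanh x`. -/
def u0 (δ μ : ℝ) (x : ℝ) : ℝ := δ + μ*Real.tanh x

/-- The WKB characteristic quadratic `χ(x;z) = (4z−1+αu₀(x))² + 16α²z·ρ₀(x)` (in `z ∈ ℂ`). -/
def chiC (α δ μ : ℝ) (x : ℝ) (z : ℂ) : ℂ :=
  (4*z - 1 + ((α * u0 δ μ x : ℝ) : ℂ))^2 + ((16*α^2*rho0 x : ℝ) : ℂ) * z

/-- The point at parameter `u` on the oriented segment `𝓑` from `q` to `z_P`. -/
def segB (α δ μ : ℝ) (q : ℂ) (u : ℝ) : ℂ := q + (u:ℂ) * ((zP α δ μ : ℂ) - q)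

/-- Characterization of the branch `S(z)` of `√((z−q)(z−conj q))` with branch cut
`𝓑 ∪ 𝓑*`, normalized by `S(z) = z + O(1)` at infinity (equivalently `S > 0` on
`(z_P, ∞)`), together with its boundary value `S₊` taken from the left of `𝓑`. -/
def SSpec (α δ μ : ℝ) (q : ℂ) (S Splus : ℂ → ℂ) : Prop :=
  DifferentiableOn ℂ S
    ((segB α δ μ q '' Set.Icc 0 1 ∪ segB α δ μ (conj q) '' Set.Icc 0 1)ᶜ) ∧
  (∀ z ∈ (segB α δ μ q '' Set.Icc 0 1 ∪ segB α δ μ (conj q) '' Set.Icc 0 1)ᶜ,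
    S z ^ 2 = (z - q) * (z - conj q)) ∧
  (∀ x : ℝ, zP α δ μ < x → S (x:ℂ) = (Real.sqrt ((x - q.re)^2 + q.im^2) : ℂ)) ∧
  (∀ u : ℝ, 0 < u → u < 1 →
    Filter.Tendsto
      (fun d : ℝ => S (segB α δ μ q u + (d:ℂ) * Complex.I * ((zP α δ μ : ℂ) - q)))
      (𝓝[>] 0) (𝓝 (Splus (segB α δ μ q u))))

/-- The moment `I_p(q, conj q) = Im ∫_𝓑 Φ′(s) s^p / S₊(s) ds`. -/
def Ip (α δ μ : ℝ) (q : ℂ) (Splus : ℂ → ℂ) (p : ℕ) : ℝ :=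
  (∫ u in (0:ℝ)..1,
      deriv (Phi α δ μ) (segB α δ μ q u) * (segB α δ μ q u)^p / Splus (segB α δ μ q u)
        * ((zP α δ μ : ℂ) - q)).im

/-- `M₀(q, conj q; x, t) = (2π/α²)(2(q+conj q)t + αx − t) + I₀`. -/
def M0 (α δ μ : ℝ) (q : ℂ) (Splus : ℂ → ℂ) (x t : ℝ) : ℝ :=
  (2*π/α^2) * (2*(2*q.re)*t + α*x - t) + Ip α δ μ q Splus 0

/-- `M₁(q, conj q; x, t) = (π/α²)((3q² + 2|q|² + 3(conj q)²)t + (q+conj q)(αx−t)) + I₁`. -/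
def M1 (α δ μ : ℝ) (q : ℂ) (Splus : ℂ → ℂ) (x t : ℝ) : ℝ :=
  (π/α^2) * ((6*(q^2).re + 2*‖q‖^2)*t + (2*q.re)*(α*x - t))
    + Ip α δ μ q Splus 1

/-- Normalized real parameters of the problem. -/
structure Prm (α μ κ T A B : ℝ) : Prop where
  hα : 0 < α
  hμ : 0 < μ
  hκ : 0 < κ
  hT1 : -1 < T
  hT2 : T < 1
  hB : 0 < B
  h1 : κ < μ ^ 2 + 4 * α * μ
  hA : A = -α * (μ * T + 2 * α * (1 - T ^ 2))
  hAB : A ^ 2 + B ^ 2 = α ^ 2 * (μ ^ 2 - (1 - T ^ 2) * κ)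

/-- The relation satisfied by `D = pT + αμ - ψ` with `ψ² = χ`. -/
def DRel (α μ κ T : ℝ) (p D : ℂ) : Prop :=
  D ^ 2 - 2 * (p * T + α * μ) * D = (1 - T ^ 2) * (p ^ 2 - α ^ 2 * (κ - 4 * p))

def E1 (α μ T : ℝ) (p D : ℂ) : ℂ := (1 - T) * (α * μ - p) / D

def H2 (α μ T : ℝ) (p r D : ℂ) : ℂ :=
  -(1 + T) * (1 + (1 - T) * (p + α * r) / D) / (μ + r)

def E2 (α μ T : ℝ) (p r D : ℂ) : ℂ := 1 + r * H2 α μ T p r D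

lemma Prm.rho_pos {α μ κ T A B : ℝ} (h : Prm α μ κ T A B) : 0 < 1 - T ^ 2 := by
  nlinarith [h.hT1, h.hT2]

lemma Prm.quad_ne {α μ κ T A B : ℝ} (h : Prm α μ κ T A B) {p : ℂ} (hp : p.im ≠ 0) :
    p ^ 2 - α ^ 2 * (κ - 4 * p) ≠ 0 := by
  intro h0
  have hre := congrArg Complex.re h0
  have him := congrArg Complex.im h0
  simp [pow_two] at hre him
  have h2 : p.re = -2 * α ^ 2 := by
    have : p.im * (2 * p.re + 4 * α ^ 2) = 0 := by nlinarith
    rcases mul_eq_zero.1 this with h3 | h3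
    · exact absurd h3 hp
    · linarith
  rw [h2] at hre
  have := h.hα
  have := h.hκ
  nlinarith [sq_nonneg p.im, pow_pos h.hα 4, mul_pos (pow_pos h.hα 2) h.hκ]

lemma Prm.D_ne {α μ κ T A B : ℝ} (h : Prm α μ κ T A B) {p D : ℂ} (hp : p.im ≠ 0)
    (hD : DRel α μ κ T p D) : D ≠ 0 := by
  rintro rfl
  have := h.quad_ne hp
  have h3 : ((1 - T ^ 2 : ℝ) : ℂ) ≠ 0 := by exact_mod_cast h.rho_pos.ne'
  push_cast at h3
  simp only [DRel] at hD
  apply mul_ne_zero h3 this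
  rw [← hD]; ring

lemma not_slit {w : ℂ} (hw : w ∉ slitPlane) : ∃ k : ℝ, 0 ≤ k ∧ w = -k := by
  rw [mem_slitPlane_iff] at hw
  push Not at hw
  refine ⟨-w.re, by linarith [hw.1], ?_⟩
  apply Complex.ext <;> simp [hw.2]

lemma real_quad_no_root {a2 a1 a0 y : ℝ} {p : ℂ} (hp : p.im ≠ 0)
    (h0 : (a2 : ℂ) * p ^ 2 + a1 * p + a0 = 0) (ha : 0 < a0) : 0 ≤ a2 * y ^ 2 + a1 * y + a0 := by
  have hre := congrArg Complex.re h0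
  have him := congrArg Complex.im h0
  simp [pow_two] at hre him
  have h1 : a1 = -2 * a2 * p.re := by
    have : p.im * (2 * a2 * p.re + a1) = 0 := by nlinarith
    rcases mul_eq_zero.1 this with h3 | h3
    · exact absurd h3 hp
    · linarith
  subst h1
  have h2 : a0 = a2 * (p.re ^ 2 + p.im ^ 2) := by nlinarith
  have h3 : 0 < a2 := by
    by_contra h4
    nlinarith [sq_nonneg p.re, sq_nonneg p.im]
  rw [h2]
  have : a2 * y ^ 2 + -2 * a2 * p.re * y + a2 * (p.re ^ 2 + p.im ^ 2)
    = a2 * ((y - p.re) ^ 2 + p.im ^ 2) := by ring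
  rw [this]; positivity

lemma Prm.E1_slit {α μ κ T A B : ℝ} (h : Prm α μ κ T A B) {p D : ℂ} (hp : p.im ≠ 0)
    (hD : DRel α μ κ T p D) : E1 α μ T p D ∈ slitPlane := by
  by_contra hc
  obtain ⟨w, hw, he⟩ := not_slit hc
  have hD0 := h.D_ne hp hD
  have hpm : (α * μ - p : ℂ) ≠ 0 := by
    intro h0
    have := congrArg Complex.im h0
    simp at this; exact hp this
  have hT : (1 - T : ℂ) ≠ 0 := by
    have := h.hT2
    have : (1 - T) ≠ 0 := by linarith
    exact_mod_cast this
  have hw0 : 0 < w := by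
    rcases hw.eq_or_lt with h0 | h0
    · exfalso
      rw [← h0] at he
      simp [E1, hD0, hpm, hT] at he
    · exact h0
  obtain ⟨k, hk, hkw⟩ : ∃ k : ℝ, 0 < k ∧ k * w = 1 - T :=
    ⟨(1 - T) / w, div_pos (by linarith [h.hT2]) hw0, by field_simp⟩
  have hkw' : (k * w : ℂ) = 1 - T := by exact_mod_cast hkw
  have hwc : (w : ℂ) ≠ 0 := by exact_mod_cast hw0.ne'
  have hDk : D = k * (p - α * μ) := by
    simp only [E1] at he
    rw [div_eq_iff hD0, ← hkw'] at he
    have : (w : ℂ) * (D - k * (p - α * μ)) = 0 := by linear_combination he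
    rcases mul_eq_zero.1 this with h3 | h3
    · exact absurd h3 hwc
    · linear_combination h3
  rw [hDk] at hD
  simp only [DRel] at hD
  have hα := h.hα
  have hμ := h.hμ
  have hκ := h.hκ
  have hρ := h.rho_pos
  have := real_quad_no_root (a2 := k ^ 2 - 2 * k * T - (1 - T ^ 2))
    (a1 := -2 * k ^ 2 * α * μ - 2 * k * (α * μ - α * μ * T) - (1 - T ^ 2) * 4 * α ^ 2)
    (a0 := k ^ 2 * α ^ 2 * μ ^ 2 + 2 * k * α ^ 2 * μ ^ 2 + (1 - T ^ 2) * (α ^ 2 * κ))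
    (y := α * μ) hp (by push_cast; linear_combination hD) (by positivity)
  have h5 : (0:ℝ) < (1 - T ^ 2) * α ^ 2 * (μ ^ 2 + 4 * α * μ - κ) := by
    have := h.h1
    have : 0 < μ ^ 2 + 4 * α * μ - κ := by linarith
    positivity
  nlinarith

lemma E2_eq {α μ T : ℝ} {p r D : ℂ} (hD : D ≠ 0) (hr : (μ : ℂ) + r ≠ 0) :
    E2 α μ T p r D * (D * (μ + r)) = (μ - r * T) * D - r * (1 - T ^ 2) * (p + α * r) := by
  simp only [E2, H2]; field_simp; ring

lemma Prm.E2_neg {α μ κ T A B : ℝ} (h : Prm α μ κ T A B) {p r D : ℂ} {w : ℝ}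
    (hr : r ^ 2 = κ - 4 * p) (hμr : (μ : ℂ) + r ≠ 0) (hpr : p + α * r ≠ 0)
    (hD : DRel α μ κ T p D) (hD0 : D ≠ 0) (he : E2 α μ T p r D = -w) :
    p * ((1 + w) ^ 2 * μ - (1 - w ^ 2) * r) +
      α * r * (μ * (1 - w ^ 2) - (1 + w ^ 2 - 2 * w * T) * r) = 0 := by
  have h1 := E2_eq (α := α) (μ := μ) (T := T) (p := p) hD0 hμr
  rw [he] at h1
  have hρ : ((1 - T ^ 2 : ℝ) : ℂ) ≠ 0 := by exact_mod_cast h.rho_pos.ne'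
  push_cast at hρ
  simp only [DRel] at hD
  rw [← hr] at hD
  have hG : D * (μ * (1 + w) + r * (w - T)) = r * (1 - T ^ 2) * (p + α * r) := by
    linear_combination -h1
  have h2 : ((1 - T ^ 2) * (p + α * r)) * ((μ + r) *
    (p * ((1 + w) ^ 2 * μ - (1 - w ^ 2) * r) +
      α * r * (μ * (1 - w ^ 2) - (1 + w ^ 2 - 2 * w * T) * r))) = 0 := by
    linear_combination -(μ * (1 + w) + r * (w - T)) ^ 2 * hD
      + (D * (μ * (1 + w) + r * (w - T)) + r * (1 - T ^ 2) * (p + α * r)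
        - 2 * (p * T + α * μ) * (μ * (1 + w) + r * (w - T))) * hG
  have h3 := (mul_eq_zero.1 h2).resolve_left (mul_ne_zero hρ hpr)
  exact (mul_eq_zero.1 h3).resolve_left hμr

set_option maxHeartbeats 1000000 in
lemma Prm.E2_slit {α μ κ T A B : ℝ} (h : Prm α μ κ T A B) {p r D : ℂ} (hp : p.im ≠ 0)
    (hr : r ^ 2 = κ - 4 * p) (hre : 0 < r.re) (hD : DRel α μ κ T p D) :
    E2 α μ T p r D ∈ slitPlane := by
  by_contra hc
  obtain ⟨w, hw, he⟩ := not_slit hc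
  have hα := h.hα
  have hμ := h.hμ
  have hκ := h.hκ
  have hρ := h.rho_pos
  have hμr : (μ : ℂ) + r ≠ 0 := by
    intro h0
    have := congrArg Complex.re h0
    simp at this
    linarith
  have hpr : p + α * r ≠ 0 := by
    intro h0
    apply h.quad_ne hp
    rw [← hr]
    linear_combination (p - α * r) * h0
  have key := h.E2_neg hr hμr hpr hD (h.D_ne hp hD) he
  have hp' : p = (κ - r ^ 2) / 4 := by rw [hr]; ring
  obtain ⟨x, y⟩ := r
  simp at hre
  have hy : y ≠ 0 := by
    rintro rfl
    apply hp
    rw [hp']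
    simp [pow_two]
  rw [hp'] at key
  have k1 := congrArg Complex.re key
  have k2 := congrArg Complex.im key
  simp [pow_two] at k1 k2
  ring_nf at k1 k2
  obtain ⟨K, hK⟩ : ∃ K : ℝ, K = 1 - w ^ 2 := ⟨_, rfl⟩
  obtain ⟨g, hg⟩ : ∃ g : ℝ, g = 1 + w ^ 2 - 2 * w * T := ⟨_, rfl⟩
  obtain ⟨N, hN⟩ : ∃ N : ℝ, N = (1 + w) ^ 2 := ⟨_, rfl⟩
  have hNpos : 0 < N := by rw [hN]; positivity
  have hgpos : 0 < g := by
    have := h.hT1; have := h.hT2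
    rw [hg]; nlinarith [sq_nonneg (w - 1), sq_nonneg (w + 1), sq_nonneg (w - T)]
  obtain ⟨β, hβ⟩ : ∃ β : ℝ, β = -(N * μ + 4 * α * g) + 2 * x * K := ⟨_, rfl⟩
  have c1 : 4 * α * μ * K - κ * K = K * (x ^ 2 + y ^ 2) - 2 * x * β := by
    have : y * (4 * α * μ * K - κ * K - (K * (x ^ 2 + y ^ 2) - 2 * x * β)) = 0 := by
      rw [hβ, hK, hg, hN]; linear_combination 4 * k2
    rcases mul_eq_zero.1 this with h3 | h3
    · exact absurd h3 hy
    · linarith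
  have c0 : κ * N * μ = β * (x ^ 2 + y ^ 2) := by
    have : κ * N * μ + x * (4 * α * μ * K - κ * K) = β * (x ^ 2 + y ^ 2) +
      x * (K * (x ^ 2 + y ^ 2) - 2 * x * β) := by
      rw [hβ, hK, hg, hN]; linear_combination 4 * k1
    rw [c1] at this
    linarith
  have hβpos : 0 < β := by
    by_contra h4
    have : 0 < κ * N * μ := by positivity
    nlinarith [sq_nonneg x, sq_nonneg y]
  have hKpos : 0 < K := by
    by_contra h4
    have : 0 < N * μ := by positivity
    have : 0 < 4 * α * g := by positivity
    nlinarith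
  obtain ⟨t, ht, hKt⟩ : ∃ t : ℝ, 0 < t ∧ K * t = N * μ :=
    ⟨N * μ / K, by positivity, by field_simp⟩
  have hf : 0 < (K * t + β) * ((t - x) ^ 2 + y ^ 2) := by positivity
  have hf2 : (K * t + β) * ((t - x) ^ 2 + y ^ 2) = 4 * α * t * (μ * K - g * t) := by
    have e1 : (K * t + β) * ((t - x) ^ 2 + y ^ 2) = K * t ^ 3 + (β - 2 * x * K) * t ^ 2 +
      (K * (x ^ 2 + y ^ 2) - 2 * x * β) * t + β * (x ^ 2 + y ^ 2) := by ring
    rw [e1, ← c1, ← c0]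
    have e2 : β - 2 * x * K = -(N * μ + 4 * α * g) := by rw [hβ]; ring
    rw [e2]
    linear_combination (t ^ 2 - κ) * hKt
  rw [hf2] at hf
  have hf3 : 0 < μ * K - g * t := by
    by_contra h4
    have : 0 < 4 * α * t := by positivity
    exact absurd hf (not_lt.2 (mul_nonpos_of_nonneg_of_nonpos this.le (not_lt.1 h4)))
  have hf4 : K * (μ * K - g * t) = -(μ * N * (2 * w * (1 - T))) := by
    have : K * (μ * K - g * t) = μ * K ^ 2 - g * (N * μ) := by rw [← hKt]; ring
    rw [this, hK, hg, hN]; ring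
  have hf5 : 0 ≤ μ * N * (2 * w * (1 - T)) := by
    have : 0 ≤ 1 - T := by linarith [h.hT2]
    positivity
  have hf6 := mul_pos hKpos hf3
  rw [hf4] at hf6
  linarith

lemma Prm.chi_eq {α μ κ T A B : ℝ} (h : Prm α μ κ T A B) (p : ℝ) :
    (p - A) ^ 2 + B ^ 2 = (p * T + α * μ) ^ 2 + (1 - T ^ 2) * (p ^ 2 - α ^ 2 * (κ - 4 * p)) := by
  have h1 := h.hA
  have h2 := h.hAB
  linear_combination h2 - 2 * p * h1

lemma Prm.dRel {α μ κ T A B : ℝ} (h : Prm α μ κ T A B) {p ψ : ℂ}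
    (hψ : ψ ^ 2 = (p - A) ^ 2 + B ^ 2) : DRel α μ κ T p (p * T + α * μ - ψ) := by
  have h1 : (A : ℂ) = -α * (μ * T + 2 * α * (1 - T ^ 2)) := by exact_mod_cast h.hA
  have h2 : (A : ℂ) ^ 2 + B ^ 2 = α ^ 2 * (μ ^ 2 - (1 - T ^ 2) * κ) := by exact_mod_cast h.hAB
  simp only [DRel]
  linear_combination hψ + h2 - 2 * p * h1

/-- The real points of the sheet on which the antiderivative integrand is real. -/
def RealReg (α μ A B p ψ : ℝ) : Prop :=
  ψ ^ 2 = (p - A) ^ 2 + B ^ 2 ∧ ((p ≤ α * μ ∧ ψ < 0) ∨ (α * μ ≤ p ∧ 0 < ψ))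

lemma Prm.D_pos {α μ κ T A B : ℝ} (h : Prm α μ κ T A B) {p ψ : ℝ}
    (hψ : ψ ^ 2 = (p - A) ^ 2 + B ^ 2) (hp : p ≤ α * μ) (hs : ψ < 0) :
    0 < p * T + α * μ - ψ := by
  by_contra hc
  push Not at hc
  have hα := h.hα
  have hμ := h.hμ
  have hκ := h.hκ
  have hρ := h.rho_pos
  have hαμ : 0 < α * μ := by positivity
  have hY : p * T < -(α * μ) := by linarith
  have hp0 : p < 0 := by
    by_contra hp1
    push Not at hp1
    nlinarith [h.hT1]
  have hT0 : 0 < T := by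
    by_contra h4
    nlinarith [mul_nonneg_of_nonpos_of_nonpos hp0.le (not_lt.1 h4)]
  have hQ : p ^ 2 - α ^ 2 * (κ - 4 * p) ≤ 0 := by
    have e := h.chi_eq p
    rw [← hψ] at e
    have e1 : (1 - T ^ 2) * (p ^ 2 - α ^ 2 * (κ - 4 * p))
      = -((p * T + α * μ - ψ) * (p * T + α * μ + ψ)) := by linear_combination -e
    have e2 : 0 ≤ (p * T + α * μ - ψ) * (p * T + α * μ + ψ) :=
      mul_nonneg_of_nonpos_of_nonpos hc (by linarith)
    by_contra h5
    have := mul_pos hρ (not_le.1 h5)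
    linarith
  obtain ⟨θ, h0, h1, hθ⟩ : ∃ θ : ℝ, 0 < θ ∧ θ < 1 ∧ θ * p * T = -(α * μ) := by
    have : p * T < 0 := by linarith
    refine ⟨-(α * μ) / (p * T), div_pos_of_neg_of_neg (by linarith) this, ?_, ?_⟩
    · rw [div_lt_one_of_neg this]; exact hY
    · have := hp0.ne
      have := hT0.ne'
      field_simp
  have e := h.chi_eq (θ * p)
  have e0 : θ * p * T + α * μ = 0 := by linarith
  rw [e0] at e
  have hB := h.hB
  have e3 : 0 < (1 - T ^ 2) * ((θ * p) ^ 2 - α ^ 2 * (κ - 4 * (θ * p))) := by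
    have : 0 < (θ * p - A) ^ 2 + B ^ 2 := by positivity
    linarith
  have e4 := (pos_iff_pos_of_mul_pos e3).1 hρ
  have e5 : (θ * p) ^ 2 - α ^ 2 * (κ - 4 * (θ * p)) = θ * (p ^ 2 - α ^ 2 * (κ - 4 * p))
    - (θ * (1 - θ) * p ^ 2 + α ^ 2 * κ * (1 - θ)) := by ring
  have e6 : 0 ≤ θ * (1 - θ) * p ^ 2 + α ^ 2 * κ * (1 - θ) := by
    have : 0 < 1 - θ := by linarith
    positivity
  have e7 := mul_nonpos_of_nonneg_of_nonpos h0.le hQ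
  linarith

lemma Prm.D_neg {α μ κ T A B : ℝ} (h : Prm α μ κ T A B) {p ψ : ℝ}
    (hψ : ψ ^ 2 = (p - A) ^ 2 + B ^ 2) (hp : α * μ ≤ p) (hs : 0 < ψ) :
    p * T + α * μ - ψ < 0 := by
  have hα := h.hα
  have hμ := h.hμ
  have hρ := h.rho_pos
  have hαμ : 0 < α * μ := by positivity
  have e := h.chi_eq p
  rw [← hψ] at e
  have e1 : (1 - T ^ 2) * (p ^ 2 - α ^ 2 * (κ - 4 * p))
      = -((p * T + α * μ - ψ) * (p * T + α * μ + ψ)) := by linear_combination -e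
  have hQ : 0 < p ^ 2 - α ^ 2 * (κ - 4 * p) := by
    have : 0 < α ^ 2 * (μ ^ 2 + 4 * α * μ - κ) := by
      have := h.h1
      have : 0 < μ ^ 2 + 4 * α * μ - κ := by linarith
      positivity
    have : 0 ≤ (p - α * μ) * (p + α * μ) + 4 * α ^ 2 * (p - α * μ) := by
      have : 0 ≤ p - α * μ := by linarith
      have : 0 ≤ p + α * μ := by linarith
      positivity
    nlinarith
  have e2 := mul_pos hρ hQ
  rw [e1] at e2
  by_contra hc
  push Not at hc
  have := mul_nonneg hc (by linarith : 0 ≤ p * T + α * μ + ψ)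
  linarith

lemma RealReg.D_ne {α μ κ T A B : ℝ} (h : Prm α μ κ T A B) {p ψ : ℝ}
    (hr : RealReg α μ A B p ψ) : p * T + α * μ - ψ ≠ 0 := by
  rcases hr.2 with h1 | h1
  · exact (h.D_pos hr.1 h1.1 h1.2).ne'
  · exact (h.D_neg hr.1 h1.1 h1.2).ne

lemma RealReg.E1_pos {α μ κ T A B : ℝ} (h : Prm α μ κ T A B) {p ψ : ℝ}
    (hr : RealReg α μ A B p ψ) (hp : p ≠ α * μ) :
    0 < (1 - T) * (α * μ - p) / (p * T + α * μ - ψ) := by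
  have hT : 0 < 1 - T := by linarith [h.hT2]
  rcases hr.2 with h1 | h1
  · have := h.D_pos hr.1 h1.1 h1.2
    have : 0 < α * μ - p := by
      have := lt_of_le_of_ne h1.1 hp
      linarith
    positivity
  · have h2 := h.D_neg hr.1 h1.1 h1.2
    have h3 : α * μ - p < 0 := by
      have := lt_of_le_of_ne h1.1 hp.symm
      linarith
    exact div_pos_of_neg_of_neg (mul_neg_of_pos_of_neg hT h3) h2

lemma Prm.V_neg {α μ κ T A B : ℝ} (h : Prm α μ κ T A B) {p : ℝ}
    (hp : 4 * p ≤ κ - μ ^ 2) : p + α * μ * T < 0 := by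
  have e := h.chi_eq ((κ - μ ^ 2) / 4)
  obtain ⟨n, hn⟩ : ∃ n : ℝ, n = (κ - μ ^ 2) / 4 + α * μ * T := ⟨_, rfl⟩
  have hA : (κ - μ ^ 2) / 4 - A = n + 2 * α ^ 2 * (1 - T ^ 2) := by
    rw [hn, h.hA]; ring
  rw [hA] at e
  have e2 : (n + 2 * α ^ 2 * (1 - T ^ 2)) ^ 2 + B ^ 2 = n ^ 2 := by
    rw [e, hn]; ring
  have hB := h.hB
  have hα := h.hα
  have hρ := h.rho_pos
  have hw : 0 < α ^ 2 * (1 - T ^ 2) := by positivity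
  have : n < 0 := by
    by_contra hc
    push Not at hc
    have := mul_nonneg hw.le hc
    nlinarith [pow_pos hB 2, pow_pos hw 2]
  linarith

set_option maxHeartbeats 1000000 in
lemma RealReg.E2_pos {α μ κ T A B : ℝ} (h : Prm α μ κ T A B) {p ψ r : ℝ}
    (hreg : RealReg α μ A B p ψ) (hr : r ^ 2 = κ - 4 * p) (hr0 : 0 ≤ r) :
    0 < 1 + r * (-(1 + T) * (1 + (1 - T) * (p + α * r) / (p * T + α * μ - ψ)) / (μ + r)) := by
  have hα := h.hα
  have hμ := h.hμ
  have hκ := h.hκ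
  have hρ := h.rho_pos
  have hT1 := h.hT1
  have hT2 := h.hT2
  have hD0 := hreg.D_ne h
  have hμr : 0 < μ + r := by positivity
  have e0 : 1 + r * (-(1 + T) * (1 + (1 - T) * (p + α * r) / (p * T + α * μ - ψ)) / (μ + r))
    = ((μ - r * T) * (p * T + α * μ - ψ) - r * (1 - T ^ 2) * (p + α * r)) /
      ((p * T + α * μ - ψ) * (μ + r)) := by
    generalize p * T + α * μ - ψ = D at hD0 ⊢
    field_simp; ring
  rw [e0]
  obtain ⟨hψ, h1 | h1⟩ := hreg
  · have hD := h.D_pos hψ h1.1 h1.2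
    apply div_pos _ (by positivity)
    have hchi : ψ ^ 2 = (p * T + α * μ) ^ 2 + (1 - T ^ 2) * (p ^ 2 - α ^ 2 * r ^ 2) := by
      rw [hψ, h.chi_eq, hr]
    obtain ⟨c, hc⟩ : ∃ c : ℝ, c = (μ - r * T) * (p * T + α * μ) - r * (1 - T ^ 2) * (p + α * r) :=
      ⟨_, rfl⟩
    obtain ⟨d, hd⟩ : ∃ d : ℝ, d = (μ - r * T) * (-ψ) := ⟨_, rfl⟩
    have e1 : (μ - r * T) * (p * T + α * μ - ψ) - r * (1 - T ^ 2) * (p + α * r) = c + d := by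
      rw [hc, hd]; ring
    rw [e1]
    have e2 : (c + d) * (c - d) = -((1 - T ^ 2) * (p + α * r) ^ 2 * (μ ^ 2 - r ^ 2)) := by
      rw [hc, hd]; linear_combination (-(μ - r * T) ^ 2) * hchi
    have e3 : c = -(p + α * μ * T) * (r - μ * T) - α * (1 - T ^ 2) * (r ^ 2 - μ ^ 2) := by
      rw [hc]; ring
    rcases lt_trichotomy r μ with h2 | h2 | h2
    · have hm : 0 < μ - r * T := by nlinarith
      by_cases hpr : p + α * r = 0
      · have : c + d = (μ - r * T) * (p * T + α * μ - ψ) := by rw [hc, hd, hpr]; ring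
        rw [this]; positivity
      · have hd0 : 0 < d := by rw [hd]; exact mul_pos hm (by linarith [h1.2])
        have : 0 < (1 - T ^ 2) * (p + α * r) ^ 2 * (μ ^ 2 - r ^ 2) := by
          have : 0 < μ ^ 2 - r ^ 2 := by nlinarith
          positivity
        by_contra hn
        push Not at hn
        have := mul_nonneg_of_nonpos_of_nonpos hn (by linarith : c - d ≤ 0)
        linarith
    · have hV := h.V_neg (p := p) (by rw [← h2]; linarith)
      subst h2
      have hs : ψ = p + α * r * T := by
        have : (ψ - (p + α * r * T)) * (ψ + (p + α * r * T)) = 0 := by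
          linear_combination hchi
        rcases mul_eq_zero.1 this with h5 | h5
        · linarith
        · linarith [h1.2]
      have : c + d = 2 * r * (1 - T) * (-(p + α * r * T)) := by
        rw [hc, hd, hs]; ring
      rw [this]
      have : 0 < 1 - T := by linarith
      have : 0 < -(p + α * r * T) := by linarith
      positivity
    · have hV := h.V_neg (p := p) (by nlinarith)
      have hm : 0 < r - μ * T := by nlinarith
      have hrm : 0 < r ^ 2 - μ ^ 2 := by nlinarith
      have hc0 : 0 < c := by
        have hV2 : α ^ 2 * (1 - T ^ 2) * (r ^ 2 - μ ^ 2) < (p + α * μ * T) ^ 2 := by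
          have hne := h1.2.ne
          have h9 : 0 < ψ ^ 2 := by positivity
          have h10 : ψ ^ 2 = (p + α * μ * T) ^ 2 - α ^ 2 * (1 - T ^ 2) * (r ^ 2 - μ ^ 2) := by
            rw [hchi]; ring
          linarith
        have hm2 : (1 - T ^ 2) * (r ^ 2 - μ ^ 2) ≤ (r - μ * T) ^ 2 := by
          nlinarith [sq_nonneg (r * T - μ)]
        have hw : 0 < (1 - T ^ 2) * (r ^ 2 - μ ^ 2) := by positivity
        obtain ⟨w, hw1⟩ : ∃ w : ℝ, w = (1 - T ^ 2) * (r ^ 2 - μ ^ 2) := ⟨_, rfl⟩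
        rw [← hw1] at hw hm2
        have hsq : (α * w) ^ 2 < (-(p + α * μ * T) * (r - μ * T)) ^ 2 := by
          calc (α * w) ^ 2 = (α ^ 2 * w) * w := by ring
            _ < (p + α * μ * T) ^ 2 * w := by
              apply mul_lt_mul_of_pos_right _ hw
              rw [hw1]; linarith
            _ ≤ (p + α * μ * T) ^ 2 * (r - μ * T) ^ 2 := by gcongr
            _ = _ := by ring
        have h7 := lt_of_pow_lt_pow_left₀ 2 (mul_pos (by linarith) hm).le hsq
        rw [e3, show α * (1 - T ^ 2) * (r ^ 2 - μ ^ 2) = α * w by rw [hw1]; ring]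
        linarith
      by_cases hpr : p + α * r = 0
      · have e4 : c = (μ - r * T) * (p * T + α * μ) := by rw [hc, hpr]; ring
        have e5 : c + d = (μ - r * T) * (p * T + α * μ - ψ) := by rw [hc, hd, hpr]; ring
        have e6 : (c + d) * (c - d) = 0 := by rw [e2, hpr]; ring
        rcases mul_eq_zero.1 e6 with h8 | h8
        · rw [e5] at h8
          rcases mul_eq_zero.1 h8 with h9 | h9
          · rw [e4, h9] at hc0; simp at hc0
          · linarith
        · linarith
      · have : 0 < (1 - T ^ 2) * (p + α * r) ^ 2 * (r ^ 2 - μ ^ 2) := by positivity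
        by_contra hn
        push Not at hn
        have h8 : 0 ≤ c - d := by linarith
        have h11 := mul_nonneg (by linarith : 0 ≤ -(c + d)) h8
        have h12 : -(c + d) * (c - d) = -((1 - T ^ 2) * (p + α * r) ^ 2 * (r ^ 2 - μ ^ 2)) := by
          linear_combination -e2
        linarith
  · have hD := h.D_neg hψ h1.1 h1.2
    have hp : 0 < p := lt_of_lt_of_le (by positivity) h1.1
    have hr2 : r < μ := by
      have := h.h1
      nlinarith
    have hm : 0 < μ - r * T := by nlinarith
    apply div_pos_of_neg_of_neg
    · have := mul_neg_of_pos_of_neg hm hD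
      have : 0 ≤ r * (1 - T ^ 2) * (p + α * r) := by positivity
      linarith
    · exact mul_neg_of_neg_of_pos hD hμr

lemma RealReg.E2_norm {α μ κ T A B : ℝ} (h : Prm α μ κ T A B) {p ψ y : ℝ}
    (hreg : RealReg α μ A B p ψ) (hr : -y ^ 2 = κ - 4 * p) :
    ‖E2 α μ T p (-(y * I)) (p * T + α * μ - ψ)‖ = 1 := by
  have hμ := h.hμ
  have hD0 := hreg.D_ne h
  have hμr : (μ : ℂ) + -(y * I) ≠ 0 := by
    intro h0
    have := congrArg Complex.re h0
    simp at this
    linarith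
  have hμr' : (μ : ℂ) + (y * I) ≠ 0 := by
    intro h0
    have := congrArg Complex.re h0
    simp at this
    linarith
  have hD0' : ((p : ℂ) * T + α * μ - ψ) ≠ 0 := by exact_mod_cast hD0
  have hD : DRel α μ κ T p (p * T + α * μ - ψ) := h.dRel (by exact_mod_cast hreg.1)
  obtain ⟨D, hDe⟩ : ∃ D : ℝ, D = p * T + α * μ - ψ := ⟨_, rfl⟩
  have hDe' : (p : ℂ) * T + α * μ - ψ = D := by rw [hDe]; push_cast; ring
  rw [hDe'] at hD hD0' ⊢
  have e1 := E2_eq (α := α) (μ := μ) (T := T) (p := p) hD0' hμr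
  have e2 : conj (E2 α μ T p (-(y * I)) D) = E2 α μ T p (y * I) D := by
    simp only [E2, H2, map_add, map_mul, map_div₀, map_neg, map_one, map_sub, conj_ofReal, conj_I]
    ring_nf
  have e3 := E2_eq (α := α) (μ := μ) (T := T) (p := p) hD0' hμr'
  have hI : (y * I : ℂ) ^ 2 = κ - 4 * p := by
    rw [mul_pow, I_sq]
    have : (-y ^ 2 : ℂ) = κ - 4 * p := by exact_mod_cast hr
    linear_combination this
  have e4 : E2 α μ T p (-(y * I)) D * conj (E2 α μ T p (-(y * I)) D) = 1 := by
    rw [e2]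
    have hne : (D : ℂ) ^ 2 * ((μ + -(y * I)) * (μ + y * I)) ≠ 0 :=
      mul_ne_zero (pow_ne_zero 2 hD0') (mul_ne_zero hμr hμr')
    apply mul_right_cancel₀ hne
    have : E2 α μ T p (-(y * I)) D * E2 α μ T p (y * I) D *
      ((D : ℂ) ^ 2 * ((μ + -(y * I)) * (μ + y * I))) =
      (E2 α μ T p (-(y * I)) D * (D * (μ + -(y * I)))) *
      (E2 α μ T p (y * I) D * (D * (μ + y * I))) := by ring
    rw [this, e1, e3]
    simp only [DRel] at hD
    rw [← hI] at hD
    linear_combination ((y * I) ^ 2 * (1 - T ^ 2)) * hD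
  rw [Complex.mul_conj, Complex.normSq_eq_norm_sq] at e4
  have e5 : ‖E2 α μ T p (-(y * I)) D‖ ^ 2 = 1 := by exact_mod_cast e4
  nlinarith [norm_nonneg (E2 α μ T p (-(y * I)) D)]

lemma RealReg.E2_slit {α μ κ T A B : ℝ} (h : Prm α μ κ T A B) {p ψ y : ℝ}
    (hreg : RealReg α μ A B p ψ) (hr : -y ^ 2 = κ - 4 * p) (hy : y ≠ 0) :
    E2 α μ T p (-(y * I)) (p * T + α * μ - ψ) ∈ slitPlane := by
  by_contra hc
  obtain ⟨w, hw, he⟩ := not_slit hc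
  have hα := h.hα
  have hμ := h.hμ
  have hκ := h.hκ
  have hD0 := hreg.D_ne h
  have hp : 0 < p := by nlinarith [sq_nonneg y]
  have hμr : (μ : ℂ) + -(y * I) ≠ 0 := by
    intro h0
    have := congrArg Complex.re h0
    simp at this
    linarith
  have hpr : (p : ℂ) + α * -(y * I) ≠ 0 := by
    intro h0
    have := congrArg Complex.re h0
    simp at this
    linarith
  have hD0' : ((p : ℂ) * T + α * μ - ψ) ≠ 0 := by exact_mod_cast hD0
  have hD : DRel α μ κ T p (p * T + α * μ - ψ) := h.dRel (by exact_mod_cast hreg.1)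
  have hI : (-(y * I) : ℂ) ^ 2 = κ - 4 * p := by
    rw [neg_sq, mul_pow, I_sq]
    have : (-y ^ 2 : ℂ) = κ - 4 * p := by exact_mod_cast hr
    linear_combination this
  have key := congrArg Complex.re (h.E2_neg hI hμr hpr hD hD0' he)
  simp [pow_two] at key
  have hgpos : 0 < 1 + w ^ 2 - 2 * w * T := by
    have := h.hT1; have := h.hT2
    nlinarith [sq_nonneg (w - 1), sq_nonneg (w + 1), sq_nonneg (w - T)]
  have h1 : 0 < p * ((1 + w) ^ 2 * μ) := by positivity
  have h2 : 0 ≤ α * y ^ 2 * (1 + w ^ 2 - 2 * w * T) := by positivity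
  nlinarith

/-- The removable quotient `log w / (w - 1)`. -/
def logq (w : ℂ) : ℂ := dslope Complex.log 1 w

lemma logq_mul (w : ℂ) : (w - 1) * logq w = Complex.log w := by
  have := sub_smul_dslope Complex.log 1 w
  simpa [logq] using this

lemma logq_one : logq 1 = 1 := by
  simp [logq, dslope_same, (Complex.hasDerivAt_log one_mem_slitPlane).deriv]

/-- The antiderivative integrand. -/
def JJ (α μ T : ℝ) (p r D : ℂ) : ℂ :=
  4 * Complex.log (E1 α μ T p D) + 8 * α * H2 α μ T p r D * logq (E2 α μ T p r D)

lemma JJ_eq {α μ T : ℝ} {p r D : ℂ} (hr : r ≠ 0) : JJ α μ T p r D =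
    4 * Complex.log (E1 α μ T p D) + 8 * α / r * Complex.log (E2 α μ T p r D) := by
  have := logq_mul (E2 α μ T p r D)
  have e : E2 α μ T p r D - 1 = r * H2 α μ T p r D := by simp [E2]
  rw [e] at this
  rw [JJ, ← this]
  field_simp

lemma RealReg.E2_mem {α μ κ T A B : ℝ} (h : Prm α μ κ T A B) {p ψ : ℝ} {r : ℂ}
    (hreg : RealReg α μ A B p ψ) (hr : r ^ 2 = κ - 4 * p) (hre : 0 ≤ r.re) :
    E2 α μ T p r (p * T + α * μ - ψ) ∈ slitPlane := by
  have h1 := congrArg Complex.re hr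
  have h2 := congrArg Complex.im hr
  simp [pow_two] at h1 h2
  rcases (show r.im = 0 ∨ r.re = 0 by
    rcases mul_eq_zero.1 (show r.re * r.im = 0 by linarith) with h3 | h3 <;> simp [h3]) with h3 | h3
  · have hrr : r = (r.re : ℂ) := Complex.ext (by simp) (by simp [h3])
    rw [hrr]
    have e := hreg.E2_pos h (r := r.re) (by rw [h3] at h1; linarith) hre
    have e2 := ofReal_mem_slitPlane.2 e
    push_cast at e2
    simpa [E2, H2] using e2
  · by_cases h4 : r.im = 0
    · have : r = 0 := Complex.ext h3 h4
      simp [this, E2]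
    · have e := hreg.E2_slit h (y := -r.im) (by rw [h3] at h1; linarith) (by simpa using h4)
      have hrr : r = -(((-r.im : ℝ) : ℂ) * I) := Complex.ext (by simp [h3]) (by simp)
      rwa [← hrr] at e

lemma RealReg.JJ_im {α μ κ T A B : ℝ} (h : Prm α μ κ T A B) {p ψ : ℝ} {r : ℂ}
    (hreg : RealReg α μ A B p ψ) (hp : p ≠ α * μ) (hr : r ^ 2 = κ - 4 * p) (hre : 0 ≤ r.re) :
    (JJ α μ T p r (p * T + α * μ - ψ)).im = 0 := by
  have hl1 : Complex.log (E1 α μ T p (p * T + α * μ - ψ)) =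
      (Real.log ((1 - T) * (α * μ - p) / (p * T + α * μ - ψ)) : ℂ) := by
    rw [Complex.ofReal_log (hreg.E1_pos h hp).le]
    congr 1
    simp [E1]
  have h1 := congrArg Complex.re hr
  have h2 := congrArg Complex.im hr
  simp [pow_two] at h1 h2
  by_cases h0 : r = 0
  · subst h0
    rw [JJ, hl1]
    have : H2 α μ T p 0 (p * T + α * μ - ψ) =
      ((-(1 + T) * (1 + (1 - T) * p / (p * T + α * μ - ψ)) / μ : ℝ) : ℂ) := by
      simp [H2]
    rw [this]
    have e : E2 α μ T p 0 (p * T + α * μ - ψ) = 1 := by simp [E2]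
    rw [e, logq_one, mul_one]
    have : (4 * (Real.log ((1 - T) * (α * μ - p) / (p * T + α * μ - ψ)) : ℂ) + 8 * α *
      ((-(1 + T) * (1 + (1 - T) * p / (p * T + α * μ - ψ)) / μ : ℝ) : ℂ)) =
      ((4 * (Real.log ((1 - T) * (α * μ - p) / (p * T + α * μ - ψ))) + 8 * α *
      ((-(1 + T) * (1 + (1 - T) * p / (p * T + α * μ - ψ)) / μ)) : ℝ) : ℂ) := by push_cast; ring
    rw [this, ofReal_im]
  · rw [JJ_eq h0, hl1]
    rcases (show r.im = 0 ∨ r.re = 0 by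
      rcases mul_eq_zero.1 (show r.re * r.im = 0 by linarith) with h3 | h3 <;> simp [h3])
      with h3 | h3
    · have hrr : r = (r.re : ℂ) := Complex.ext (by simp) (by simp [h3])
      have e := hreg.E2_pos h (r := r.re) (by rw [h3] at h1; linarith) hre
      have e2 : E2 α μ T p r (p * T + α * μ - ψ) = ((1 + r.re * (-(1 + T) * (1 + (1 - T) *
        (p + α * r.re) / (p * T + α * μ - ψ)) / (μ + r.re)) : ℝ) : ℂ) := by
        rw [hrr]; push_cast; simp [E2, H2]
      rw [e2, ← Complex.ofReal_log e.le, hrr]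
      generalize Real.log _ = a
      generalize Real.log _ = b
      have : (4 * (a : ℂ) + 8 * α / r.re * b) = ((4 * a + 8 * α / r.re * b : ℝ) : ℂ) := by
        push_cast; ring
      rw [this, ofReal_im]
    · have h4 : r.im ≠ 0 := fun h4 => h0 (Complex.ext h3 h4)
      have e := hreg.E2_norm h (y := -r.im) (by rw [h3] at h1; linarith)
      have hrr : r = -(((-r.im : ℝ) : ℂ) * I) := Complex.ext (by simp [h3]) (by simp)
      rw [← hrr] at e
      have e2 : Complex.log (E2 α μ T p r (p * T + α * μ - ψ)) =
        (arg (E2 α μ T p r (p * T + α * μ - ψ)) : ℂ) * I := by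
        rw [Complex.log, e]; simp
      rw [e2]
      generalize Real.log _ = a
      generalize arg _ = b
      rw [hrr]
      have : (4 * (a : ℂ) + 8 * α / -(((-r.im : ℝ) : ℂ) * I) * (b * I)) =
        ((4 * a + 8 * α / r.im * b : ℝ) : ℂ) := by
        have : (r.im : ℂ) ≠ 0 := by exact_mod_cast h4
        push_cast
        field_simp
      rw [this, ofReal_im]

/-- The branch of `√(κ - 4p)` continuous on the closed upper half-plane, with positive real part. -/
def rr (κ : ℝ) (p : ℂ) : ℂ :=
  -I * (Complex.exp (I * (π : ℂ) / 4) * (-I * (4 * p - κ)) ^ ((1 : ℂ) / 2))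

lemma rr_sq (κ : ℝ) (p : ℂ) : rr κ p ^ 2 = κ - 4 * p := by
  have e : ((-I * (4 * p - κ)) ^ ((1 : ℂ) / 2)) ^ 2 = -I * (4 * p - κ) := by
    rw [← Complex.cpow_nat_mul]; simp
  have e2 : Complex.exp (I * (π : ℂ) / 4) ^ 2 = I := by
    rw [← Complex.exp_nat_mul]
    convert Complex.exp_pi_div_two_mul_I using 2
    push_cast; ring
  rw [rr, mul_pow, mul_pow, e, e2]
  linear_combination (4 * p - κ) * (1 - I ^ 2) * I_sq

lemma rr_eq_polar {κ : ℝ} {p : ℂ} (hp : 4 * p ≠ κ) : ∃ θ : ℝ, ∃ m : ℝ, 0 < m ∧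
    θ = arg (-I * (4 * p - κ)) / 2 - π / 4 ∧
    rr κ p = m * (Real.cos θ + Real.sin θ * I) := by
  have hne : -I * (4 * p - κ) ≠ 0 := by
    apply mul_ne_zero (by simp) (sub_ne_zero.2 hp)
  refine ⟨_, Real.exp (Real.log ‖-I * (4 * p - κ)‖ / 2), Real.exp_pos _, rfl, ?_⟩
  rw [rr, Complex.cpow_def_of_ne_zero hne, Complex.ofReal_exp, Complex.ofReal_cos,
    Complex.ofReal_sin, ← Complex.exp_mul_I, ← Complex.exp_add, ← Complex.exp_add]
  have : -I = Complex.exp (-(π / 2 * I)) := by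
    rw [Complex.exp_neg, Complex.exp_pi_div_two_mul_I, Complex.inv_I]
  nth_rewrite 1 [this]
  rw [← Complex.exp_add]
  congr 1
  rw [Complex.log]
  push_cast
  ring

lemma rr_re_nonneg {κ : ℝ} {p : ℂ} (hp : 0 ≤ p.im) : 0 ≤ (rr κ p).re := by
  by_cases h0 : 4 * p = κ
  · have := rr_sq κ p
    rw [h0, sub_self] at this
    rw [pow_eq_zero_iff (by norm_num)] at this
    simp [this]
  · obtain ⟨θ, m, hm, hθ, he⟩ := rr_eq_polar h0
    have h1 : |arg (-I * (4 * p - κ))| ≤ π / 2 := by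
      rw [Complex.abs_arg_le_pi_div_two_iff]
      simp [hp]
    rw [abs_le] at h1
    have h2 : 0 ≤ Real.cos θ := Real.cos_nonneg_of_neg_pi_div_two_le_of_le (by linarith)
      (by linarith [Real.pi_pos])
    rw [he, Complex.re_ofReal_mul]
    simp
    positivity

lemma rr_im_nonpos {κ : ℝ} {p : ℂ} (hp : 0 ≤ p.im) : (rr κ p).im ≤ 0 := by
  by_cases h0 : 4 * p = κ
  · have := rr_sq κ p
    rw [h0, sub_self] at this
    rw [pow_eq_zero_iff (by norm_num)] at this
    simp [this]
  · obtain ⟨θ, m, hm, hθ, he⟩ := rr_eq_polar h0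
    have h1 : |arg (-I * (4 * p - κ))| ≤ π / 2 := by
      rw [Complex.abs_arg_le_pi_div_two_iff]
      simp [hp]
    rw [abs_le] at h1
    have h2 : Real.sin θ ≤ 0 := Real.sin_nonpos_of_nonpos_of_neg_pi_le (by linarith)
      (by linarith [Real.pi_pos])
    rw [he, Complex.im_ofReal_mul]
    simp
    exact mul_nonpos_of_nonneg_of_nonpos hm.le h2

lemma rr_re_im (κ : ℝ) (p : ℂ) : 2 * (rr κ p).re * (rr κ p).im = -4 * p.im := by
  have := congrArg Complex.im (rr_sq κ p)
  simp [pow_two] at this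
  linarith

lemma rr_re_pos {κ : ℝ} {p : ℂ} (hp : 0 < p.im) : 0 < (rr κ p).re := by
  rcases (rr_re_nonneg (κ := κ) hp.le).eq_or_lt with h | h
  · have := rr_re_im κ p
    rw [← h] at this
    linarith
  · exact h

lemma rr_im_neg {κ : ℝ} {p : ℂ} (hp : 0 < p.im) : (rr κ p).im < 0 := by
  rcases (rr_im_nonpos (κ := κ) hp.le).eq_or_lt with h | h
  · have := rr_re_im κ p
    rw [h] at this
    linarith
  · exact h

lemma rr_ne {κ : ℝ} {p : ℂ} (hp : 0 < p.im) : rr κ p ≠ 0 := fun h => by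
  have := rr_re_pos (κ := κ) hp
  simp [h] at this

lemma rr_hasDerivAt {κ : ℝ} {p : ℂ} (hp : 0 < p.im) :
    HasDerivAt (rr κ) (-2 / rr κ p) p := by
  have hs : -I * (4 * p - κ) ∈ slitPlane := by
    left; simp [hp]
  have h1 : HasDerivAt (fun p : ℂ => -I * (4 * p - κ)) (-I * 4) p := by
    have := (((hasDerivAt_id p).const_mul 4).sub_const (κ : ℂ)).const_mul (-I)
    simpa using this
  have h2 := ((h1.cpow_const (c := (1 : ℂ) / 2) hs).const_mul
    (Complex.exp (I * (π : ℂ) / 4))).const_mul (-I)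
  have h3 : DifferentiableAt ℂ (rr κ) p := h2.differentiableAt
  have h4 := h3.hasDerivAt.pow 2
  have h5 : HasDerivAt (fun p : ℂ => (κ : ℂ) - 4 * p) (-4) p := by
    have := ((hasDerivAt_id p).const_mul 4).const_sub (κ : ℂ)
    simpa using this
  have h6 : (rr κ) ^ 2 = fun p : ℂ => (κ : ℂ) - 4 * p := by ext q; simp [rr_sq]
  rw [h6] at h4
  have h7 := h4.unique h5
  have hne := rr_ne (κ := κ) hp
  have : deriv (rr κ) p = -2 / rr κ p := by
    rw [eq_div_iff hne]
    push_cast at h7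
    simp at h7
    linear_combination h7 / 2
  rw [← this]
  exact h3.hasDerivAt

lemma rr_continuousOn (κ : ℝ) : ContinuousOn (rr κ) {p | 0 ≤ p.im} := by
  intro p hp
  apply ContinuousAt.continuousWithinAt
  have hp : 0 ≤ p.im := hp
  have h1 : ContinuousAt (fun p : ℂ => -I * (4 * p - κ)) p := by fun_prop
  have h2 : ContinuousAt (fun w : ℂ => w ^ ((1 : ℂ) / 2)) (-I * (4 * p - κ)) := by
    by_cases h0 : -I * (4 * p - κ) = 0
    · rw [h0]
      exact Complex.continuousAt_cpow_const_of_re_pos (by simp) (by simp)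
    · apply continuousAt_cpow_const
      rw [mem_slitPlane_iff]
      by_contra hc
      push Not at hc
      apply h0
      apply Complex.ext
      · have : 0 ≤ (-I * (4 * p - κ)).re := by simp [hp]
        simpa using le_antisymm hc.1 this
      · simpa using hc.2
  exact continuousAt_const.mul (continuousAt_const.mul (h2.comp_of_eq h1 rfl))

lemma eq_zero_of_exp {U : Set ℂ} (hU : IsPreconnected U) {f : ℂ → ℂ} (hf : ContinuousOn f U)
    (he : ∀ t ∈ U, Complex.exp (f t) = 1) {t₀ : ℂ} (h0 : t₀ ∈ U) (hi : (f t₀).im = 0)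
    {t : ℂ} (ht : t ∈ U) : f t = 0 := by
  have h_int : ∀ s ∈ U, ∃ n : ℤ, f s = n * (2 * π * I) := fun s hs =>
    Complex.exp_eq_one_iff.1 (he s hs)
  have hpre : IsPreconnected ((fun s => (f s).im) '' U) :=
    hU.image _ (Complex.continuous_im.comp_continuousOn hf)
  have hord := hpre.ordConnected
  obtain ⟨n, hn⟩ := h_int t ht
  have hnim : (f t).im = n * (2 * π) := by rw [hn]; simp
  have hpi := Real.pi_pos
  suffices hn0 : n = 0 by rw [hn, hn0]; simp
  by_contra hne
  have hsgn : (1 : ℝ) ≤ n ∨ (n : ℝ) ≤ -1 := by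
    rcases lt_trichotomy n 0 with h | h | h
    · right; exact_mod_cast (by omega : n ≤ -1)
    · exact absurd h hne
    · left; exact_mod_cast (by omega : 1 ≤ n)
  rcases hsgn with h | h
  · have hmem : π ∈ (fun s => (f s).im) '' U :=
      hord.out ⟨t₀, h0, rfl⟩ ⟨t, ht, rfl⟩ ⟨by simp [hi]; linarith, by simp [hnim]; nlinarith⟩
    obtain ⟨s, hs, hse⟩ := hmem
    obtain ⟨m, hm⟩ := h_int s hs
    simp [hm] at hse
    have : (m : ℝ) * 2 = 1 := by
      have : π * ((m : ℝ) * 2 - 1) = 0 := by linarith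
      rcases mul_eq_zero.1 this with h' | h' <;> linarith
    have : m * 2 = 1 := by exact_mod_cast this
    omega
  · have hmem : -π ∈ (fun s => (f s).im) '' U :=
      hord.out ⟨t, ht, rfl⟩ ⟨t₀, h0, rfl⟩ ⟨by simp [hnim]; nlinarith, by simp [hi]; linarith⟩
    obtain ⟨s, hs, hse⟩ := hmem
    obtain ⟨m, hm⟩ := h_int s hs
    simp [hm] at hse
    have : (m : ℝ) * 2 = -1 := by
      have : π * ((m : ℝ) * 2 + 1) = 0 := by linarith
      rcases mul_eq_zero.1 this with h' | h' <;> linarith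
    have : m * 2 = -1 := by exact_mod_cast this
    omega

lemma w1_slit {α κ : ℝ} (hα : 0 < α) (hκ : 0 < κ) {p : ℂ} (hp : 0 < p.im) :
    -I * (p + α * rr κ p) / (2 * α) ∈ slitPlane := by
  by_contra hc
  obtain ⟨k, hk, he⟩ := not_slit hc
  have hx := rr_re_pos (κ := κ) hp
  have hy := rr_im_neg (κ := κ) hp
  have hsq := rr_sq κ p
  have hαc : (2 * α : ℂ) ≠ 0 := by
    have : 2 * α ≠ 0 := by positivity
    exact_mod_cast this
  rw [div_eq_iff hαc] at he
  have h1 := congrArg Complex.re he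
  have h2 := congrArg Complex.im he
  have h3 := congrArg Complex.re hsq
  have h4 := rr_re_im κ p
  generalize rr κ p = r at *
  simp [pow_two] at h1 h2 h3
  have h5 : p.re = -(α * r.re) := by linarith
  have h6 : p.im = -(α * r.im) - k * (2 * α) := by linarith
  have h7 : r.re ≤ 2 * α := by
    have : (2 * α - r.re) * (-r.im) = 2 * (k * (2 * α)) := by 
      linear_combination h4 / 2 - 2 * h6
    have h8 : 0 ≤ (2 * α - r.re) * (-r.im) := by rw [this]; positivity
    by_contra h9
    push Not at h9
    have := mul_neg_of_neg_of_pos (by linarith : 2 * α - r.re < 0) (by linarith : 0 < -r.im)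
    linarith
  nlinarith [mul_pos hx hα, mul_nonneg hx.le (by linarith : 0 ≤ 2 * α - r.re), sq_nonneg r.im]

lemma w2_slit {α κ : ℝ} (hα : 0 < α) {p : ℂ} (hp : 0 < p.im) :
    -I * (p - α * rr κ p) / (2 * α) ∈ slitPlane := by
  left
  have hy := rr_im_neg (κ := κ) hp
  have : -I * (p - α * rr κ p) / (2 * α) = ((1 / (2 * α) : ℝ) : ℂ) * (-I * (p - α * rr κ p)) := by
    push_cast; ring
  rw [this, Complex.re_ofReal_mul]
  simp
  have := mul_pos_of_neg_of_neg (by linarith : -α < 0) hy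
  have h2 : 0 < p.im - α * (rr κ p).im := by linarith
  positivity

lemma n1_slit {μ : ℝ} {r : ℂ} (hr : 0 ≤ r.re) (hμ : 0 < μ) : -I * (μ + r) / 2 ∈ slitPlane := by
  right
  have : -I * (μ + r) / 2 = ((1 / 2 : ℝ) : ℂ) * (-I * (μ + r)) := by push_cast; ring
  rw [this, Complex.im_ofReal_mul]
  simp
  linarith

lemma n2_slit {μ : ℝ} {r : ℂ} (hr : r.im < 0) : -I * (μ - r) / 2 ∈ slitPlane := by
  left
  have : -I * (μ - r) / 2 = ((1 / 2 : ℝ) : ℂ) * (-I * (μ - r)) := by push_cast; ring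
  rw [this, Complex.re_ofReal_mul]
  simp
  linarith

def strip : Set ℂ := {t | 0 < t.im ∧ t.im < π}

lemma strip_eq : strip = Complex.im ⁻¹' Ioo 0 π := rfl

lemma strip_isOpen : IsOpen strip := isOpen_Ioo.preimage Complex.continuous_im

lemma strip_convex : Convex ℝ strip :=
  (convex_Ioo (𝕜 := ℝ) 0 π).is_linear_preimage (f := Complex.im) ⟨by simp, by simp⟩

lemma sinh_im' (t : ℂ) : (Complex.sinh t).im = Real.cosh t.re * Real.sin t.im := by
  conv_lhs => rw [← Complex.re_add_im t, Complex.sinh_add, Complex.sinh_mul_I, Complex.cosh_mul_I]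
  rw [← Complex.ofReal_cosh, ← Complex.ofReal_sinh, ← Complex.ofReal_sin, ← Complex.ofReal_cos]
  rw [← Complex.ofReal_mul, ← mul_assoc, ← Complex.ofReal_mul]
  simp
  left
  exact Complex.sin_ofReal_re _

def pt (A B : ℝ) (t : ℂ) : ℂ := A + B * Complex.sinh t

lemma pt_im (A B : ℝ) (t : ℂ) : (pt A B t).im = B * (Real.cosh t.re * Real.sin t.im) := by
  simp [pt, sinh_im']

lemma pt_im_pos {A B : ℝ} (hB : 0 < B) {t : ℂ} (ht : t ∈ strip) : 0 < (pt A B t).im := by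
  rw [pt_im]
  exact mul_pos hB (mul_pos (Real.cosh_pos _) (Real.sin_pos_of_pos_of_lt_pi ht.1 ht.2))

lemma pt_im_nonneg {A B : ℝ} (hB : 0 < B) {t : ℂ} (h1 : 0 ≤ t.im) (h2 : t.im ≤ π) :
    0 ≤ (pt A B t).im := by
  rw [pt_im]
  exact mul_nonneg hB.le (mul_nonneg (Real.cosh_pos _).le (Real.sin_nonneg_of_nonneg_of_le_pi h1 h2))

lemma psi_sq (A B : ℝ) (t : ℂ) : (B * Complex.cosh t) ^ 2 = (pt A B t - A) ^ 2 + (B : ℂ) ^ 2 := by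
  rw [pt, mul_pow, Complex.cosh_sq]; ring

/-- `D = pT + αμ - ψ` along the uniformization. -/
def Dt (α μ T A B : ℝ) (t : ℂ) : ℂ := pt A B t * T + α * μ - B * Complex.cosh t

/-- The conjugate sheet `pT + αμ + ψ`. -/
def Dt' (α μ T A B : ℝ) (t : ℂ) : ℂ := pt A B t * T + α * μ + B * Complex.cosh t

lemma Prm.dRel_t {α μ κ T A B : ℝ} (h : Prm α μ κ T A B) (t : ℂ) :
    DRel α μ κ T (pt A B t) (Dt α μ T A B t) := h.dRel (psi_sq A B t)

lemma Prm.dRel_t' {α μ κ T A B : ℝ} (h : Prm α μ κ T A B) (t : ℂ) :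
    DRel α μ κ T (pt A B t) (Dt' α μ T A B t) := by
  have := h.dRel (p := pt A B t) (ψ := -(B * Complex.cosh t)) (by rw [neg_sq, psi_sq])
  rwa [sub_neg_eq_add] at this

lemma DRel.mul {α μ κ T : ℝ} {p D D' : ℂ} (hD : DRel α μ κ T p D)
    (hs : D + D' = 2 * (p * T + α * μ)) :
    D * D' = -((1 - T ^ 2) * (p ^ 2 - α ^ 2 * (κ - 4 * p))) := by
  simp only [DRel] at hD
  linear_combination -hD + D * hs

lemma Dt_add (α μ T A B : ℝ) (t : ℂ) :
    Dt α μ T A B t + Dt' α μ T A B t = 2 * (pt A B t * T + α * μ) := by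
  simp only [Dt, Dt']; ring

lemma Prm.rho_ne {α μ κ T A B : ℝ} (h : Prm α μ κ T A B) : (1 - T ^ 2 : ℂ) ≠ 0 := by
  have := h.rho_pos.ne'
  exact_mod_cast this

lemma E2_mul {α μ κ T : ℝ} {p r D D' : ℂ} (hρ : (1 - T ^ 2 : ℂ) ≠ 0)
    (hr : r ^ 2 = κ - 4 * p) (hD : DRel α μ κ T p D)
    (hs : D + D' = 2 * (p * T + α * μ)) (hD0 : D ≠ 0) (hD0' : D' ≠ 0) (hμr : (μ : ℂ) + r ≠ 0) :
    E2 α μ T p r D * E2 α μ T p r D' * ((p - α * r) * (μ + r)) = (p + α * r) * (μ - r) := by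
  have h1 := E2_eq (α := α) (μ := μ) (T := T) (p := p) hD0 hμr
  have h2 := E2_eq (α := α) (μ := μ) (T := T) (p := p) hD0' hμr
  have hm := hD.mul hs
  rw [← hr] at hm
  have hm0 : D * D' ≠ 0 := mul_ne_zero hD0 hD0'
  have hp1 : p + α * r ≠ 0 := by
    intro h; apply hm0; rw [hm]; linear_combination -(1 - T ^ 2) * (p - α * r) * h
  have e : (E2 α μ T p r D * (D * (μ + r))) * (E2 α μ T p r D' * (D' * (μ + r))) =
    -(1 - T ^ 2) * (p + α * r) ^ 2 * (μ ^ 2 - r ^ 2) := by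
    rw [h1, h2]
    linear_combination (μ - r * T) ^ 2 * hm - (μ - r * T) * r * (1 - T ^ 2) * (p + α * r) * hs
  have e2 : -(1 - T ^ 2) * (p + α * r) * (μ + r) * (E2 α μ T p r D * E2 α μ T p r D' *
    ((p - α * r) * (μ + r))) = -(1 - T ^ 2) * (p + α * r) * (μ + r) * ((p + α * r) * (μ - r)) := by
    linear_combination e - E2 α μ T p r D * E2 α μ T p r D' * (μ + r) ^ 2 * hm
  apply mul_left_cancel₀ _ e2
  exact mul_ne_zero (mul_ne_zero (neg_ne_zero.2 hρ) hp1) hμr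

/-- `α Φ'` in the normalized variable. -/
def GG (α μ κ : ℝ) (p : ℂ) : ℂ :=
  4 * Complex.log ((α * μ - p) / (2 * α))
  - 2 * (Complex.log (-I * (p + α * rr κ p) / (2 * α)) +
      Complex.log (-I * (p - α * rr κ p) / (2 * α)))
  + 4 * α / rr κ p * (-Complex.log (-I * (μ + rr κ p) / 2) + Complex.log (-I * (μ - rr κ p) / 2)
      + Complex.log (-I * (p + α * rr κ p) / (2 * α))
      - Complex.log (-I * (p - α * rr κ p) / (2 * α)))

lemma strip_insert_preconnected (t₀ : ℝ) : IsPreconnected (insert (t₀ : ℂ) strip) := by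
  apply strip_convex.isPreconnected.subset_closure (subset_insert _ _)
  apply insert_subset _ subset_closure
  rw [strip_eq, ← Complex.isOpenMap_im.preimage_closure_eq_closure_preimage Complex.continuous_im,
    closure_Ioo Real.pi_pos.ne]
  simp [Real.pi_pos.le]

lemma pt_continuous (A B : ℝ) : Continuous (pt A B) := by
  unfold pt; fun_prop

lemma Dt_continuous (α μ T A B : ℝ) : Continuous (Dt α μ T A B) := by
  unfold Dt pt; fun_prop

lemma Dt'_continuous (α μ T A B : ℝ) : Continuous (Dt' α μ T A B) := by
  unfold Dt' pt; fun_prop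

lemma rr_pt_continuousOn {κ A B : ℝ} (hB : 0 < B) :
    ContinuousOn (fun t => rr κ (pt A B t)) {t | 0 ≤ t.im ∧ t.im ≤ π} :=
  (rr_continuousOn κ).comp (pt_continuous A B).continuousOn
    (fun _ ht => pt_im_nonneg hB ht.1 ht.2)

lemma strip_insert_subset (t₀ : ℝ) : insert (t₀ : ℂ) strip ⊆ {t | 0 ≤ t.im ∧ t.im ≤ π} := by
  apply insert_subset
  · simp [Real.pi_pos.le]
  · intro t ht; exact ⟨ht.1.le, ht.2.le⟩

lemma pt_arsinh {A B : ℝ} (hB : 0 < B) (p : ℝ) : pt A B (Real.arsinh ((p - A) / B) : ℝ) = p := by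
  rw [pt, ← Complex.ofReal_sinh, Real.sinh_arsinh]
  have : (B : ℂ) ≠ 0 := by exact_mod_cast hB.ne'
  push_cast
  field_simp
  ring

lemma Prm.log_E1_add {α μ κ T A B : ℝ} (h : Prm α μ κ T A B) {t : ℂ} (ht : t ∈ strip) :
    Complex.log (E1 α μ T (pt A B t) (Dt α μ T A B t)) +
      Complex.log (E1 α μ T (pt A B t) (Dt' α μ T A B t)) + Real.log ((1 + T) / (1 - T)) =
    2 * Complex.log ((α * μ - pt A B t) / (2 * α))
    - Complex.log (-I * (pt A B t + α * rr κ (pt A B t)) / (2 * α))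
    - Complex.log (-I * (pt A B t - α * rr κ (pt A B t)) / (2 * α)) := by
  have hα := h.hα
  have hμ := h.hμ
  have hκ := h.hκ
  have hT1 := h.hT1
  have hT2 := h.hT2
  have hρ := h.rho_pos
  obtain ⟨t₀, ht₀⟩ : ∃ t₀ : ℝ, pt A B t₀ = 0 := ⟨_, by simpa using pt_arsinh (A := A) h.hB 0⟩
  have hr0 : rr κ 0 = √κ := by
    have h1 := rr_sq κ 0
    have h2 := rr_re_nonneg (κ := κ) (p := 0) (by simp)
    have h3 := rr_re_im κ 0
    have h4 := congrArg Complex.re h1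
    simp [pow_two] at h3 h4
    have h5 : (rr κ 0).im = 0 := by
      rcases h3 with h3 | h3
      · rw [h3] at h4; nlinarith
      · exact h3
    apply Complex.ext
    · rw [h5] at h4
      simp
      rw [eq_comm, Real.sqrt_eq_iff_mul_self_eq hκ.le h2]
      linarith
    · simp [h5]
  obtain ⟨d, hd⟩ : ∃ d : ℝ, Dt α μ T A B t₀ = d :=
    ⟨α * μ - B * Real.cosh t₀, by simp [Dt, ht₀]⟩
  obtain ⟨d', hd'⟩ : ∃ d : ℝ, Dt' α μ T A B t₀ = d :=
    ⟨α * μ + B * Real.cosh t₀, by simp [Dt', ht₀]⟩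
  have hdd : 0 < d ∧ 0 < d' := by
    have h1 := Dt_add α μ T A B t₀
    have h2 := (h.dRel_t t₀).mul (Dt_add α μ T A B t₀)
    rw [hd, hd', ht₀] at h1 h2
    have h3 : d + d' = 2 * (α * μ) := by
      have : ((d + d' : ℝ) : ℂ) = ((2 * (α * μ) : ℝ) : ℂ) := by push_cast; rw [h1]; ring
      exact_mod_cast this
    have h4 : d * d' = (1 - T ^ 2) * (α ^ 2 * κ) := by
      have : ((d * d' : ℝ) : ℂ) = (((1 - T ^ 2) * (α ^ 2 * κ) : ℝ) : ℂ) := by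
        push_cast; rw [h2]; ring
      exact_mod_cast this
    have h5 : 0 < d * d' := by rw [h4]; positivity
    have h6 : 0 < d + d' := by rw [h3]; positivity
    rcases mul_pos_iff.1 h5 with h7 | h7
    · exact h7
    · linarith [h7.1, h7.2]
  have hsub := strip_insert_subset t₀
  have hpc : ContinuousOn (pt A B) (insert (t₀ : ℂ) strip) := (pt_continuous A B).continuousOn
  have hrc : ContinuousOn (fun t => rr κ (pt A B t)) (insert (t₀ : ℂ) strip) :=
    (rr_pt_continuousOn h.hB).mono hsub
  have hDc : ContinuousOn (Dt α μ T A B) (insert (t₀ : ℂ) strip) :=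
    (Dt_continuous α μ T A B).continuousOn
  have hDc' : ContinuousOn (Dt' α μ T A B) (insert (t₀ : ℂ) strip) :=
    (Dt'_continuous α μ T A B).continuousOn
  have hD0 : ∀ s ∈ insert (t₀ : ℂ) strip, Dt α μ T A B s ≠ 0 := by
    rintro s (rfl | hs)
    · rw [hd]; exact_mod_cast hdd.1.ne'
    · exact h.D_ne (pt_im_pos h.hB hs).ne' (h.dRel_t s)
  have hD0' : ∀ s ∈ insert (t₀ : ℂ) strip, Dt' α μ T A B s ≠ 0 := by
    rintro s (rfl | hs)
    · rw [hd']; exact_mod_cast hdd.2.ne'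
    · exact h.D_ne (pt_im_pos h.hB hs).ne' (h.dRel_t' s)
  have hα2 : (2 * α : ℂ) ≠ 0 := by exact_mod_cast (by positivity : 2 * α ≠ 0)
  have hTpos : 0 < 1 - T := by linarith
  have hαc : (α : ℂ) ≠ 0 := by exact_mod_cast hα.ne'
  have s1 : ∀ s ∈ insert (t₀ : ℂ) strip, E1 α μ T (pt A B s) (Dt α μ T A B s) ∈ slitPlane := by
    rintro s (rfl | hs)
    · have : E1 α μ T (pt A B t₀) (Dt α μ T A B t₀) = (((1 - T) * (α * μ) / d : ℝ) : ℂ) := by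
        rw [E1, ht₀, hd]; push_cast; ring
      rw [this, ofReal_mem_slitPlane]
      have := hdd.1
      positivity
    · exact h.E1_slit (pt_im_pos h.hB hs).ne' (h.dRel_t s)
  have s2 : ∀ s ∈ insert (t₀ : ℂ) strip, E1 α μ T (pt A B s) (Dt' α μ T A B s) ∈ slitPlane := by
    rintro s (rfl | hs)
    · have : E1 α μ T (pt A B t₀) (Dt' α μ T A B t₀) = (((1 - T) * (α * μ) / d' : ℝ) : ℂ) := by
        rw [E1, ht₀, hd']; push_cast; ring
      rw [this, ofReal_mem_slitPlane]
      have := hdd.2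
      positivity
    · exact h.E1_slit (pt_im_pos h.hB hs).ne' (h.dRel_t' s)
  have s3 : ∀ s ∈ insert (t₀ : ℂ) strip, (α * μ - pt A B s) / (2 * α) ∈ slitPlane := by
    rintro s (rfl | hs)
    · have : (α * μ - pt A B t₀) / (2 * α) = ((α * μ / (2 * α) : ℝ) : ℂ) := by
        rw [ht₀]; push_cast; ring
      rw [this, ofReal_mem_slitPlane]
      positivity
    · right
      have : (α * μ - pt A B s) / (2 * α) = ((1 / (2 * α) : ℝ) : ℂ) * (α * μ - pt A B s) := by
        push_cast; ring
      rw [this, Complex.im_ofReal_mul]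
      have := pt_im_pos (A := A) h.hB hs
      have h2 : (α * μ - pt A B s).im = -(pt A B s).im := by simp
      rw [h2]
      apply mul_ne_zero (by positivity)
      linarith
  have v4 : -I * (pt A B t₀ + α * rr κ (pt A B t₀)) / (2 * α) = ((√κ / 2 : ℝ) : ℂ) * -I := by
    rw [ht₀, hr0]; push_cast; field_simp; ring
  have v5 : -I * (pt A B t₀ - α * rr κ (pt A B t₀)) / (2 * α) = ((√κ / 2 : ℝ) : ℂ) * I := by
    rw [ht₀, hr0]; push_cast; field_simp; ring
  have hκs : 0 < √κ / 2 := by positivity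
  have s4 : ∀ s ∈ insert (t₀ : ℂ) strip,
      -I * (pt A B s + α * rr κ (pt A B s)) / (2 * α) ∈ slitPlane := by
    rintro s (rfl | hs)
    · rw [v4]; right; rw [Complex.im_ofReal_mul]; simp [hκ.le]; positivity
    · exact w1_slit hα hκ (pt_im_pos h.hB hs)
  have s5 : ∀ s ∈ insert (t₀ : ℂ) strip,
      -I * (pt A B s - α * rr κ (pt A B s)) / (2 * α) ∈ slitPlane := by
    rintro s (rfl | hs)
    · rw [v5]; right; rw [Complex.im_ofReal_mul]; simp [hκ.le]; positivity
    · exact w2_slit hα (pt_im_pos h.hB hs)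
  have key := eq_zero_of_exp (strip_insert_preconnected t₀) (f := fun t =>
    Complex.log (E1 α μ T (pt A B t) (Dt α μ T A B t)) +
      Complex.log (E1 α μ T (pt A B t) (Dt' α μ T A B t)) + Real.log ((1 + T) / (1 - T)) -
    (2 * Complex.log ((α * μ - pt A B t) / (2 * α))
    - Complex.log (-I * (pt A B t + α * rr κ (pt A B t)) / (2 * α))
    - Complex.log (-I * (pt A B t - α * rr κ (pt A B t)) / (2 * α)))) ?_ ?_
    (mem_insert _ _) ?_ (mem_insert_of_mem _ ht)
  · linear_combination key
  · apply ContinuousOn.sub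
    · refine ContinuousOn.add (ContinuousOn.add (ContinuousOn.clog ?_ s1)
        (ContinuousOn.clog ?_ s2)) continuousOn_const
      · unfold E1
        exact ContinuousOn.div (by fun_prop) hDc hD0
      · unfold E1
        exact ContinuousOn.div (by fun_prop) hDc' hD0'
    · refine ContinuousOn.sub (ContinuousOn.sub (continuousOn_const.mul (ContinuousOn.clog ?_ s3))
        (ContinuousOn.clog ?_ s4)) (ContinuousOn.clog ?_ s5)
      all_goals fun_prop
  · intro s hs
    have n1 := slitPlane_ne_zero (s1 s hs)
    have n2 := slitPlane_ne_zero (s2 s hs)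
    have n3 := slitPlane_ne_zero (s3 s hs)
    have n4 := slitPlane_ne_zero (s4 s hs)
    have n5 := slitPlane_ne_zero (s5 s hs)
    have hT3 : ((1 - T : ℝ) : ℂ) ≠ 0 := by exact_mod_cast hTpos.ne'
    push_cast at hT3
    rw [Complex.exp_sub, Complex.exp_add, Complex.exp_add, Complex.exp_sub, Complex.exp_sub,
      two_mul, Complex.exp_add, Complex.exp_log n1, Complex.exp_log n2, Complex.exp_log n3,
      Complex.exp_log n4, Complex.exp_log n5, ← Complex.ofReal_exp,
      Real.exp_log (div_pos (by linarith) hTpos)]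
    have hm := (h.dRel_t s).mul (Dt_add α μ T A B s)
    rw [← rr_sq] at hm
    have d1 := hD0 s hs
    have d2 := hD0' s hs
    generalize rr κ (pt A B s) = r at *
    generalize Dt α μ T A B s = D at *
    generalize Dt' α μ T A B s = D' at *
    generalize pt A B s = p at *
    have hρ2 := h.rho_ne
    have m1 : (α * μ - p : ℂ) ≠ 0 := fun hh => n3 (by rw [hh, zero_div])
    have m2 : (p + α * r : ℂ) ≠ 0 := fun hh => n4 (by rw [hh, mul_zero, zero_div])
    have m3 : (p - α * r : ℂ) ≠ 0 := fun hh => n5 (by rw [hh, mul_zero, zero_div])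
    have e1 : E1 α μ T p D * E1 α μ T p D' = (1 - T) ^ 2 * (α * μ - p) ^ 2 /
      (-((1 - T ^ 2) * (p ^ 2 - α ^ 2 * r ^ 2))) := by
      rw [← hm, E1, E1]; field_simp
    have m4 : (p ^ 2 - α ^ 2 * r ^ 2 : ℂ) ≠ 0 := by
      have := mul_ne_zero m2 m3
      intro hh; apply this; linear_combination hh
    have e2 : (-I * (p + α * r) / (2 * α)) * (-I * (p - α * r) / (2 * α)) =
      -(p ^ 2 - α ^ 2 * r ^ 2) / (4 * α ^ 2) := by
      field_simp
      linear_combination 4 * (p ^ 2 - α ^ 2 * r ^ 2) * I_sq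
    rw [e1, div_div, div_div_eq_mul_div, e2]
    push_cast
    field_simp
    ring
  · rw [v4, v5]
    have l1 : Complex.log (E1 α μ T (pt A B t₀) (Dt α μ T A B t₀)) =
      (Real.log ((1 - T) * (α * μ) / d) : ℂ) := by
      have := hdd.1
      rw [Complex.ofReal_log (by positivity)]
      congr 1
      rw [E1, ht₀, hd]; push_cast; ring
    have l2 : Complex.log (E1 α μ T (pt A B t₀) (Dt' α μ T A B t₀)) =
      (Real.log ((1 - T) * (α * μ) / d') : ℂ) := by
      have := hdd.2
      rw [Complex.ofReal_log (by positivity)]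
      congr 1
      rw [E1, ht₀, hd']; push_cast; ring
    have l3 : Complex.log ((α * μ - pt A B t₀) / (2 * α)) = (Real.log (α * μ / (2 * α)) : ℂ) := by
      rw [Complex.ofReal_log (by positivity)]
      congr 1
      rw [ht₀]; push_cast; ring
    rw [l1, l2, l3]
    simp only [Complex.sub_im, Complex.add_im, Complex.ofReal_im, Complex.log_im]
    rw [Complex.arg_real_mul _ hκs, Complex.arg_real_mul _ hκs, Complex.arg_I, Complex.arg_neg_I]
    simp

lemma Prm.log_E2_add {α μ κ T A B : ℝ} (h : Prm α μ κ T A B) {t : ℂ} (ht : t ∈ strip) :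
    Complex.log (E2 α μ T (pt A B t) (rr κ (pt A B t)) (Dt α μ T A B t)) +
      Complex.log (E2 α μ T (pt A B t) (rr κ (pt A B t)) (Dt' α μ T A B t)) =
    -Complex.log (-I * (μ + rr κ (pt A B t)) / 2) + Complex.log (-I * (μ - rr κ (pt A B t)) / 2)
      + Complex.log (-I * (pt A B t + α * rr κ (pt A B t)) / (2 * α))
      - Complex.log (-I * (pt A B t - α * rr κ (pt A B t)) / (2 * α)) := by
  have hα := h.hα
  have hμ := h.hμ
  have hκ := h.hκ
  have hρ := h.rho_pos
  obtain ⟨t₀, ht₀⟩ : ∃ t₀ : ℝ, pt A B t₀ = (κ / 4 : ℝ) := ⟨_, pt_arsinh (A := A) h.hB (κ / 4)⟩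
  have hr0 : rr κ (κ / 4 : ℝ) = 0 := by
    have h1 := rr_sq κ (κ / 4 : ℝ)
    rw [← pow_eq_zero_iff two_ne_zero, h1]
    push_cast
    ring
  have hdd : Dt α μ T A B t₀ ≠ 0 ∧ Dt' α μ T A B t₀ ≠ 0 := by
    have h2 := (h.dRel_t t₀).mul (Dt_add α μ T A B t₀)
    rw [ht₀, ← rr_sq, hr0] at h2
    rw [← mul_ne_zero_iff, h2]
    have : -((1 - T ^ 2) * ((κ / 4) ^ 2)) ≠ 0 := neg_ne_zero.2 (by positivity)
    have : (-((1 - T ^ 2) * ((κ / 4) ^ 2)) : ℂ) ≠ 0 := by exact_mod_cast this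
    convert this using 1
    push_cast
    ring
  have hsub := strip_insert_subset t₀
  have hpc : ContinuousOn (pt A B) (insert (t₀ : ℂ) strip) := (pt_continuous A B).continuousOn
  have hrc : ContinuousOn (fun t => rr κ (pt A B t)) (insert (t₀ : ℂ) strip) :=
    (rr_pt_continuousOn h.hB).mono hsub
  have hDc : ContinuousOn (Dt α μ T A B) (insert (t₀ : ℂ) strip) :=
    (Dt_continuous α μ T A B).continuousOn
  have hDc' : ContinuousOn (Dt' α μ T A B) (insert (t₀ : ℂ) strip) :=
    (Dt'_continuous α μ T A B).continuousOn
  have hD0 : ∀ s ∈ insert (t₀ : ℂ) strip, Dt α μ T A B s ≠ 0 := by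
    rintro s (rfl | hs)
    · exact hdd.1
    · exact h.D_ne (pt_im_pos h.hB hs).ne' (h.dRel_t s)
  have hD0' : ∀ s ∈ insert (t₀ : ℂ) strip, Dt' α μ T A B s ≠ 0 := by
    rintro s (rfl | hs)
    · exact hdd.2
    · exact h.D_ne (pt_im_pos h.hB hs).ne' (h.dRel_t' s)
  have hα2 : (2 * α : ℂ) ≠ 0 := by exact_mod_cast (by positivity : 2 * α ≠ 0)
  have hαc : (α : ℂ) ≠ 0 := by exact_mod_cast hα.ne'
  have s1 : ∀ s ∈ insert (t₀ : ℂ) strip,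
      E2 α μ T (pt A B s) (rr κ (pt A B s)) (Dt α μ T A B s) ∈ slitPlane := by
    rintro s (rfl | hs)
    · rw [ht₀, hr0]; simp [E2]
    · exact h.E2_slit (pt_im_pos h.hB hs).ne' (rr_sq _ _) (rr_re_pos (pt_im_pos h.hB hs))
        (h.dRel_t s)
  have s2 : ∀ s ∈ insert (t₀ : ℂ) strip,
      E2 α μ T (pt A B s) (rr κ (pt A B s)) (Dt' α μ T A B s) ∈ slitPlane := by
    rintro s (rfl | hs)
    · rw [ht₀, hr0]; simp [E2]
    · exact h.E2_slit (pt_im_pos h.hB hs).ne' (rr_sq _ _) (rr_re_pos (pt_im_pos h.hB hs))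
        (h.dRel_t' s)
  have hre : ∀ s ∈ insert (t₀ : ℂ) strip, 0 ≤ (rr κ (pt A B s)).re := fun s hs =>
    rr_re_nonneg (pt_im_nonneg h.hB (hsub hs).1 (hsub hs).2)
  have hμr : ∀ s ∈ insert (t₀ : ℂ) strip, (μ : ℂ) + rr κ (pt A B s) ≠ 0 := by
    intro s hs h0
    have h1 := congrArg Complex.re h0
    have h2 := hre s hs
    simp at h1
    linarith
  have s3 : ∀ s ∈ insert (t₀ : ℂ) strip, -I * (μ + rr κ (pt A B s)) / 2 ∈ slitPlane :=
    fun s hs => n1_slit (hre s hs) hμ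
  have s3' : ∀ s ∈ insert (t₀ : ℂ) strip, -I * (μ - rr κ (pt A B s)) / 2 ∈ slitPlane := by
    rintro s (rfl | hs)
    · rw [ht₀, hr0]; simpa using n1_slit (r := 0) (by simp) hμ
    · exact n2_slit (rr_im_neg (pt_im_pos h.hB hs))
  have v4 : -I * (pt A B t₀) / (2 * α) = ((κ / (8 * α) : ℝ) : ℂ) * -I := by
    rw [ht₀]; push_cast; field_simp; ring
  have hκs : 0 < κ / (8 * α) := by positivity
  have s4 : ∀ s ∈ insert (t₀ : ℂ) strip,
      -I * (pt A B s + α * rr κ (pt A B s)) / (2 * α) ∈ slitPlane := by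
    rintro s (rfl | hs)
    · nth_rewrite 2 [ht₀]
      rw [hr0, mul_zero, add_zero, v4]; right; rw [Complex.im_ofReal_mul]; simp [hκ.ne', hα.ne']
    · exact w1_slit hα hκ (pt_im_pos h.hB hs)
  have s5 : ∀ s ∈ insert (t₀ : ℂ) strip,
      -I * (pt A B s - α * rr κ (pt A B s)) / (2 * α) ∈ slitPlane := by
    rintro s (rfl | hs)
    · nth_rewrite 2 [ht₀]
      rw [hr0, mul_zero, sub_zero, v4]; right; rw [Complex.im_ofReal_mul]; simp [hκ.ne', hα.ne']
    · exact w2_slit hα (pt_im_pos h.hB hs)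
  have key := eq_zero_of_exp (strip_insert_preconnected t₀) (f := fun t =>
    Complex.log (E2 α μ T (pt A B t) (rr κ (pt A B t)) (Dt α μ T A B t)) +
      Complex.log (E2 α μ T (pt A B t) (rr κ (pt A B t)) (Dt' α μ T A B t)) -
    (-Complex.log (-I * (μ + rr κ (pt A B t)) / 2) + Complex.log (-I * (μ - rr κ (pt A B t)) / 2)
      + Complex.log (-I * (pt A B t + α * rr κ (pt A B t)) / (2 * α))
      - Complex.log (-I * (pt A B t - α * rr κ (pt A B t)) / (2 * α)))) ?_ ?_
    (mem_insert _ _) ?_ (mem_insert_of_mem _ ht)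
  · linear_combination key
  · apply ContinuousOn.sub
    · refine ContinuousOn.add (ContinuousOn.clog ?_ s1) (ContinuousOn.clog ?_ s2)
      · unfold E2 H2
        have e1 : ContinuousOn (fun t => (1 - T) * (pt A B t + α * rr κ (pt A B t)) /
          Dt α μ T A B t) (insert (t₀ : ℂ) strip) := ContinuousOn.div (by fun_prop) hDc hD0
        exact continuousOn_const.add (hrc.mul (ContinuousOn.div
          (continuousOn_const.mul (continuousOn_const.add e1)) (by fun_prop) hμr))
      · unfold E2 H2
        have e1 : ContinuousOn (fun t => (1 - T) * (pt A B t + α * rr κ (pt A B t)) /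
          Dt' α μ T A B t) (insert (t₀ : ℂ) strip) := ContinuousOn.div (by fun_prop) hDc' hD0'
        exact continuousOn_const.add (hrc.mul (ContinuousOn.div
          (continuousOn_const.mul (continuousOn_const.add e1)) (by fun_prop) hμr))
    · refine ContinuousOn.sub (ContinuousOn.add (ContinuousOn.add (ContinuousOn.neg
        (ContinuousOn.clog ?_ s3)) (ContinuousOn.clog ?_ s3')) (ContinuousOn.clog ?_ s4))
        (ContinuousOn.clog ?_ s5)
      all_goals fun_prop
  · intro s hs
    have n1 := slitPlane_ne_zero (s1 s hs)
    have n2 := slitPlane_ne_zero (s2 s hs)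
    have n3 := slitPlane_ne_zero (s3 s hs)
    have n3' := slitPlane_ne_zero (s3' s hs)
    have n4 := slitPlane_ne_zero (s4 s hs)
    have n5 := slitPlane_ne_zero (s5 s hs)
    have hm := E2_mul h.rho_ne (rr_sq κ _) (h.dRel_t s) (Dt_add α μ T A B s) (hD0 s hs)
      (hD0' s hs) (hμr s hs)
    rw [Complex.exp_sub, Complex.exp_add, Complex.exp_sub, Complex.exp_add, Complex.exp_add,
      Complex.exp_neg, Complex.exp_log n1, Complex.exp_log n2, Complex.exp_log n3,
      Complex.exp_log n3', Complex.exp_log n4, Complex.exp_log n5]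
    generalize E2 α μ T (pt A B s) (rr κ (pt A B s)) (Dt α μ T A B s) = e at *
    generalize E2 α μ T (pt A B s) (rr κ (pt A B s)) (Dt' α μ T A B s) = e' at *
    generalize rr κ (pt A B s) = r at *
    generalize pt A B s = p at *
    have m2 : (p + α * r : ℂ) ≠ 0 := fun hh => n4 (by rw [hh, mul_zero, zero_div])
    have m3 : (p - α * r : ℂ) ≠ 0 := fun hh => n5 (by rw [hh, mul_zero, zero_div])
    have m4 : (μ + r : ℂ) ≠ 0 := fun hh => n3 (by rw [hh, mul_zero, zero_div])
    have m5 : (μ - r : ℂ) ≠ 0 := fun hh => n3' (by rw [hh, mul_zero, zero_div])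
    have hee : e * e' = (p + α * r) * (μ - r) / ((p - α * r) * (μ + r)) := by
      rw [eq_div_iff (mul_ne_zero m3 m4)]; exact hm
    rw [hee]
    have := I_ne_zero
    field_simp
  · simp only [ht₀, hr0, mul_zero, add_zero, sub_zero, E2, zero_mul, Complex.log_one]
    simp

/-- The functional equation relating the two sheets to `α Φ'`. -/
lemma Prm.JJ_add {α μ κ T A B : ℝ} (h : Prm α μ κ T A B) {t : ℂ} (ht : t ∈ strip) :
    JJ α μ T (pt A B t) (rr κ (pt A B t)) (Dt α μ T A B t) +
      JJ α μ T (pt A B t) (rr κ (pt A B t)) (Dt' α μ T A B t) =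
    2 * (GG α μ κ (pt A B t) - 2 * Real.log ((1 + T) / (1 - T))) := by
  have hr := rr_ne (κ := κ) (pt_im_pos (A := A) h.hB ht)
  have h1 := h.log_E1_add ht
  have h2 := h.log_E2_add ht
  rw [JJ_eq hr, JJ_eq hr, GG]
  linear_combination 4 * h1 + 8 * α / rr κ (pt A B t) * h2

lemma Rf_eq (α δ μ : ℝ) (z : ℂ) :
    Rf μ z = I * rr (μ ^ 2 - 4 * (1 - α * δ)) (4 * z - (1 - α * δ)) := by
  rw [Rf, rr]
  have : (16 * z - (μ : ℂ) ^ 2) = 4 * (4 * z - (1 - α * δ)) -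
    ((μ ^ 2 - 4 * (1 - α * δ) : ℝ) : ℂ) := by push_cast; ring
  rw [this]
  linear_combination (Complex.exp (I * π / 4) * (-I * (4 * (4 * z - (1 - α * δ)) -
    ((μ ^ 2 - 4 * (1 - α * δ) : ℝ) : ℂ))) ^ ((1 : ℂ) / 2)) * I_sq

lemma HasDerivAt.mul_clog {f : ℂ → ℂ} {f' z : ℂ} (hf : HasDerivAt f f' z)
    (h : f z ∈ slitPlane) :
    HasDerivAt (fun z => f z * Complex.log (f z)) (f' * (Complex.log (f z) + 1)) z := by
  refine (hf.mul (hf.clog h)).congr_deriv ?_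
  have := slitPlane_ne_zero h
  field_simp

lemma hasDerivAt_Phi {α δ μ : ℝ} (hα : 0 < α) (hμ : 0 < μ) (hκ : 0 < μ ^ 2 - 4 * (1 - α * δ))
    {z : ℂ} (hz : 0 < z.im) :
    HasDerivAt (Phi α δ μ) (GG α μ (μ ^ 2 - 4 * (1 - α * δ)) (4 * z - (1 - α * δ)) / α) z := by
  obtain ⟨κ, hκe⟩ : ∃ κ : ℝ, κ = μ ^ 2 - 4 * (1 - α * δ) := ⟨_, rfl⟩
  have hαc : (α : ℂ) ≠ 0 := by exact_mod_cast hα.ne'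
  have hR : ∀ z, Rf μ z = I * rr κ (4 * z - (1 - α * δ)) := by
    intro z; rw [hκe]; exact Rf_eq α δ μ z
  rw [← hκe] at hκ ⊢
  let a : ℂ → ℂ := fun z => (α * μ - (4 * z - (1 - α * δ))) / (2 * α)
  let p : ℂ → ℂ := fun z => 4 * z - (1 - α * δ)
  let n1 : ℂ → ℂ := fun z => -I * (μ + rr κ (p z)) / 2
  let n2 : ℂ → ℂ := fun z => -I * (μ - rr κ (p z)) / 2
  let w1 : ℂ → ℂ := fun z => -I * (p z + α * rr κ (p z)) / (2 * α)
  let w2 : ℂ → ℂ := fun z => -I * (p z - α * rr κ (p z)) / (2 * α)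
  have hPhi : Phi α δ μ = fun z => -(μ : ℂ) * Complex.log 2 - 2 * (a z * Complex.log (a z))
      + I * (n1 z * Complex.log (n1 z)) + I * (n2 z * Complex.log (n2 z))
      - I * (w1 z * Complex.log (w1 z)) - I * (w2 z * Complex.log (w2 z)) := by
    ext z
    have ha : (2 / (α : ℂ)) * ((zP α δ μ : ℂ) - z) = a z := by
      simp only [a, zP]; push_cast; field_simp; ring
    have ha2 : (4 / (α : ℂ)) * (z - (zP α δ μ : ℂ)) = -2 * a z := by
      rw [← ha]; ring
    have e1 : (-I * (μ : ℂ) - Rf μ z) / 2 = n1 z := by simp only [n1, p, hR]; ring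
    have e2 : (-I * (μ : ℂ) + Rf μ z) / 2 = n2 z := by simp only [n2, p, hR]; ring
    have e3 : ((μ : ℂ) - I * Rf μ z) / 2 = I * n1 z := by
      rw [← e1]; linear_combination (μ / 2 : ℂ) * I_sq
    have e4 : ((μ : ℂ) + I * Rf μ z) / 2 = I * n2 z := by
      rw [← e2]; linear_combination (μ / 2 : ℂ) * I_sq
    have hO : Omg α δ z = -I * p z / (2 * α) := by
      simp only [Omg, p]
      have := I_ne_zero
      field_simp
      linear_combination (4 * (4 * z - (1 - α * δ))) * I_sq
    have e5 : Omg α δ z - Rf μ z / 2 = w1 z := by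
      rw [hO, hR]; simp only [w1, p]; field_simp; ring
    have e6 : Omg α δ z + Rf μ z / 2 = w2 z := by
      rw [hO, hR]; simp only [w2, p]; field_simp; ring
    rw [Phi, ha, ha2, e1, e2, e3, e4, e5, e6]
    ring
  have hp : 0 < (p z).im := by
    have : (p z).im = 4 * z.im := by simp [p]
    rw [this]; linarith
  have dp : HasDerivAt p 4 z := by
    have := ((hasDerivAt_id z).const_mul 4).sub_const (1 - α * δ : ℂ)
    simpa [p] using this
  have dr : HasDerivAt (fun z => rr κ (p z)) (-2 / rr κ (p z) * 4) z :=
    (rr_hasDerivAt hp).comp z dp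
  have da : HasDerivAt a (-4 / (2 * α)) z := (dp.const_sub (α * μ : ℂ)).div_const (2 * α)
  have dn1 := ((dr.const_add (μ : ℂ)).const_mul (-I)).div_const 2
  have dn2 := ((dr.const_sub (μ : ℂ)).const_mul (-I)).div_const 2
  have dw1 := ((dp.add (dr.const_mul (α : ℂ))).const_mul (-I)).div_const (2 * α)
  have dw2 := ((dp.sub (dr.const_mul (α : ℂ))).const_mul (-I)).div_const (2 * α)
  have hre := rr_re_pos (κ := κ) hp
  have sa : a z ∈ slitPlane := by
    right
    have : a z = ((1 / (2 * α) : ℝ) : ℂ) * (α * μ - p z) := by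
      simp only [a, p]; push_cast; ring
    rw [this, Complex.im_ofReal_mul]
    have h2 : (α * μ - p z).im = -(p z).im := by simp
    rw [h2]
    apply mul_ne_zero (by positivity)
    linarith
  have D := (((((da.mul_clog sa).const_mul 2).const_sub (-(μ : ℂ) * Complex.log 2)).add
    ((dn1.mul_clog (n1_slit hre.le hμ)).const_mul I)).add
    ((dn2.mul_clog (n2_slit (rr_im_neg hp))).const_mul I)).sub
    ((dw1.mul_clog (w1_slit hα hκ hp)).const_mul I) |>.sub
    ((dw2.mul_clog (w2_slit hα hp)).const_mul I)
  rw [hPhi]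
  refine D.congr_deriv ?_
  have hr0 := rr_ne (κ := κ) hp
  change _ = GG α μ κ (p z) / α
  rw [GG]
  have ha : (α * μ - p z) / (2 * α) = a z := rfl
  rw [ha]
  simp only [Pi.add_apply, Pi.sub_apply]
  generalize Complex.log (a z) = la
  generalize Complex.log (-I * (μ + rr κ (p z)) / 2) = l1
  generalize Complex.log (-I * (μ - rr κ (p z)) / 2) = l2
  generalize Complex.log (-I * (p z + α * rr κ (p z)) / (2 * α)) = l3
  generalize Complex.log (-I * (p z - α * rr κ (p z)) / (2 * α)) = l4
  generalize rr κ (p z) = r at *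
  have hI : ∀ x y : ℂ, I * (-I * x / y) = x / y := by
    intro x y; linear_combination (-x / y) * I_sq
  simp only [← mul_assoc I, hI]
  field_simp
  ring

lemma logq_differentiableAt {w : ℂ} (hw : w ∈ slitPlane) : DifferentiableAt ℂ logq w := by
  have h : DifferentiableOn ℂ (dslope Complex.log 1) slitPlane := by
    rw [Complex.differentiableOn_dslope (Complex.isOpen_slitPlane.mem_nhds one_mem_slitPlane)]
    exact fun z hz => (Complex.differentiableAt_log hz).differentiableWithinAt
  exact (h w hw).differentiableAt (Complex.isOpen_slitPlane.mem_nhds hw)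

/-- The integrand on the strip, with weight `(p - A) ^ k`. -/
def FF (α μ κ T A B : ℝ) (k : ℕ) (t : ℂ) : ℂ :=
  JJ α μ T (pt A B t) (rr κ (pt A B t)) (Dt α μ T A B t) * (pt A B t - A) ^ k

lemma Prm.FF_differentiableAt {α μ κ T A B : ℝ} (h : Prm α μ κ T A B) (k : ℕ) {t : ℂ}
    (ht : t ∈ strip) : DifferentiableAt ℂ (FF α μ κ T A B k) t := by
  have hp := pt_im_pos (A := A) h.hB ht
  have hD := h.dRel_t t
  have hre := rr_re_pos (κ := κ) hp
  have hD0 := h.D_ne hp.ne' hD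
  have hμr : (μ : ℂ) + rr κ (pt A B t) ≠ 0 := by
    intro h0
    have := congrArg Complex.re h0
    simp at this
    linarith [h.hμ]
  have h1 : E1 α μ T (pt A B t) (Dt α μ T A B t) ∈ slitPlane := h.E1_slit hp.ne' hD
  have h2 : E2 α μ T (pt A B t) (rr κ (pt A B t)) (Dt α μ T A B t) ∈ slitPlane :=
    h.E2_slit hp.ne' (rr_sq κ _) hre hD
  have dp : DifferentiableAt ℂ (pt A B) t := by unfold pt; fun_prop
  have dr : DifferentiableAt ℂ (fun t => rr κ (pt A B t)) t :=
    (rr_hasDerivAt hp).differentiableAt.comp t dp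
  have dD : DifferentiableAt ℂ (Dt α μ T A B) t := by unfold Dt pt; fun_prop
  have dE1 : DifferentiableAt ℂ (fun t => E1 α μ T (pt A B t) (Dt α μ T A B t)) t := by
    unfold E1
    exact ((dp.const_sub _).const_mul _).div dD hD0
  have dH2 : DifferentiableAt ℂ
      (fun t => H2 α μ T (pt A B t) (rr κ (pt A B t)) (Dt α μ T A B t)) t := by
    unfold H2
    exact (((((dp.add (dr.const_mul _)).const_mul _).div dD hD0).const_add _).const_mul _).div
      (dr.const_add _) hμr
  have dE2 : DifferentiableAt ℂ
      (fun t => E2 α μ T (pt A B t) (rr κ (pt A B t)) (Dt α μ T A B t)) t := by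
    unfold E2
    exact (dr.mul dH2).const_add _
  have dq : DifferentiableAt ℂ
      (fun t => logq (E2 α μ T (pt A B t) (rr κ (pt A B t)) (Dt α μ T A B t))) t :=
    DifferentiableAt.comp t (logq_differentiableAt h2) dE2
  unfold FF JJ
  exact (((dE1.clog h1).const_mul _).add ((dH2.const_mul _).mul dq)).mul ((dp.sub_const _).pow k)

/-- The closed strip. -/
def cstrip : Set ℂ := {t | 0 ≤ t.im ∧ t.im ≤ π}

lemma strip_subset_cstrip : strip ⊆ cstrip := fun _ h => ⟨h.1.le, h.2.le⟩

section boundary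

variable {α μ κ T A B : ℝ} {c : ℂ}

lemma Prm.mu_add_ne (h : Prm α μ κ T A B) (hc : c ∈ cstrip) :
    (μ : ℂ) + rr κ (pt A B c) ≠ 0 := by
  intro h0
  have h1 := congrArg Complex.re h0
  have := rr_re_nonneg (κ := κ) (pt_im_nonneg (A := A) h.hB hc.1 hc.2)
  simp at h1
  linarith [h.hμ]

lemma Prm.H2_continuousWithinAt (h : Prm α μ κ T A B) (hc : c ∈ cstrip)
    (hD0 : Dt α μ T A B c ≠ 0) : ContinuousWithinAt
      (fun t => H2 α μ T (pt A B t) (rr κ (pt A B t)) (Dt α μ T A B t)) cstrip c := by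
  have cp := (pt_continuous A B).continuousWithinAt (s := cstrip) (x := c)
  have cr : ContinuousWithinAt (fun t => rr κ (pt A B t)) cstrip c :=
    rr_pt_continuousOn h.hB c hc
  have cD := (Dt_continuous α μ T A B).continuousWithinAt (s := cstrip) (x := c)
  unfold H2
  exact ((((((cp.add (cr.const_mul _)).const_mul _).div cD hD0).const_add _)).const_mul _).div
    (cr.const_add _) (h.mu_add_ne hc)

lemma Prm.regular_continuousWithinAt (h : Prm α μ κ T A B) (hc : c ∈ cstrip)
    (hD0 : Dt α μ T A B c ≠ 0)
    (h2 : E2 α μ T (pt A B c) (rr κ (pt A B c)) (Dt α μ T A B c) ∈ slitPlane) :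
    ContinuousWithinAt
      (fun t => 8 * α * H2 α μ T (pt A B t) (rr κ (pt A B t)) (Dt α μ T A B t) *
        logq (E2 α μ T (pt A B t) (rr κ (pt A B t)) (Dt α μ T A B t))) cstrip c := by
  have cr : ContinuousWithinAt (fun t => rr κ (pt A B t)) cstrip c :=
    rr_pt_continuousOn h.hB c hc
  have cH := h.H2_continuousWithinAt hc hD0
  have cE : ContinuousWithinAt
      (fun t => E2 α μ T (pt A B t) (rr κ (pt A B t)) (Dt α μ T A B t)) cstrip c := by
    unfold E2
    exact (cr.mul cH).const_add _
  exact (cH.const_mul _).mul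
    (ContinuousAt.comp_continuousWithinAt (logq_differentiableAt h2).continuousAt cE)

lemma Prm.FF_continuousWithinAt (h : Prm α μ κ T A B) (k : ℕ) (hc : c ∈ cstrip)
    (hD0 : Dt α μ T A B c ≠ 0) (h1 : E1 α μ T (pt A B c) (Dt α μ T A B c) ∈ slitPlane)
    (h2 : E2 α μ T (pt A B c) (rr κ (pt A B c)) (Dt α μ T A B c) ∈ slitPlane) :
    ContinuousWithinAt (FF α μ κ T A B k) cstrip c := by
  have cp := (pt_continuous A B).continuousWithinAt (s := cstrip) (x := c)
  have cD := (Dt_continuous α μ T A B).continuousWithinAt (s := cstrip) (x := c)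
  have cE1 : ContinuousWithinAt (fun t => E1 α μ T (pt A B t) (Dt α μ T A B t)) cstrip c := by
    unfold E1
    exact ((continuousWithinAt_const.sub cp).const_mul _).div cD hD0
  unfold FF JJ
  exact (((cE1.clog h1).const_mul _).add (h.regular_continuousWithinAt hc hD0 h2)).mul
    ((cp.sub continuousWithinAt_const).pow k)

lemma tendsto_log_mul_sqrt : Tendsto (fun w : ℂ => ‖Complex.log w‖ * √‖w‖) (𝓝 0) (𝓝 0) := by
  have h0 : Tendsto (fun w : ℂ => ‖w‖) (𝓝 0) (𝓝 0) := by
    simpa using (continuous_norm (E := ℂ)).tendsto 0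
  have h1 : Tendsto (fun w : ℂ => √‖w‖) (𝓝 0) (𝓝 0) := by
    simpa [Function.comp_def] using (Real.continuous_sqrt.tendsto 0).comp h0
  have h2 : Tendsto (fun w : ℂ => |Real.log (√‖w‖) * √‖w‖|) (𝓝 0) (𝓝 0) := by
    have h3 : Tendsto (fun x : ℝ => Real.log x * x) (𝓝 0) (𝓝 0) := by
      have := Real.continuous_mul_log.tendsto 0
      simp only [zero_mul] at this
      exact this.congr fun x => mul_comm _ _
    simpa using ((h3.comp h1).abs)
  have h3 := (h2.const_mul 2).add (h1.const_mul π)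
  simp only [mul_zero, add_zero] at h3
  refine squeeze_zero (fun w => by positivity) (fun w => ?_) h3
  have e : Real.log ‖w‖ = 2 * Real.log (√‖w‖) := by
    rw [Real.log_sqrt (norm_nonneg _)]; ring
  have h4 : ‖Complex.log w‖ ≤ |Real.log ‖w‖| + π := by
    calc ‖Complex.log w‖ ≤ |(Complex.log w).re| + |(Complex.log w).im| :=
          Complex.norm_le_abs_re_add_abs_im _
      _ ≤ _ := by
          rw [Complex.log_re, Complex.log_im]
          gcongr
          exact Complex.abs_arg_le_pi w
  calc ‖Complex.log w‖ * √‖w‖ ≤ (|Real.log ‖w‖| + π) * √‖w‖ := by gcongr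
    _ = 2 * |Real.log (√‖w‖) * √‖w‖| + π * √‖w‖ := by
        rw [e, abs_mul, abs_mul, abs_of_nonneg (Real.sqrt_nonneg ‖w‖)]
        norm_num
        ring

lemma Prm.FF_corner (h : Prm α μ κ T A B) (k : ℕ) (hc : c ∈ cstrip)
    (hp : pt A B c = α * μ) (hcosh : Complex.cosh c ≠ 0)
    (hD0 : Dt α μ T A B c ≠ 0)
    (h2 : E2 α μ T (pt A B c) (rr κ (pt A B c)) (Dt α μ T A B c) ∈ slitPlane) :
    Tendsto (fun t => ‖FF α μ κ T A B k t‖ * √‖t - c‖) (𝓝[cstrip] c) (𝓝 0) := by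
  have hR := h.regular_continuousWithinAt hc hD0 h2
  have cp := (pt_continuous A B).continuousWithinAt (s := cstrip) (x := c)
  have cg : ContinuousWithinAt (fun t => (pt A B t - A) ^ k) cstrip c :=
    (cp.sub continuousWithinAt_const).pow k
  have hsq : Tendsto (fun t => √‖t - c‖) (𝓝[cstrip] c) (𝓝 0) := by
    have : Continuous (fun t : ℂ => √‖t - c‖) := by fun_prop
    have := this.continuousWithinAt (s := cstrip) (x := c)
    simpa [ContinuousWithinAt] using this
  -- derivative of `E1` at the corner
  have dp : HasDerivAt (pt A B) (B * Complex.cosh c) c := by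
    unfold pt
    exact ((Complex.hasDerivAt_sinh c).const_mul _).const_add _
  have dD : DifferentiableAt ℂ (Dt α μ T A B) c := by unfold Dt pt; fun_prop
  have dE := ((dp.const_sub ((α : ℂ) * μ)).const_mul ((1 : ℂ) - T)).div dD.hasDerivAt hD0
  have hT : (1 - T : ℂ) ≠ 0 := by
    have : 1 - T ≠ 0 := by linarith [h.hT2]
    exact_mod_cast this
  have hB : (B : ℂ) ≠ 0 := by exact_mod_cast h.hB.ne'
  have hO := dE.isTheta_sub (by
    rw [hp]
    simp only [sub_self, mul_zero, zero_mul, sub_zero]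
    refine div_ne_zero (mul_ne_zero (mul_ne_zero hT ?_) hD0) (pow_ne_zero 2 hD0)
    exact neg_ne_zero.2 (mul_ne_zero hB hcosh))
  obtain ⟨C, hC⟩ := hO.symm.isBigO.bound
  rw [Filter.prod_pure, eventually_map] at hC
  have hE0 : Tendsto (fun t => E1 α μ T (pt A B t) (Dt α μ T A B t)) (𝓝 c) (𝓝 0) := by
    have := dE.continuousAt
    simp only [ContinuousAt, Pi.div_apply] at this
    simpa [hp, E1, Pi.div_def] using this
  have hl : Tendsto (fun t => ‖Complex.log (E1 α μ T (pt A B t) (Dt α μ T A B t))‖ *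
      √‖t - c‖) (𝓝 c) (𝓝 0) := by
    have h3 := (tendsto_log_mul_sqrt.comp hE0).mul_const √C
    rw [zero_mul] at h3
    refine squeeze_zero' (Eventually.of_forall fun t => by positivity) ?_ h3
    filter_upwards [hC] with t ht
    simp only [Pi.div_apply, hp, sub_self, mul_zero, zero_div, sub_zero] at ht
    have h4 : √‖t - c‖ ≤ √‖E1 α μ T (pt A B t) (Dt α μ T A B t)‖ * √C := by
      rw [← Real.sqrt_mul (norm_nonneg _), mul_comm]
      exact Real.sqrt_le_sqrt ht
    simp only [Function.comp]
    rw [mul_assoc]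
    gcongr
  have hl' := hl.mono_left (nhdsWithin_le_nhds (s := cstrip))
  have hsum := ((hl'.const_mul 4).add (hR.norm.tendsto.mul hsq)).mul cg.norm.tendsto
  simp only [mul_zero, add_zero, zero_mul] at hsum
  refine squeeze_zero (fun t => by positivity) (fun t => ?_) hsum
  rw [FF, norm_mul, JJ]
  have h5 := norm_add_le (4 * Complex.log (E1 α μ T (pt A B t) (Dt α μ T A B t)))
    (8 * α * H2 α μ T (pt A B t) (rr κ (pt A B t)) (Dt α μ T A B t) *
        logq (E2 α μ T (pt A B t) (rr κ (pt A B t)) (Dt α μ T A B t)))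
  rw [norm_mul 4] at h5
  have h6 : ‖(4 : ℂ)‖ = 4 := by simp
  rw [h6] at h5
  calc _ ≤ (_ + _) * ‖(pt A B t - A) ^ k‖ * √‖t - c‖ := by gcongr
    _ = _ := by ring

end boundary

section

variable {α μ κ T A B : ℝ} {c : ℂ} {p ψ : ℝ}

lemma Dt_ofReal (hp : pt A B c = p) (hψ : B * Complex.cosh c = ψ) :
    Dt α μ T A B c = p * T + α * μ - ψ := by
  rw [Dt, hp, hψ]

lemma RealReg.Dt_ne (h : Prm α μ κ T A B) (hp : pt A B c = p) (hψ : B * Complex.cosh c = ψ)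
    (hreg : RealReg α μ A B p ψ) : Dt α μ T A B c ≠ 0 := by
  rw [Dt_ofReal hp hψ]
  exact_mod_cast hreg.D_ne h

lemma RealReg.Et2_mem (h : Prm α μ κ T A B) (hc : c ∈ cstrip) (hp : pt A B c = p)
    (hψ : B * Complex.cosh c = ψ) (hreg : RealReg α μ A B p ψ) :
    E2 α μ T (pt A B c) (rr κ (pt A B c)) (Dt α μ T A B c) ∈ slitPlane := by
  have hre := rr_re_nonneg (κ := κ) (pt_im_nonneg (A := A) h.hB hc.1 hc.2)
  have hsq := rr_sq κ (pt A B c)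
  rw [Dt_ofReal hp hψ]
  rw [hp] at hre hsq ⊢
  exact hreg.E2_mem h hsq hre

lemma RealReg.Et1_mem (h : Prm α μ κ T A B) (hp : pt A B c = p)
    (hψ : B * Complex.cosh c = ψ) (hreg : RealReg α μ A B p ψ) (hpne : p ≠ α * μ) :
    E1 α μ T (pt A B c) (Dt α μ T A B c) ∈ slitPlane := by
  rw [Dt_ofReal hp hψ, hp]
  have := hreg.E1_pos h hpne
  have e : E1 α μ T (p : ℂ) (p * T + α * μ - ψ) =
      (((1 - T) * (α * μ - p) / (p * T + α * μ - ψ) : ℝ) : ℂ) := by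
    rw [E1]; push_cast; rfl
  rw [e]
  exact ofReal_mem_slitPlane.2 this

lemma RealReg.FF_continuousWithinAt (h : Prm α μ κ T A B) (k : ℕ) (hc : c ∈ cstrip)
    (hp : pt A B c = p) (hψ : B * Complex.cosh c = ψ) (hreg : RealReg α μ A B p ψ)
    (hpne : p ≠ α * μ) : ContinuousWithinAt (FF α μ κ T A B k) cstrip c :=
  h.FF_continuousWithinAt k hc (hreg.Dt_ne h hp hψ) (hreg.Et1_mem h hp hψ hpne)
    (hreg.Et2_mem h hc hp hψ)

lemma RealReg.FF_im (h : Prm α μ κ T A B) (k : ℕ) (hc : c ∈ cstrip)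
    (hp : pt A B c = p) (hψ : B * Complex.cosh c = ψ) (hreg : RealReg α μ A B p ψ)
    (hpne : p ≠ α * μ) : (FF α μ κ T A B k c).im = 0 := by
  have hre := rr_re_nonneg (κ := κ) (pt_im_nonneg (A := A) h.hB hc.1 hc.2)
  have hsq := rr_sq κ (pt A B c)
  rw [FF, Dt_ofReal hp hψ]
  rw [hp] at hre hsq ⊢
  have h1 := hreg.JJ_im h hpne hsq hre
  have : ((p : ℂ) - A) ^ k = (((p - A) ^ k : ℝ) : ℂ) := by push_cast; rfl
  rw [this, Complex.mul_im, h1, ofReal_im]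
  simp

lemma RealReg.FF_corner (h : Prm α μ κ T A B) (k : ℕ) (hc : c ∈ cstrip)
    (hp : pt A B c = p) (hψ : B * Complex.cosh c = ψ) (hreg : RealReg α μ A B p ψ)
    (hpe : p = α * μ) :
    Tendsto (fun t => ‖FF α μ κ T A B k t‖ * √‖t - c‖) (𝓝[cstrip] c) (𝓝 0) := by
  refine h.FF_corner k hc (by rw [hp, hpe]; push_cast; rfl) ?_ (hreg.Dt_ne h hp hψ)
    (hreg.Et2_mem h hc hp hψ)
  intro h0
  rw [h0, mul_zero] at hψ
  have h1 : ψ = 0 := by exact_mod_cast hψ.symm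
  rcases hreg.2 with h2 | h2 <;> linarith [h2.2]

end

/-- The real point of the uniformizing strip lying over `p = αμ`. -/
def tP (α μ A B : ℝ) : ℝ := Real.arsinh ((α * μ - A) / B)

section

variable {α μ κ T A B : ℝ}

lemma B_sinh_tP (hB : 0 < B) : B * Real.sinh (tP α μ A B) = α * μ - A := by
  rw [tP, Real.sinh_arsinh]; field_simp

lemma Prm.reg_lower (h : Prm α μ κ T A B) {u : ℝ} (hu : tP α μ A B ≤ u) :
    RealReg α μ A B (A + B * Real.sinh u) (B * Real.cosh u) := by
  refine ⟨?_, Or.inr ⟨?_, mul_pos h.hB (Real.cosh_pos u)⟩⟩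
  · rw [mul_pow, Real.cosh_sq]; ring
  · have h1 := B_sinh_tP (α := α) (μ := μ) (A := A) h.hB
    have := mul_le_mul_of_nonneg_left (Real.sinh_le_sinh.2 hu) h.hB.le
    linarith

lemma Prm.reg_upper (h : Prm α μ κ T A B) {u : ℝ} (hu : -tP α μ A B ≤ u) :
    RealReg α μ A B (A - B * Real.sinh u) (-(B * Real.cosh u)) := by
  refine ⟨?_, Or.inl ⟨?_, neg_neg_of_pos (mul_pos h.hB (Real.cosh_pos u))⟩⟩
  · rw [neg_sq, mul_pow, Real.cosh_sq]; ring
  · have h1 := B_sinh_tP (α := α) (μ := μ) (A := A) h.hB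
    have := mul_le_mul_of_nonneg_left (Real.sinh_le_sinh.2 hu) h.hB.le
    rw [Real.sinh_neg] at this
    linarith

lemma pt_lower (u : ℝ) : pt A B u = ((A + B * Real.sinh u : ℝ) : ℂ) := by
  rw [pt]; push_cast; rfl

lemma cosh_lower (u : ℝ) : B * Complex.cosh u = ((B * Real.cosh u : ℝ) : ℂ) := by
  push_cast; rfl

lemma sinh_refl (t : ℂ) : Complex.sinh (I * π - t) = Complex.sinh t := by
  rw [Complex.sinh_sub, mul_comm I, Complex.sinh_mul_I, Complex.cosh_mul_I]
  simp

lemma cosh_refl (t : ℂ) : Complex.cosh (I * π - t) = -Complex.cosh t := by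
  rw [Complex.cosh_sub, mul_comm I, Complex.sinh_mul_I, Complex.cosh_mul_I]
  simp

lemma pt_refl (t : ℂ) : pt A B (I * π - t) = pt A B t := by rw [pt, sinh_refl, pt]

lemma Dt_refl (t : ℂ) : Dt α μ T A B (I * π - t) = Dt' α μ T A B t := by
  rw [Dt, Dt', pt_refl, cosh_refl]; ring

lemma refl_mem_strip {t : ℂ} (ht : t ∈ strip) : I * π - t ∈ strip := by
  constructor <;> simp <;> linarith [ht.1, ht.2]

/-- Sum of the integrand over the two sheets. -/
lemma Prm.FF_add_refl (h : Prm α μ κ T A B) (k : ℕ) {t : ℂ} (ht : t ∈ strip) :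
    FF α μ κ T A B k t + FF α μ κ T A B k (I * π - t) =
      2 * (GG α μ κ (pt A B t) - 2 * Real.log ((1 + T) / (1 - T))) * (pt A B t - A) ^ k := by
  rw [FF, FF, pt_refl, Dt_refl, ← add_mul, h.JJ_add ht]

lemma pt_upper (u : ℝ) : pt A B (I * π + u) = ((A - B * Real.sinh u : ℝ) : ℂ) := by
  have := pt_refl (A := A) (B := B) (-u : ℂ)
  rw [sub_neg_eq_add] at this
  rw [this, pt, Complex.sinh_neg]; push_cast; ring

lemma cosh_upper (u : ℝ) : B * Complex.cosh (I * π + u) = ((-(B * Real.cosh u) : ℝ) : ℂ) := by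
  have := cosh_refl (-u : ℂ)
  rw [sub_neg_eq_add] at this
  rw [this, Complex.cosh_neg]; push_cast; ring

lemma lower_mem (u : ℝ) : (u : ℂ) ∈ cstrip := by simp [cstrip, Real.pi_pos.le]

lemma upper_mem (u : ℝ) : I * π + (u : ℂ) ∈ cstrip := by simp [cstrip, Real.pi_pos.le]

lemma Prm.ne_of_lt (h : Prm α μ κ T A B) {u : ℝ} (hu : tP α μ A B < u) :
    A + B * Real.sinh u ≠ α * μ := by
  have h1 := B_sinh_tP (α := α) (μ := μ) (A := A) h.hB
  have := mul_lt_mul_of_pos_left (Real.sinh_lt_sinh.2 hu) h.hB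
  linarith

lemma Prm.ne_of_lt' (h : Prm α μ κ T A B) {u : ℝ} (hu : -tP α μ A B < u) :
    A - B * Real.sinh u ≠ α * μ := by
  have h1 := B_sinh_tP (α := α) (μ := μ) (A := A) h.hB
  have := mul_lt_mul_of_pos_left (Real.sinh_lt_sinh.2 hu) h.hB
  rw [Real.sinh_neg] at this
  linarith

end

/-- A corner `c` of the boundary of the strip: to the right of `c` the function `F` is real and
continuous up to the boundary, and at `c` it is `o(|t - c|^{-1/2})`. -/
structure Corner (F : ℂ → ℂ) (c : ℂ) : Prop where
  mem : ∀ s : ℝ, c + s ∈ cstrip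
  cont : ∀ s : ℝ, 0 < s → ContinuousWithinAt F cstrip (c + s)
  real : ∀ s : ℝ, 0 < s → (F (c + s)).im = 0
  lim : Tendsto (fun t => ‖F t‖ * √‖t - c‖) (𝓝[cstrip] c) (𝓝 0)

lemma Prm.corner_lower {α μ κ T A B : ℝ} (h : Prm α μ κ T A B) (k : ℕ) :
    Corner (FF α μ κ T A B k) (tP α μ A B) where
  mem s := by rw [← ofReal_add]; exact lower_mem _
  cont s hs := by
    rw [← ofReal_add]
    exact (h.reg_lower (by linarith)).FF_continuousWithinAt h k (lower_mem _) (pt_lower _)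
      (cosh_lower _) (h.ne_of_lt (by linarith))
  real s hs := by
    rw [← ofReal_add]
    exact (h.reg_lower (by linarith)).FF_im h k (lower_mem _) (pt_lower _)
      (cosh_lower _) (h.ne_of_lt (by linarith))
  lim := (h.reg_lower le_rfl).FF_corner h k (lower_mem _) (pt_lower _)
      (cosh_lower _) (by linarith [B_sinh_tP (α := α) (μ := μ) (A := A) h.hB])

lemma Prm.corner_upper {α μ κ T A B : ℝ} (h : Prm α μ κ T A B) (k : ℕ) :
    Corner (FF α μ κ T A B k) (I * π - tP α μ A B) := by
  have e : ∀ s : ℝ, I * π - tP α μ A B + s = I * π + ((-tP α μ A B + s : ℝ) : ℂ) := by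
    intro s; push_cast; ring
  have e0 : I * π - tP α μ A B = I * π + ((-tP α μ A B : ℝ) : ℂ) := by
    push_cast; ring
  refine ⟨fun s => ?_, fun s hs => ?_, fun s hs => ?_, ?_⟩
  · rw [e]; exact upper_mem _
  · rw [e]
    exact (h.reg_upper (by linarith)).FF_continuousWithinAt h k (upper_mem _) (pt_upper _)
      (cosh_upper _) (h.ne_of_lt' (by linarith))
  · rw [e]
    exact (h.reg_upper (by linarith)).FF_im h k (upper_mem _) (pt_upper _)
      (cosh_upper _) (h.ne_of_lt' (by linarith))
  · rw [e0]
    refine (h.reg_upper le_rfl).FF_corner h k (upper_mem _) (pt_upper _) (cosh_upper _) ?_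
    rw [Real.sinh_neg]
    linarith [B_sinh_tP (α := α) (μ := μ) (A := A) h.hB]

lemma tendsto_logq {ι : Type*} {l : Filter ι} {f : ι → ℂ} (hf : Tendsto f l (𝓝 1)) :
    Tendsto (fun i => logq (f i)) l (𝓝 1) := by
  have := (logq_differentiableAt one_mem_slitPlane).continuousAt.tendsto.comp hf
  rwa [logq_one] at this

lemma mul_JJ_tendsto_zero {ι : Type*} {l : Filter ι} {α μ κ T A : ℝ} {p r D : ι → ℂ}
    (hT : T < 1) (hA : A = -α * (μ * T + 2 * α * (1 - T ^ 2)))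
    (hp : Tendsto p l (Bornology.cobounded ℂ)) (hr : ∀ i, r i ^ 2 = κ - 4 * p i)
    (hD : Tendsto (fun i => D i - (p i * (T - 1) + α * μ + A)) l (𝓝 0)) :
    Tendsto (fun i => p i * JJ α μ T (p i) (r i) (D i)) l (𝓝 0) := by
  have hTc : (T - 1 : ℂ) ≠ 0 := by
    have : T - 1 ≠ 0 := by linarith
    exact_mod_cast this
  have hAc : (A : ℂ) = -α * (μ * T + 2 * α * (1 - T ^ 2)) := by exact_mod_cast hA
  obtain ⟨e, he⟩ : ∃ e : ι → ℂ, e = fun i => D i - (p i * (T - 1) + α * μ + A) := ⟨_, rfl⟩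
  rw [← he] at hD
  have hDe : ∀ i, D i = p i * (T - 1) + α * μ + A + e i := by intro i; rw [he]; ring
  have hpi : Tendsto (fun i => (p i)⁻¹) l (𝓝 0) := tendsto_inv₀_cobounded.comp hp
  have hp0 : ∀ᶠ i in l, p i ≠ 0 := hp.eventually_ne_cobounded 0
  have hrc : Tendsto (fun i => κ - 4 * p i) l (Bornology.cobounded ℂ) := by
    rw [← tendsto_norm_atTop_iff_cobounded] at hp ⊢
    refine tendsto_atTop_mono (fun i => ?_)
      (tendsto_atTop_add_const_right _ (-‖(κ : ℂ)‖) (hp.const_mul_atTop (r := 4) (by norm_num)))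
    have h1 := norm_sub_norm_le (4 * p i) (κ : ℂ)
    rw [norm_sub_rev, norm_mul, show ‖(4 : ℂ)‖ = 4 by simp] at h1
    linarith
  have hri : Tendsto (fun i => (r i)⁻¹) l (𝓝 0) := by
    have h1 : Tendsto (fun i => ((r i)⁻¹) ^ 2) l (𝓝 0) := by
      have := tendsto_inv₀_cobounded.comp hrc
      refine this.congr fun i => ?_
      simp only [Function.comp]; rw [inv_pow, hr]
    rw [tendsto_zero_iff_norm_tendsto_zero] at h1 ⊢
    have h2 := (Real.continuous_sqrt.tendsto 0).comp h1
    rw [Real.sqrt_zero] at h2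
    refine h2.congr fun i => ?_
    simp only [Function.comp]; rw [norm_pow, Real.sqrt_sq (norm_nonneg _)]
  have hr0 : ∀ᶠ i in l, r i ≠ 0 := by
    filter_upwards [hrc.eventually_ne_cobounded 0] with i hi h0
    rw [← hr, h0] at hi; simp at hi
  have hrp : Tendsto (fun i => r i * (p i)⁻¹) l (𝓝 0) := by
    have h1 := hri.mul ((hpi.const_mul (κ : ℂ)).sub_const 4)
    simp only [zero_mul] at h1
    refine h1.congr' ?_
    filter_upwards [hp0, hr0] with i h0 h1
    have := hr i
    field_simp
    linear_combination -this
  have hDp : Tendsto (fun i => D i * (p i)⁻¹) l (𝓝 (T - 1)) := by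
    have h1 := ((hpi.const_mul (α * μ + A : ℂ)).add (hD.mul hpi)).const_add (T - 1 : ℂ)
    simp only [mul_zero, add_zero] at h1
    refine h1.congr' ?_
    filter_upwards [hp0] with i h0
    rw [hDe]; field_simp; ring
  have hpD : Tendsto (fun i => p i / D i) l (𝓝 (T - 1)⁻¹) := by
    refine (hDp.inv₀ hTc).congr fun i => ?_
    rw [mul_inv, inv_inv, div_eq_mul_inv, mul_comm]
  have hD0 : ∀ᶠ i in l, D i ≠ 0 := by
    filter_upwards [hDp.eventually_ne hTc] with i hi h0
    simp [h0] at hi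
  have hrμ : Tendsto (fun i => r i / (μ + r i)) l (𝓝 1) := by
    have h1 := ((hri.const_mul (μ : ℂ)).add_const 1).inv₀ (by simp)
    simp only [mul_zero, zero_add, inv_one] at h1
    refine h1.congr' ?_
    filter_upwards [hr0] with i h0
    rw [← div_eq_mul_inv, ← inv_div (_ + _), add_div, div_self h0]
  have hμr : ∀ᶠ i in l, (μ : ℂ) + r i ≠ 0 := by
    filter_upwards [hrμ.eventually_ne one_ne_zero] with i hi h0
    simp [h0] at hi
  -- first order expansions
  have k1 : Tendsto (fun i => p i * (E1 α μ T (p i) (D i) - 1)) l (𝓝 (-2 * α ^ 2 * (1 + T))) := by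
    have h1 := hpD.mul ((hD.neg).sub_const (T * α * μ + A : ℂ))
    have hv : (T - 1 : ℂ)⁻¹ * (-0 - (T * α * μ + A)) = -2 * α ^ 2 * (1 + T) := by
      rw [hAc]; field_simp; ring
    rw [hv] at h1
    refine h1.congr' ?_
    filter_upwards [hD0] with i h0
    rw [E1]; field_simp; rw [hDe]; ring
  have k2 : Tendsto (fun i => p i * H2 α μ T (p i) (r i) (D i)) l (𝓝 ((1 + T) * α)) := by
    have h1 := (((((hD.add_const (α * μ + A : ℂ)).mul hri).add_const ((1 - T) * α : ℂ)).mul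
      hrμ).mul hpD).const_mul (-(1 + T) : ℂ)
    have hv : (-(1 + T) : ℂ) * (((0 + (α * μ + A)) * 0 + (1 - T) * α) * 1 * (T - 1 : ℂ)⁻¹) =
        (1 + T) * α := by
      field_simp; ring
    rw [hv] at h1
    refine h1.congr' ?_
    filter_upwards [hD0, hr0, hμr] with i h0 h1 h2
    rw [H2]; field_simp; rw [hDe]; ring
  have k3 : Tendsto (fun i => E1 α μ T (p i) (D i)) l (𝓝 1) := by
    have h1 := (hpi.mul k1).const_add 1
    simp only [zero_mul, add_zero] at h1
    refine h1.congr' ?_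
    filter_upwards [hp0] with i h0
    field_simp; ring
  have k4 : Tendsto (fun i => E2 α μ T (p i) (r i) (D i)) l (𝓝 1) := by
    have h1 := (hrp.mul k2).const_add 1
    simp only [zero_mul, add_zero] at h1
    refine h1.congr' ?_
    filter_upwards [hp0] with i h0
    rw [E2]; field_simp
  have := ((k1.mul (tendsto_logq k3)).const_mul 4).add
    ((k2.mul (tendsto_logq k4)).const_mul (8 * α : ℂ))
  have hv : (4 : ℂ) * (-2 * α ^ 2 * (1 + T) * 1) + 8 * α * ((1 + T) * α * 1) = 0 := by ring
  rw [hv] at this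
  refine this.congr fun i => ?_
  rw [JJ, ← logq_mul (E1 α μ T (p i) (D i))]
  ring

lemma tendsto_sinh_atTop' : Tendsto Real.sinh atTop atTop :=
  tendsto_atTop_mono' _ ((eventually_ge_atTop 0).mono fun _ hx => Real.self_le_sinh_iff.2 hx)
    tendsto_id

lemma norm_sinh_ge (t : ℂ) : Real.sinh t.re ≤ ‖Complex.sinh t‖ := by
  rw [Complex.sinh, Real.sinh_eq, norm_div, Complex.norm_two]
  have := norm_sub_norm_le (Complex.exp t) (Complex.exp (-t))
  rw [Complex.norm_exp, Complex.norm_exp, neg_re] at this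
  linarith

lemma cosh_sub_sinh_tendsto :
    Tendsto (fun t : ℂ => Complex.cosh t - Complex.sinh t) (comap Complex.re atTop) (𝓝 0) := by
  rw [tendsto_zero_iff_norm_tendsto_zero]
  have : Tendsto (fun t : ℂ => Real.exp (-t.re)) (comap Complex.re atTop) (𝓝 0) :=
    Real.tendsto_exp_neg_atTop_nhds_zero.comp tendsto_comap
  refine this.congr fun t => ?_
  rw [Complex.cosh_sub_sinh, Complex.norm_exp, neg_re]

lemma Prm.pt_tendsto {A B : ℝ} (hB : 0 < B) :
    Tendsto (pt A B) (comap Complex.re atTop) (Bornology.cobounded ℂ) := by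
  rw [← tendsto_norm_atTop_iff_cobounded]
  have h1 : Tendsto (fun t : ℂ => B * Real.sinh t.re - ‖(A : ℂ)‖) (comap Complex.re atTop) atTop :=
    tendsto_atTop_add_const_right _ _ ((tendsto_sinh_atTop'.comp tendsto_comap).const_mul_atTop hB)
  refine tendsto_atTop_mono (fun t => ?_) h1
  have h2 := norm_sub_norm_le ((B : ℂ) * Complex.sinh t) (-(A : ℂ))
  have h3 := mul_le_mul_of_nonneg_left (norm_sinh_ge t) hB.le
  rw [norm_mul, Complex.norm_real, Real.norm_of_nonneg hB.le, norm_neg, sub_neg_eq_add,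
    add_comm ((B : ℂ) * _)] at h2
  simp only [pt]
  linarith

lemma Prm.FF_tendsto {α μ κ T A B : ℝ} (h : Prm α μ κ T A B) {k : ℕ} (hk : k ≤ 1) :
    Tendsto (FF α μ κ T A B k) (comap Complex.re atTop) (𝓝 0) := by
  have hp := Prm.pt_tendsto (A := A) h.hB
  have hD : Tendsto (fun t => Dt α μ T A B t - (pt A B t * (T - 1) + α * μ + A))
      (comap Complex.re atTop) (𝓝 0) := by
    have := cosh_sub_sinh_tendsto.const_mul (-B : ℂ)
    rw [mul_zero] at this
    refine this.congr fun t => ?_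
    rw [Dt, pt]; ring
  have hm := mul_JJ_tendsto_zero h.hT2 h.hA hp (fun t => rr_sq κ (pt A B t)) hD
  have hpi : Tendsto (fun t => (pt A B t)⁻¹) (comap Complex.re atTop) (𝓝 0) :=
    tendsto_inv₀_cobounded.comp hp
  have h0 : Tendsto (fun t => JJ α μ T (pt A B t) (rr κ (pt A B t)) (Dt α μ T A B t))
      (comap Complex.re atTop) (𝓝 0) := by
    have := hpi.mul hm
    rw [zero_mul] at this
    refine this.congr' ?_
    filter_upwards [hp.eventually_ne_cobounded 0] with t ht
    field_simp
  unfold FF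
  interval_cases k
  · simpa using h0
  · have := hm.sub (h0.mul_const (A : ℂ))
    rw [zero_mul, sub_zero] at this
    refine this.congr fun t => ?_
    ring

lemma Prm.FF_decay {α μ κ T A B : ℝ} (h : Prm α μ κ T A B) {k : ℕ} (hk : k ≤ 1) {ε : ℝ}
    (hε : 0 < ε) : ∃ R : ℝ, ∀ t : ℂ, R ≤ t.re → ‖FF α μ κ T A B k t‖ ≤ ε := by
  have := (h.FF_tendsto hk).norm.eventually_le_const (u := ε) (by simpa using hε)
  rw [eventually_comap, eventually_atTop] at this
  obtain ⟨R, hR⟩ := this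
  exact ⟨R, fun t ht => hR t.re ht t rfl⟩

section

variable {F P : ℂ → ℂ} {c : ℂ} {w : ℝ → ℂ} {l : Filter ℝ} {C M : ℝ}

lemma strip_add_real {t : ℂ} (ht : t ∈ strip) (s : ℝ) : t + s ∈ strip := by
  simpa [strip] using ht

lemma Corner.bound (hc : Corner F c) (hw : Tendsto w l (𝓝 c)) (hws : ∀ᶠ u in l, w u ∈ strip)
    (hdir : ∀ᶠ u in l, ∀ s : ℝ, 0 ≤ s → s ≤ C * ‖w u + s - c‖) :
    ∃ K, ∀ᶠ u in l, ∀ s : ℝ, s ∈ Icc 0 M → ‖F (w u + s)‖ * √s ≤ K := by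
  refine isCompact_Icc.induction_on (p := fun S => ∃ K, ∀ᶠ u in l, ∀ s : ℝ, s ∈ S →
    ‖F (w u + s)‖ * √s ≤ K) ⟨0, by simp⟩ ?_ ?_ ?_
  · rintro S S' hS ⟨K, hK⟩
    exact ⟨K, hK.mono fun u h s hs => h s (hS hs)⟩
  · rintro S S' ⟨K, hK⟩ ⟨K', hK'⟩
    refine ⟨max K K', ?_⟩
    filter_upwards [hK, hK'] with u h h' s hs
    rcases hs with hs | hs
    · exact (h s hs).trans (le_max_left _ _)
    · exact (h' s hs).trans (le_max_right _ _)
  · intro s hs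
    suffices H : ∃ K, ∀ᶠ z : ℝ × ℝ in l ×ˢ 𝓝[Icc 0 M] s, ‖F (w z.1 + z.2)‖ * √z.2 ≤ K by
      obtain ⟨K, hK⟩ := H
      obtain ⟨p, hp, q, hq, hpq⟩ := eventually_prod_iff.1 hK
      exact ⟨{x | q x}, hq, K, hp.mono fun u hu s hs => hpq hu hs⟩
    have hT : Tendsto (fun z : ℝ × ℝ => w z.1 + z.2) (l ×ˢ 𝓝[Icc 0 M] s) (𝓝[cstrip] (c + s)) := by
      refine tendsto_nhdsWithin_iff.2 ⟨?_, ?_⟩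
      · refine (hw.comp tendsto_fst).add ?_
        have : Tendsto (fun x : ℝ => (x : ℂ)) (𝓝[Icc 0 M] s) (𝓝 s) :=
          (continuous_ofReal.tendsto s).mono_left nhdsWithin_le_nhds
        exact this.comp tendsto_snd
      · filter_upwards [tendsto_fst.eventually hws] with z hz
        exact strip_subset_cstrip (strip_add_real hz _)
    have hI : ∀ᶠ z : ℝ × ℝ in l ×ˢ 𝓝[Icc 0 M] s, z.2 ∈ Icc 0 M :=
      tendsto_snd.eventually self_mem_nhdsWithin
    rcases hs.1.eq_or_lt with h0 | h0
    · refine ⟨√C, ?_⟩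
      rw [← h0] at hT hI ⊢
      rw [ofReal_zero, add_zero] at hT
      have h1 := (hc.lim.comp hT).eventually_le_const one_pos
      filter_upwards [h1, hI, tendsto_fst.eventually hdir] with z h1 h2 h3
      have h4 : √z.2 ≤ √C * √‖w z.1 + z.2 - c‖ := by
        rw [← Real.sqrt_mul' _ (norm_nonneg _)]
        exact Real.sqrt_le_sqrt (h3 _ h2.1)
      simp only [Function.comp] at h1
      calc _ ≤ ‖F (w z.1 + z.2)‖ * (√C * √‖w z.1 + z.2 - c‖) := by gcongr
        _ = √C * (‖F (w z.1 + z.2)‖ * √‖w z.1 + z.2 - c‖) := by ring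
        _ ≤ √C * 1 := by gcongr
        _ = _ := mul_one _
    · refine ⟨(‖F (c + s)‖ + 1) * √M, ?_⟩
      have h1 := ((hc.cont s h0).norm.tendsto.comp hT).eventually_le_const (lt_add_one _)
      filter_upwards [h1, hI] with z h1 h2
      simp only [Function.comp] at h1
      have := Real.sqrt_le_sqrt h2.2
      gcongr

lemma Corner.shift [l.IsCountablyGenerated] (hP : ∀ t ∈ strip, HasDerivAt P (F t) t)
    (hF : ContinuousOn F strip) (hc : Corner F c) (hw : Tendsto w l (𝓝 c))
    (hws : ∀ᶠ u in l, w u ∈ strip)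
    (hdir : ∀ᶠ u in l, ∀ s : ℝ, 0 ≤ s → s ≤ C * ‖w u + s - c‖) (hM : 0 ≤ M) :
    Tendsto (fun u => (P (w u + M) - P (w u)).im) l (𝓝 0) := by
  obtain ⟨K, hK⟩ := hc.bound (M := M) hw hws hdir
  have hcont : ∀ u, w u ∈ strip → Continuous fun s : ℝ => F (w u + s) := by
    intro u hu
    refine hF.comp_continuous (by fun_prop) fun s => strip_add_real hu s
  have hD : Tendsto (fun u => ∫ s in (0 : ℝ)..M, F (w u + s)) l
      (𝓝 (∫ s in (0 : ℝ)..M, F (c + s))) := by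
    refine intervalIntegral.tendsto_integral_filter_of_dominated_convergence
      (fun s => K * s ^ (-(1 / 2) : ℝ)) ?_ ?_ ?_ ?_
    · filter_upwards [hws] with u hu
      exact (hcont u hu).aestronglyMeasurable
    · filter_upwards [hK] with u hu
      refine Eventually.of_forall fun s hs => ?_
      rw [uIoc_of_le hM] at hs
      have h1 := hu s ⟨hs.1.le, hs.2⟩
      rw [Real.rpow_neg hs.1.le, ← Real.sqrt_eq_rpow, ← div_eq_mul_inv,
        le_div_iff₀ (Real.sqrt_pos.2 hs.1)]
      exact h1
    · exact (intervalIntegral.intervalIntegrable_rpow' (by norm_num)).const_mul K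
    · refine Eventually.of_forall fun s hs => ?_
      rw [uIoc_of_le hM] at hs
      refine (hc.cont s hs.1).tendsto.comp (tendsto_nhdsWithin_iff.2 ⟨hw.add_const _, ?_⟩)
      filter_upwards [hws] with u hu
      exact strip_subset_cstrip (strip_add_real hu _)
  have him : (∫ s in (0 : ℝ)..M, F (c + s)).im = 0 := by
    have : ∫ s in (0 : ℝ)..M, F (c + s) = ∫ s in (0 : ℝ)..M, ((F (c + s)).re : ℂ) := by
      refine intervalIntegral.integral_congr_ae (Eventually.of_forall fun s hs => ?_)
      rw [uIoc_of_le hM] at hs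
      apply Complex.ext
      · simp
      · simp [hc.real s hs.1]
    rw [this, intervalIntegral.integral_ofReal, ofReal_im]
  have := (Complex.continuous_im.tendsto _).comp hD
  rw [him] at this
  refine this.congr' ?_
  filter_upwards [hws] with u hu
  simp only [Function.comp]
  rw [intervalIntegral.integral_eq_sub_of_hasDerivAt (f := fun s : ℝ => P (w u + s))
    (fun s _ => ((hP _ (strip_add_real hu s)).comp_const_add (w u) (s : ℂ)).comp_ofReal)
    ((hcont u hu).intervalIntegrable _ _)]
  simp

lemma Corner.tendsto_im_sub [l.IsCountablyGenerated] {w₁ w₂ : ℝ → ℂ} {c₁ c₂ : ℂ}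
    (hP : ∀ t ∈ strip, HasDerivAt P (F t) t)
    (hF : ContinuousOn F strip) (hdec : ∀ ε > 0, ∃ R : ℝ, ∀ t : ℂ, R ≤ t.re → ‖F t‖ ≤ ε)
    (hc₁ : Corner F c₁) (hw₁ : Tendsto w₁ l (𝓝 c₁)) (hws₁ : ∀ᶠ u in l, w₁ u ∈ strip)
    (hdir₁ : ∀ᶠ u in l, ∀ s : ℝ, 0 ≤ s → s ≤ C * ‖w₁ u + s - c₁‖)
    (hc₂ : Corner F c₂) (hw₂ : Tendsto w₂ l (𝓝 c₂)) (hws₂ : ∀ᶠ u in l, w₂ u ∈ strip)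
    (hdir₂ : ∀ᶠ u in l, ∀ s : ℝ, 0 ≤ s → s ≤ C * ‖w₂ u + s - c₂‖) :
    Tendsto (fun u => (P (w₁ u) - P (w₂ u)).im) l (𝓝 0) := by
  rw [Metric.tendsto_nhds]
  intro ε hε
  obtain ⟨δ, hδ⟩ : ∃ δ : ℝ, δ = ε / 2 / (‖c₁ - c₂‖ + 2) := ⟨_, rfl⟩
  have hn : 0 < ‖c₁ - c₂‖ + 2 := by positivity
  have hδ0 : 0 < δ := by rw [hδ]; positivity
  obtain ⟨R, hR⟩ := hdec δ hδ0
  obtain ⟨M, hM0, hM1, hM2⟩ : ∃ M : ℝ, 0 ≤ M ∧ R ≤ c₁.re - 1 + M ∧ R ≤ c₂.re - 1 + M :=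
    ⟨max 0 (max (R - (c₁.re - 1)) (R - (c₂.re - 1))), le_max_left _ _, by
      have := (le_max_left (R - (c₁.re - 1)) (R - (c₂.re - 1))).trans (le_max_right 0 _)
      linarith, by
      have := (le_max_right (R - (c₁.re - 1)) (R - (c₂.re - 1))).trans (le_max_right 0 _)
      linarith⟩
  have s1 := (Metric.tendsto_nhds.1 (hc₁.shift hP hF hw₁ hws₁ hdir₁ hM0)) (ε / 4) (by linarith)
  have s2 := (Metric.tendsto_nhds.1 (hc₂.shift hP hF hw₂ hws₂ hdir₂ hM0)) (ε / 4) (by linarith)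
  have n1 := Metric.tendsto_nhds.1 hw₁ 1 one_pos
  have n2 := Metric.tendsto_nhds.1 hw₂ 1 one_pos
  filter_upwards [s1, s2, n1, n2, hws₁, hws₂] with u s1 s2 n1 n2 m1 m2
  rw [dist_zero_right, Real.norm_eq_abs] at s1 s2 ⊢
  rw [Complex.dist_eq] at n1 n2
  have r1 : R ≤ (w₁ u + M).re := by
    have := (Complex.abs_re_le_norm (w₁ u - c₁)).trans n1.le
    rw [sub_re] at this
    have := (abs_le.1 this).1
    simp; linarith
  have r2 : R ≤ (w₂ u + M).re := by
    have := (Complex.abs_re_le_norm (w₂ u - c₂)).trans n2.le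
    rw [sub_re] at this
    have := (abs_le.1 this).1
    simp; linarith
  have hconv : Convex ℝ (strip ∩ {t : ℂ | R ≤ t.re}) :=
    strip_convex.inter (convex_halfSpace_re_ge R)
  have hmv := hconv.norm_image_sub_le_of_norm_hasDerivWithin_le (f := P) (f' := F) (C := δ)
    (fun t ht => (hP t ht.1).hasDerivWithinAt) (fun t ht => hR t ht.2)
    (x := w₂ u + M) (y := w₁ u + M) ⟨strip_add_real m2 _, r2⟩ ⟨strip_add_real m1 _, r1⟩
  have hd : ‖(w₁ u + M) - (w₂ u + M)‖ ≤ ‖c₁ - c₂‖ + 2 := by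
    have e : (w₁ u + M) - (w₂ u + M) = (w₁ u - c₁) + (c₁ - c₂) - (w₂ u - c₂) := by ring
    rw [e]
    have h1 := norm_sub_le ((w₁ u - c₁) + (c₁ - c₂)) (w₂ u - c₂)
    have h2 := norm_add_le (w₁ u - c₁) (c₁ - c₂)
    linarith
  have h3 : ‖P (w₁ u + M) - P (w₂ u + M)‖ ≤ ε / 2 := by
    refine hmv.trans ((mul_le_mul_of_nonneg_left hd hδ0.le).trans (le_of_eq ?_))
    rw [hδ]; field_simp
  have h4 := (Complex.abs_im_le_norm _).trans h3
  have e : P (w₁ u) - P (w₂ u) = -(P (w₁ u + M) - P (w₁ u)) + (P (w₂ u + M) - P (w₂ u)) +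
    (P (w₁ u + M) - P (w₂ u + M)) := by ring
  rw [e, add_im, add_im, neg_im]
  rw [abs_lt] at *
  rw [abs_le] at h4
  constructor <;> linarith [h4.1, h4.2]

end

/-- The oriented segment from `q` to the real point `e`. -/
def seg (q : ℂ) (e : ℝ) (u : ℝ) : ℂ := q + (u : ℂ) * ((e : ℂ) - q)

/-- The principal branch of `√((z - q)(z - conj q))`. -/
def Se (q z : ℂ) : ℂ := Complex.exp ((Complex.log (z - q) + Complex.log (z - conj q)) / 2)

/-- The values of the square root along the segment, including the endpoint `q`. -/
def ss (q : ℂ) (e : ℝ) (u : ℝ) : ℂ :=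
  (√u : ℂ) * Complex.exp (Complex.log (e - q) / 2) *
    Complex.exp (Complex.log (seg q e u - conj q) / 2)

/-- The lift of the segment to the uniformizing strip. -/
def gam (q : ℂ) (e : ℝ) (u : ℝ) : ℂ := Complex.log ((seg q e u - q.re + ss q e u) / q.im)

section

variable {q : ℂ} {e u : ℝ}

lemma seg_im (q : ℂ) (e u : ℝ) : (seg q e u).im = (1 - u) * q.im := by
  simp [seg]; ring

lemma seg_hasDerivAt (q : ℂ) (e u : ℝ) : HasDerivAt (seg q e) (e - q) u := by
  have := ((Complex.ofRealCLM.hasDerivAt (x := u)).mul_const ((e : ℂ) - q)).const_add q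
  exact this.congr_deriv (by simp)

lemma seg_sub_conj_mem (hq : 0 < q.im) (hu : u < 2) : seg q e u - conj q ∈ slitPlane := by
  right
  rw [sub_im, seg_im, conj_im]
  nlinarith

lemma e_sub_mem (hq : 0 < q.im) : (e : ℂ) - q ∈ slitPlane := by
  right; simp; exact hq.ne'

lemma Se_sq {z : ℂ} (h1 : z - q ≠ 0) (h2 : z - conj q ≠ 0) :
    Se q z ^ 2 = (z - q) * (z - conj q) := by
  rw [Se, ← Complex.exp_nat_mul]
  have : ((2 : ℕ) : ℂ) * ((Complex.log (z - q) + Complex.log (z - conj q)) / 2) =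
      Complex.log (z - q) + Complex.log (z - conj q) := by push_cast; ring
  rw [this, Complex.exp_add, Complex.exp_log h1, Complex.exp_log h2]

lemma Se_ne (q z : ℂ) : Se q z ≠ 0 := Complex.exp_ne_zero _

lemma Se_hasDerivAt {z : ℂ} (h1 : z - q ∈ slitPlane) (h2 : z - conj q ∈ slitPlane) :
    HasDerivAt (Se q) ((z - q.re) / Se q z) z := by
  have d := ((((hasDerivAt_id z).sub_const q).clog h1).add
    (((hasDerivAt_id z).sub_const (conj q)).clog h2)).div_const 2 |>.cexp
  refine d.congr_deriv ?_
  have n1 := slitPlane_ne_zero h1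
  have n2 := slitPlane_ne_zero h2
  have hsq := Se_sq n1 n2
  have h0 := Se_ne q z
  change Se q z * _ = _
  have hc : q + conj q = 2 * q.re := by rw [Complex.add_conj]; push_cast; ring
  rw [eq_div_iff h0]
  have : Se q z * ((1 / (id z - q) + 1 / (id z - conj q)) / 2) * Se q z =
    Se q z ^ 2 * ((1 / (z - q) + 1 / (z - conj q)) / 2) := by simp only [id]; ring
  rw [this, hsq]
  field_simp
  linear_combination -hc

lemma Se_eq_ss (hq : 0 < q.im) (hu : 0 < u) : Se q (seg q e u) = ss q e u := by
  have e1 : seg q e u - q = (u : ℂ) * (e - q) := by simp [seg]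
  have e2 : (√u : ℂ) = Complex.exp (Real.log u / 2 : ℝ) := by
    rw [← Complex.ofReal_exp, Real.exp_half, Real.exp_log hu]
  rw [Se, ss, e1, Complex.log_ofReal_mul hu (slitPlane_ne_zero (e_sub_mem hq)), e2,
    ← Complex.exp_add, ← Complex.exp_add]
  congr 1
  push_cast
  ring

lemma ss_sq (hq : 0 < q.im) (h0 : 0 ≤ u) (hu : u < 2) :
    ss q e u ^ 2 = (seg q e u - q.re) ^ 2 + (q.im : ℂ) ^ 2 := by
  have h1 := slitPlane_ne_zero (e_sub_mem (e := e) hq)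
  have h2 := slitPlane_ne_zero (seg_sub_conj_mem (e := e) hq hu)
  have hs : (√u : ℂ) ^ 2 = u := by exact_mod_cast Real.sq_sqrt h0
  rw [ss, mul_pow, mul_pow, hs, ← Complex.exp_nat_mul, ← Complex.exp_nat_mul]
  have e3 : ∀ x : ℂ, ((2 : ℕ) : ℂ) * (x / 2) = x := by intro x; push_cast; ring
  rw [e3, e3, Complex.exp_log h1, Complex.exp_log h2]
  obtain ⟨a, b⟩ := q
  have hq1 : (⟨a, b⟩ : ℂ) = a + b * I := (Complex.re_add_im ⟨a, b⟩).symm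
  have hq2 : conj (⟨a, b⟩ : ℂ) = a - b * I := by
    apply Complex.ext <;> simp
  change _ = (_ - (a : ℂ)) ^ 2 + (b : ℂ) ^ 2
  rw [hq2, seg, hq1]
  linear_combination (-(b : ℂ) ^ 2) * I_sq

lemma ss_ne (hq : 0 < q.im) (h0 : 0 < u) : ss q e u ≠ 0 := by
  rw [← Se_eq_ss hq h0]; exact Se_ne _ _

lemma ss_continuousAt (hq : 0 < q.im) (hu : u < 2) : ContinuousAt (ss q e) u := by
  have h1 : ContinuousAt (fun u : ℝ => seg q e u - conj q) u :=
    ((seg_hasDerivAt q e u).continuousAt).sub continuousAt_const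
  have h2 := h1.clog (seg_sub_conj_mem hq hu)
  have h3 : ContinuousAt (fun u : ℝ => (√u : ℂ)) u :=
    (Complex.continuous_ofReal.comp Real.continuous_sqrt).continuousAt
  exact (h3.mul continuousAt_const).mul (h2.div_const 2).cexp

lemma ss_one (hq : 0 < q.im) : ss q e 1 = (‖(e : ℂ) - q‖ : ℂ) := by
  have h1 := e_sub_mem (e := e) hq
  have e1 : seg q e 1 - conj q = conj ((e : ℂ) - q) := by simp [seg]
  have e2 : Complex.log (e - q) / 2 + conj (Complex.log (e - q)) / 2 =
      (Real.log ‖(e : ℂ) - q‖ : ℝ) := by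
    rw [← Complex.log_re, ← add_div, Complex.add_conj]; simp
  rw [ss, e1, Complex.log_conj _ (slitPlane_arg_ne_pi h1), mul_assoc, ← Complex.exp_add, e2,
    ← Complex.ofReal_exp, Real.exp_log (norm_pos_iff.2 (slitPlane_ne_zero h1))]
  simp

lemma ss_zero : ss q e 0 = 0 := by simp [ss]

lemma ss_hasDerivAt (hq : 0 < q.im) (h0 : 0 < u) (hu : u < 2) :
    HasDerivAt (ss q e) ((seg q e u - q.re) * (e - q) / ss q e u) u := by
  have h1 : seg q e u - q ∈ slitPlane := by
    right; rw [sub_im, seg_im]; nlinarith [mul_pos h0 hq]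
  have d := (Se_hasDerivAt h1 (seg_sub_conj_mem hq hu)).comp u (seg_hasDerivAt q e u)
  rw [Se_eq_ss hq h0] at d
  refine (d.congr_deriv (by ring)).congr_of_eventuallyEq ?_
  filter_upwards [lt_mem_nhds h0] with v hv
  exact (Se_eq_ss hq hv).symm

/-- The exponential of the lift. -/
def ww (q : ℂ) (e : ℝ) (u : ℝ) : ℂ := (seg q e u - q.re + ss q e u) / q.im

lemma ww_mul (hq : 0 < q.im) (h0 : 0 ≤ u) (hu : u < 2) :
    ww q e u * ((ss q e u - (seg q e u - q.re)) / q.im) = 1 := by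
  have hb : (q.im : ℂ) ≠ 0 := by exact_mod_cast hq.ne'
  have := ss_sq (e := e) hq h0 hu
  rw [ww]
  field_simp
  linear_combination this

lemma ww_ne (hq : 0 < q.im) (h0 : 0 ≤ u) (hu : u < 2) : ww q e u ≠ 0 :=
  left_ne_zero_of_mul_eq_one (ww_mul (e := e) hq h0 hu)

lemma exp_gam (hq : 0 < q.im) (h0 : 0 ≤ u) (hu : u < 2) :
    Complex.exp (gam q e u) = ww q e u := Complex.exp_log (ww_ne hq h0 hu)

lemma exp_neg_gam (hq : 0 < q.im) (h0 : 0 ≤ u) (hu : u < 2) :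
    Complex.exp (-gam q e u) = (ss q e u - (seg q e u - q.re)) / q.im := by
  rw [Complex.exp_neg, exp_gam hq h0 hu]
  exact inv_eq_of_mul_eq_one_right (ww_mul hq h0 hu)

lemma sinh_gam (hq : 0 < q.im) (h0 : 0 ≤ u) (hu : u < 2) :
    Complex.sinh (gam q e u) = (seg q e u - q.re) / q.im := by
  rw [Complex.sinh, exp_gam hq h0 hu, exp_neg_gam hq h0 hu, ww]; ring

lemma ww_im_pos (hq : 0 < q.im) (h0 : 0 ≤ u) (hu : u < 1) : 0 < (ww q e u).im := by
  have h1 := inv_eq_of_mul_eq_one_right (ww_mul (e := e) hq h0 (by linarith))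
  have h2 : ww q e u - (ww q e u)⁻¹ = ((2 / q.im : ℝ) : ℂ) * (seg q e u - q.re) := by
    rw [h1, ww]; push_cast; ring
  have h3 := congrArg Complex.im h2
  rw [sub_im, inv_im, im_ofReal_mul, sub_im, seg_im, ofReal_im] at h3
  have h4 : 2 / q.im * ((1 - u) * q.im - 0) = 2 * (1 - u) := by field_simp; ring
  rw [h4] at h3
  have h5 : (ww q e u).im * (1 + (normSq (ww q e u))⁻¹) = 2 * (1 - u) := by rw [← h3]; ring
  have h6 : 0 ≤ (normSq (ww q e u))⁻¹ := inv_nonneg.2 (normSq_nonneg _)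
  by_contra hc
  push Not at hc
  nlinarith

lemma ww_one (hq : 0 < q.im) : ww q e 1 = (((e - q.re + ‖(e : ℂ) - q‖) / q.im : ℝ) : ℂ) := by
  rw [ww, ss_one hq, seg]; push_cast; ring

lemma ww_one_pos (hq : 0 < q.im) : 0 < (e - q.re + ‖(e : ℂ) - q‖) / q.im := by
  have h1 : |((e : ℂ) - q).re| < ‖(e : ℂ) - q‖ := Complex.abs_re_lt_norm.2 (by simp [hq.ne'])
  have h2 := neg_abs_le (((e : ℂ) - q).re)
  simp only [sub_re, ofReal_re] at h1 h2
  exact div_pos (by linarith) hq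

lemma ww_mem (hq : 0 < q.im) (h0 : 0 ≤ u) (hu : u ≤ 1) : ww q e u ∈ slitPlane := by
  rcases hu.lt_or_eq with h | rfl
  · exact Or.inr (ww_im_pos hq h0 h).ne'
  · rw [ww_one hq]; exact Complex.ofReal_mem_slitPlane.2 (ww_one_pos hq)

lemma gam_one (hq : 0 < q.im) : gam q e 1 = (Real.arsinh ((e - q.re) / q.im) : ℂ) := by
  have h1 : gam q e 1 = (Real.log ((e - q.re + ‖(e : ℂ) - q‖) / q.im) : ℝ) := by
    rw [Complex.ofReal_log (ww_one_pos hq).le, ← ww_one hq]; rfl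
  have h2 := sinh_gam (e := e) hq zero_le_one one_lt_two
  rw [h1, ← Complex.ofReal_sinh] at h2
  have h3 : Real.sinh (Real.log ((e - q.re + ‖(e : ℂ) - q‖) / q.im)) = (e - q.re) / q.im := by
    have : seg q e 1 = e := by simp [seg]
    rw [this] at h2
    exact_mod_cast h2
  rw [h1, ← h3, Real.arsinh_sinh]

lemma gam_zero (hq : 0 < q.im) : gam q e 0 = (π / 2 : ℝ) * I := by
  have hb : (q.im : ℂ) ≠ 0 := by exact_mod_cast hq.ne'
  have : (seg q e 0 - q.re + ss q e 0) / q.im = I := by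
    rw [ss_zero, seg, div_eq_iff hb]
    rw [ofReal_zero]
    linear_combination -Complex.re_add_im q
  rw [gam, this, Complex.log_I]; push_cast; ring

lemma gam_im_pos (hq : 0 < q.im) (h0 : 0 ≤ u) (hu : u < 1) : 0 < (gam q e u).im := by
  rw [gam, Complex.log_im]
  have h := ww_im_pos (e := e) hq h0 hu
  rw [ww] at h
  have h1 := Complex.arg_nonneg_iff.2 h.le
  refine h1.lt_of_ne fun h2 => ?_
  exact h.ne' (Complex.arg_eq_zero_iff.1 h2.symm).2

lemma gam_im_lt (hq : 0 < q.im) (h0 : 0 ≤ u) (hu : u < 1) : (gam q e u).im < π := by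
  rw [gam, Complex.log_im, Complex.arg_lt_pi_iff]
  exact Or.inr (ww_im_pos (e := e) hq h0 hu).ne'

lemma gam_continuousAt (hq : 0 < q.im) (h0 : 0 ≤ u) (hu : u ≤ 1) : ContinuousAt (gam q e) u := by
  have h1 : ContinuousAt (ww q e) u := by
    have h2 := (seg_hasDerivAt q e u).continuousAt
    have h3 := ss_continuousAt (e := e) hq (hu.trans_lt one_lt_two)
    exact ((h2.sub continuousAt_const).add h3).div_const _
  exact h1.clog (ww_mem hq h0 hu)

lemma gam_hasDerivAt (hq : 0 < q.im) (h0 : 0 < u) (hu : u ≤ 1) :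
    HasDerivAt (gam q e) ((e - q) / ss q e u) u := by
  have hb : (q.im : ℂ) ≠ 0 := by exact_mod_cast hq.ne'
  have h1 := ss_ne (e := e) hq h0
  have hw := ww_ne (e := e) hq h0.le (hu.trans_lt one_lt_two)
  have d : HasDerivAt (ww q e) _ u := (((seg_hasDerivAt q e u).sub_const (q.re : ℂ)).add
    (ss_hasDerivAt hq h0 (hu.trans_lt one_lt_two))).div_const (q.im : ℂ)
  refine (d.clog_real (ww_mem hq h0.le hu)).congr_deriv ?_
  rw [div_eq_iff hw, ww]
  field_simp
  ring

end

section

variable {q : ℂ} {e u : ℝ}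

lemma HasDerivAt.eventually_norm_sub_le_im {g : ℝ → ℂ} {g' : ℂ} {x : ℝ} (hg : HasDerivAt g g' x)
    (him : g'.im < 0) : ∃ C : ℝ, 0 < C ∧ ∀ᶠ u in 𝓝[<] x,
      ‖g u - g x‖ ≤ C * (g u - g x).im ∧ x - u ≤ C * (g u - g x).im := by
  set c : ℝ := -g'.im / 2 with hc
  have hc0 : 0 < c := by rw [hc]; linarith
  refine ⟨(‖g'‖ + c + 1) / c, by positivity, ?_⟩
  have h1 := (hasDerivAt_iff_isLittleO.1 hg).def hc0
  filter_upwards [h1.filter_mono nhdsWithin_le_nhds, self_mem_nhdsWithin] with u hu hux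
  have hux : u < x := hux
  rw [Real.norm_eq_abs, abs_sub_comm, abs_of_pos (by linarith)] at hu
  obtain ⟨D, hD⟩ : ∃ D, D = g u - g x := ⟨_, rfl⟩
  rw [← hD] at hu ⊢
  have h2 := (neg_le_abs _).trans ((Complex.abs_im_le_norm (D - (u - x) • g')).trans hu)
  rw [sub_im, Complex.smul_im, smul_eq_mul] at h2
  have him' : g'.im = -2 * c := by rw [hc]; ring
  rw [him'] at h2
  have h4 : c * (x - u) ≤ D.im := by nlinarith
  have h5 : ‖D‖ ≤ ‖D - (u - x) • g'‖ + ‖(u - x) • g'‖ := by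
    simpa using norm_add_le (D - (u - x) • g') ((u - x) • g')
  rw [norm_smul, Real.norm_eq_abs, abs_sub_comm, abs_of_pos (by linarith : 0 < x - u)] at h5
  have h6 : x - u ≤ D.im / c := by rw [le_div_iff₀ hc0]; linarith
  have h7 : 0 ≤ D.im / c := by linarith
  have h8 := norm_nonneg g'
  rw [div_mul_eq_mul_div, mul_div_assoc]
  constructor <;> nlinarith

lemma le_mul_norm_add_ofReal {d : ℂ} {C s : ℝ} (hd : ‖d‖ ≤ C * d.im) (hC : 0 < C) :
    s ≤ (1 + C) * ‖d + s‖ := by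
  have h1 := norm_sub_le (d + s) d
  have h2 := Complex.abs_im_le_norm (d + s)
  have h3 := le_abs_self (d + s).im
  rw [add_sub_cancel_left, Complex.norm_real] at h1
  have h4 := le_abs_self s
  rw [← Real.norm_eq_abs] at h4
  have h5 : (d + s).im = d.im := by simp
  rw [h5] at h2 h3
  nlinarith [mul_le_mul_of_nonneg_left (h3.trans h2) hC.le]

lemma le_mul_norm_neg_add_ofReal {d : ℂ} {C s : ℝ} (hd : ‖d‖ ≤ C * d.im) (hC : 0 < C) : s ≤ (1 + C) * ‖-d + s‖ := by
  have h1 := norm_add_le (-d + s) d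
  have h2 := Complex.abs_im_le_norm (-d + s)
  have h3 := neg_le_abs (-d + s).im
  rw [show -d + s + d = s by ring, Complex.norm_real] at h1
  have h4 := le_abs_self s
  rw [← Real.norm_eq_abs] at h4
  have h5 : (-d + s).im = -d.im := by simp
  rw [h5] at h2 h3
  rw [neg_neg] at h3
  nlinarith [mul_le_mul_of_nonneg_left (h3.trans h2) hC.le]

lemma gam_deriv_one_im_neg (hq : 0 < q.im) : (((e : ℂ) - q) / ss q e 1).im < 0 := by
  have h1 := norm_pos_iff.2 (slitPlane_ne_zero (e_sub_mem (e := e) hq))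
  rw [ss_one hq, div_ofReal_im]
  exact div_neg_of_neg_of_pos (by simpa using hq) h1

/-- The open half-plane to the left of the line through the segment. -/
def leftHalf (q : ℂ) (e : ℝ) : Set ℂ := {z | q.im * e < q.im * z.re + (e - q.re) * z.im}

lemma leftHalf_convex (q : ℂ) (e : ℝ) : Convex ℝ (leftHalf q e) := by
  refine convex_halfSpace_gt ?_ _
  constructor
  · intro x y; simp; ring
  · intro c x; simp; ring

lemma sub_mem_of_leftHalf (hq : 0 < q.im) {z : ℂ} (hz : z ∈ leftHalf q e) :
    z - q ∈ slitPlane := by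
  rw [mem_slitPlane_iff]
  by_contra hc
  push Not at hc
  obtain ⟨h1, h2⟩ := hc
  rw [sub_re] at h1
  rw [sub_im] at h2
  simp only [leftHalf, mem_ofPred_eq] at hz
  have : z.im = q.im := by linarith
  rw [this] at hz
  nlinarith

lemma sub_conj_mem_of_leftHalf (hq : 0 < q.im) (he : q.re < e) {z : ℂ} (hz : z ∈ leftHalf q e) :
    z - conj q ∈ slitPlane := by
  rw [mem_slitPlane_iff]
  by_contra hc
  push Not at hc
  obtain ⟨h1, h2⟩ := hc
  rw [sub_re, conj_re] at h1
  rw [sub_im, conj_im] at h2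
  simp only [leftHalf, mem_ofPred_eq] at hz
  have : z.im = -q.im := by linarith
  rw [this] at hz
  nlinarith

lemma Se_ofReal (hq : 0 < q.im) (x : ℝ) : Se q x = (‖(x : ℂ) - q‖ : ℂ) := by
  have h := ss_one (e := x) hq
  rw [← Se_eq_ss hq one_pos] at h
  simpa [seg] using h

lemma SSpec.splus_eq {α δ μ : ℝ} {S Splus : ℂ → ℂ} (h : SSpec α δ μ q S Splus) (hq : 0 < q.im)
    (he : q.re < zP α δ μ) (h0 : 0 < u) (h1 : u < 1) :
    Splus (segB α δ μ q u) = ss q (zP α δ μ) u := by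
  obtain ⟨hd, hsq, hreal, hlim⟩ := h
  set e := zP α δ μ with hedef
  have hsub : leftHalf q e ⊆
      (segB α δ μ q '' Set.Icc 0 1 ∪ segB α δ μ (conj q) '' Set.Icc 0 1)ᶜ := by
    rintro z hz (⟨v, hv, rfl⟩ | ⟨v, hv, rfl⟩)
    · simp [leftHalf, segB, ← hedef] at hz
      nlinarith
    · simp [leftHalf, segB, ← hedef] at hz
      nlinarith [mul_nonneg (mul_pos hq (sub_pos.2 he)).le (sub_nonneg.2 hv.2)]
  have hSe : ∀ z ∈ leftHalf q e, S z = Se q z := by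
    have hx : ((e + 1 : ℝ) : ℂ) ∈ leftHalf q e := by
      simp only [leftHalf, mem_ofPred_eq, ofReal_re, ofReal_im]; nlinarith
    refine (leftHalf_convex q e).isPreconnected.eq_of_sq_eq (hd.continuousOn.mono hsub)
      (fun z hz => (Se_hasDerivAt (sub_mem_of_leftHalf hq hz)
        (sub_conj_mem_of_leftHalf hq he hz)).continuousAt.continuousWithinAt) ?_
      (fun {z} _ => Se_ne q z) hx ?_
    · intro z hz
      simp only [Pi.pow_apply]
      rw [hsq z (hsub hz), Se_sq (slitPlane_ne_zero (sub_mem_of_leftHalf hq hz))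
        (slitPlane_ne_zero (sub_conj_mem_of_leftHalf hq he hz))]
    · rw [hreal _ (by linarith), Se_ofReal hq, Complex.norm_def, normSq_apply]
      congr 2
      simp; ring
  refine tendsto_nhds_unique (hlim u h0 h1) ?_
  have hcont : ContinuousAt (Se q) (seg q e u) := by
    refine (Se_hasDerivAt ?_ (seg_sub_conj_mem hq (by linarith))).continuousAt
    right; rw [sub_im, seg_im]; nlinarith [mul_pos h0 hq]
  have hpath : Tendsto (fun d : ℝ => segB α δ μ q u + (d : ℂ) * Complex.I * ((e : ℂ) - q))
      (𝓝[>] 0) (𝓝 (seg q e u)) := by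
    have : ContinuousAt
        (fun d : ℝ => segB α δ μ q u + (d : ℂ) * Complex.I * ((e : ℂ) - q)) 0 := by fun_prop
    have h2 := this.tendsto
    simp only [ofReal_zero, zero_mul, add_zero] at h2
    exact h2.mono_left nhdsWithin_le_nhds
  rw [← Se_eq_ss hq h0]
  refine (hcont.tendsto.comp hpath).congr' ?_
  filter_upwards [self_mem_nhdsWithin] with d hd0
  have hd0 : 0 < d := hd0
  refine (hSe _ ?_).symm
  simp [leftHalf, segB, ← hedef]
  nlinarith [mul_pos hd0 (mul_pos hq hq), mul_nonneg hd0.le (mul_self_nonneg (e - q.re))]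

end

lemma intervalIntegrable_of_sqrt_bounds {f : ℝ → ℂ} {K₀ K₁ : ℝ} (hc : ContinuousOn f (Ioo 0 1))
    (h0 : ∀ᶠ u in 𝓝[>] (0 : ℝ), ‖f u‖ * √u ≤ K₀)
    (h1 : ∀ᶠ u in 𝓝[<] (1 : ℝ), ‖f u‖ * √(1 - u) ≤ K₁) : IntervalIntegrable f volume 0 1 := by
  obtain ⟨a, ha, has⟩ := mem_nhdsGT_iff_exists_Ioo_subset.1 h0
  obtain ⟨b, hb, hbs⟩ := mem_nhdsLT_iff_exists_Ioo_subset.1 h1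
  have ha : 0 < a := ha
  have hb : b < 1 := hb
  set r := min (a / 2) (1 / 2) with hr
  set s := max ((b + 1) / 2) (1 / 2) with hs
  have hr0 : 0 < r := by positivity
  have hra : r < a := (min_le_left _ _).trans_lt (by linarith)
  have hr2 : r ≤ 1 / 2 := min_le_right _ _
  have hsb : b < s := lt_of_lt_of_le (by linarith) (le_max_left _ _)
  have hs1 : s < 1 := max_lt (by linarith) (by norm_num)
  have hs2 : 1 / 2 ≤ s := le_max_right _ _
  have hI : IntervalIntegrable (fun u : ℝ => u ^ (-(1 / 2) : ℝ)) volume 0 r :=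
    intervalIntegral.intervalIntegrable_rpow' (by norm_num)
  have hI' : IntervalIntegrable (fun u : ℝ => (1 - u) ^ (-(1 / 2) : ℝ)) volume s 1 := by
    have : IntervalIntegrable (fun u : ℝ => u ^ (-(1 / 2) : ℝ)) volume (1 - s) (1 - 1) :=
      intervalIntegral.intervalIntegrable_rpow' (by norm_num)
    simpa using this.comp_sub_left 1
  have hbd : ∀ {x y K : ℝ}, 0 < y → x * √y ≤ K → x ≤ K * y ^ (-(1 / 2) : ℝ) := by
    intro x y K hy h
    rw [Real.rpow_neg hy.le, ← Real.sqrt_eq_rpow, ← div_eq_mul_inv, le_div_iff₀ (Real.sqrt_pos.2 hy)]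
    exact h
  have i1 : IntervalIntegrable f volume 0 r := by
    refine (hI.const_mul K₀).mono_fun' ?_ ?_
    · rw [uIoc_of_le hr0.le]
      exact (hc.mono fun u hu => ⟨hu.1, by linarith [hu.2]⟩).aestronglyMeasurable
        measurableSet_Ioc
    · rw [uIoc_of_le hr0.le]
      filter_upwards [ae_restrict_mem measurableSet_Ioc] with u hu
      exact hbd hu.1 (has ⟨hu.1, hu.2.trans_lt hra⟩)
  have i2 : IntervalIntegrable f volume r s := by
    refine ContinuousOn.intervalIntegrable (hc.mono ?_)
    rw [uIcc_of_le (hr2.trans hs2)]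
    exact fun u hu => ⟨by linarith [hu.1], by linarith [hu.2]⟩
  have i3 : IntervalIntegrable f volume s 1 := by
    rw [intervalIntegrable_iff_integrableOn_Ioo_of_le hs1.le] at hI' ⊢
    refine (hI'.const_mul K₁).mono' ?_ ?_
    · exact (hc.mono fun u hu => ⟨by linarith [hu.1], hu.2⟩).aestronglyMeasurable
        measurableSet_Ioo
    · filter_upwards [ae_restrict_mem measurableSet_Ioo] with u hu
      exact hbd (by linarith [hu.2]) (hbs ⟨hsb.trans hu.1, hu.2⟩)
  exact (i1.trans i2).trans i3

section

variable {q : ℂ} {e : ℝ}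

lemma deriv_gam_bound_zero (hq : 0 < q.im) :
    ∃ K, ∀ᶠ u in 𝓝[>] (0 : ℝ), ‖((e : ℂ) - q) / ss q e u‖ * √u ≤ K := by
  have h1 : ContinuousAt (fun u : ℝ => ‖((e : ℂ) - q) / (Complex.exp (Complex.log (e - q) / 2) *
      Complex.exp (Complex.log (seg q e u - conj q) / 2))‖) 0 := by
    have h1 : ContinuousAt (fun u : ℝ => seg q e u - conj q) 0 :=
      ((seg_hasDerivAt q e 0).continuousAt).sub continuousAt_const
    have h2 := h1.clog (seg_sub_conj_mem hq two_pos)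
    exact (continuousAt_const.div (continuousAt_const.mul (h2.div_const 2).cexp)
      (mul_ne_zero (Complex.exp_ne_zero _) (Complex.exp_ne_zero _))).norm
  refine ⟨_, (((h1.eventually (gt_mem_nhds (lt_add_one _))).filter_mono
    nhdsWithin_le_nhds).and self_mem_nhdsWithin).mono fun u hu => le_trans (le_of_eq ?_) hu.1.le⟩
  have hu0 : 0 < u := hu.2
  have : 0 < √u := Real.sqrt_pos.2 hu0
  rw [ss, mul_assoc, ← div_div, div_right_comm, norm_div _ (√u : ℂ), Complex.norm_real,
    Real.norm_eq_abs, abs_of_pos this]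
  field_simp

lemma deriv_gam_continuousAt {u : ℝ} (hq : 0 < q.im) (h0 : 0 < u) (hu : u < 2) :
    ContinuousAt (fun u => ((e : ℂ) - q) / ss q e u) u :=
  continuousAt_const.div (ss_continuousAt hq hu) (ss_ne hq h0)

lemma deriv_gam_bound_one (hq : 0 < q.im) :
    ∃ K, ∀ᶠ u in 𝓝[<] (1 : ℝ), ‖((e : ℂ) - q) / ss q e u‖ ≤ K := by
  refine ⟨_, (((deriv_gam_continuousAt (e := e) hq one_pos one_lt_two).norm.eventually
    (gt_mem_nhds (lt_add_one _))).filter_mono nhdsWithin_le_nhds).mono fun u hu => hu.le⟩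

lemma deriv_gam_intervalIntegrable (hq : 0 < q.im) :
    IntervalIntegrable (fun u => ((e : ℂ) - q) / ss q e u) volume 0 1 := by
  obtain ⟨K₀, h0⟩ := deriv_gam_bound_zero (e := e) hq
  obtain ⟨K₁, h1⟩ := deriv_gam_bound_one (e := e) hq
  refine intervalIntegrable_of_sqrt_bounds (fun u hu => (deriv_gam_continuousAt hq hu.1
    (hu.2.trans one_lt_two)).continuousWithinAt) h0 (K₁ := K₁) ?_
  filter_upwards [h1, Ioo_mem_nhdsLT (zero_lt_one' ℝ)] with u hu hu1
  have : √(1 - u) ≤ 1 := by rw [Real.sqrt_le_one]; linarith [hu1.1]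
  nlinarith [norm_nonneg (((e : ℂ) - q) / ss q e u), Real.sqrt_nonneg (1 - u)]

lemma integral_deriv_gam_im (hq : 0 < q.im) :
    (∫ u in (0 : ℝ)..1, ((e : ℂ) - q) / ss q e u).im = -(π / 2) := by
  rw [intervalIntegral.integral_eq_sub_of_hasDerivAt_of_tendsto zero_lt_one
    (fun u hu => gam_hasDerivAt hq hu.1 hu.2.le) (deriv_gam_intervalIntegrable hq)
    ((gam_continuousAt hq le_rfl zero_le_one).tendsto.mono_left nhdsWithin_le_nhds)
    ((gam_continuousAt hq zero_le_one le_rfl).tendsto.mono_left nhdsWithin_le_nhds),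
    gam_one hq, gam_zero]
  · simp
  · exact hq

lemma deriv_ss_intervalIntegrable (hq : 0 < q.im) :
    IntervalIntegrable (fun u => (seg q e u - q.re) * (e - q) / ss q e u) volume 0 1 := by
  simp only [mul_div_assoc]
  refine (deriv_gam_intervalIntegrable hq).continuousOn_mul (Continuous.continuousOn ?_)
  unfold seg
  fun_prop

lemma integral_deriv_ss_im (hq : 0 < q.im) :
    (∫ u in (0 : ℝ)..1, (seg q e u - q.re) * (e - q) / ss q e u).im = 0 := by
  rw [intervalIntegral.integral_eq_sub_of_hasDerivAt_of_tendsto zero_lt_one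
    (fun u hu => ss_hasDerivAt hq hu.1 (hu.2.trans one_lt_two)) (deriv_ss_intervalIntegrable hq)
    ((ss_continuousAt hq zero_lt_two).tendsto.mono_left nhdsWithin_le_nhds)
    ((ss_continuousAt hq one_lt_two).tendsto.mono_left nhdsWithin_le_nhds),
    ss_one hq, ss_zero]
  simp

lemma gam_mem_strip {u : ℝ} (hq : 0 < q.im) (h0 : 0 ≤ u) (hu : u < 1) : gam q e u ∈ strip :=
  ⟨gam_im_pos hq h0 hu, gam_im_lt hq h0 hu⟩

lemma gam_zero_mem (hq : 0 < q.im) : gam q e 0 ∈ strip := gam_mem_strip hq le_rfl one_pos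

lemma refl_gam_zero (hq : 0 < q.im) : I * π - gam q e 0 = gam q e 0 := by
  rw [gam_zero hq]; push_cast; ring

lemma gam_direction (hq : 0 < q.im) : ∃ C : ℝ, 0 < C ∧ ∀ᶠ u in 𝓝[<] (1 : ℝ),
    (∀ s : ℝ, 0 ≤ s → s ≤ C * ‖gam q e u + s - gam q e 1‖) ∧
    (∀ s : ℝ, 0 ≤ s → s ≤ C * ‖(I * π - gam q e u) + s - (I * π - gam q e 1)‖) ∧
    1 - u ≤ C * ‖gam q e u - gam q e 1‖ := by
  obtain ⟨C, hC, h⟩ := (gam_hasDerivAt (e := e) hq one_pos le_rfl).eventually_norm_sub_le_im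
    (gam_deriv_one_im_neg hq)
  refine ⟨1 + C, by positivity, h.mono fun u hu => ⟨fun s _ => ?_, fun s _ => ?_, ?_⟩⟩
  · convert le_mul_norm_add_ofReal (s := s) hu.1 hC using 3
    ring
  · convert le_mul_norm_neg_add_ofReal (s := s) hu.1 hC using 3
    ring
  · have h1 := (le_abs_self _).trans (Complex.abs_im_le_norm (gam q e u - gam q e 1))
    nlinarith [hu.2, norm_nonneg (gam q e u - gam q e 1)]

end

section

variable {α μ κ T A B : ℝ} {q : ℂ} {e : ℝ}

/-- The sum over the two sheets of the integrand, pulled back to the segment. -/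
def sheetSum (α μ κ T A B : ℝ) (k : ℕ) (q : ℂ) (e u : ℝ) : ℂ :=
  (FF α μ κ T A B k (gam q e u) + FF α μ κ T A B k (I * π - gam q e u)) * ((e - q) / ss q e u)

lemma Prm.FF_continuousAt (h : Prm α μ κ T A B) (k : ℕ) {t : ℂ} (ht : t ∈ strip) :
    ContinuousAt (FF α μ κ T A B k) t := (h.FF_differentiableAt k ht).continuousAt

lemma Prm.sheets_continuousAt (h : Prm α μ κ T A B) (k : ℕ) {u : ℝ} (hq : 0 < q.im) (h0 : 0 ≤ u)
    (hu : u < 1) : ContinuousAt (fun u => FF α μ κ T A B k (gam q e u) +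
      FF α μ κ T A B k (I * π - gam q e u)) u := by
  have hg := gam_continuousAt (e := e) hq h0 hu.le
  have hs := gam_mem_strip (e := e) hq h0 hu
  exact ((h.FF_continuousAt k hs).comp (f := gam q e) hg).add
    ((h.FF_continuousAt k (refl_mem_strip hs)).comp (f := fun u => I * π - gam q e u)
      (continuousAt_const.sub hg))

lemma gam_one_eq_tP (hq : 0 < q.im) (hB : B = 4 * q.im) (he : α * μ - A = 4 * (e - q.re)) :
    gam q e 1 = tP α μ A B := by
  rw [gam_one hq, tP, hB, he, mul_div_mul_left _ _ (by norm_num : (4 : ℝ) ≠ 0)]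

lemma Corner.bounded_mul_sqrt {F : ℂ → ℂ} {c : ℂ} (hc : Corner F c) {w : ℝ → ℂ} {C : ℝ}
    (hw : Tendsto w (𝓝[<] 1) (𝓝 c)) (hws : ∀ᶠ u in 𝓝[<] (1 : ℝ), w u ∈ strip)
    (hdir : ∀ᶠ u in 𝓝[<] (1 : ℝ), 1 - u ≤ C * ‖w u - c‖) (hC : 0 < C) :
    ∀ᶠ u in 𝓝[<] (1 : ℝ), ‖F (w u)‖ * √(1 - u) ≤ √C := by
  have h1 := hc.lim.comp (tendsto_nhdsWithin_iff.2
    ⟨hw, hws.mono fun u hu => strip_subset_cstrip hu⟩)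
  filter_upwards [h1.eventually (gt_mem_nhds one_pos), hdir] with u hu hd
  simp only [Function.comp_apply] at hu
  calc ‖F (w u)‖ * √(1 - u) ≤ ‖F (w u)‖ * √(C * ‖w u - c‖) := by gcongr
    _ = √C * (‖F (w u)‖ * √‖w u - c‖) := by rw [Real.sqrt_mul hC.le]; ring
    _ ≤ √C * 1 := by gcongr
    _ = √C := mul_one _

lemma Prm.sheetSum_intervalIntegrable (h : Prm α μ κ T A B) (k : ℕ) (hq : 0 < q.im)
    (hB : B = 4 * q.im) (he : α * μ - A = 4 * (e - q.re)) :
    IntervalIntegrable (sheetSum α μ κ T A B k q e) volume 0 1 := by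
  obtain ⟨K₀, h0⟩ := deriv_gam_bound_zero (e := e) hq
  obtain ⟨K₁, h1⟩ := deriv_gam_bound_one (e := e) hq
  obtain ⟨C, hC, hdir⟩ := gam_direction (e := e) hq
  have hg1 := (gam_continuousAt (e := e) hq zero_le_one le_rfl).tendsto.mono_left
    (nhdsWithin_le_nhds (s := Iio 1))
  have hstrip : ∀ᶠ u in 𝓝[<] (1 : ℝ), gam q e u ∈ strip := by
    filter_upwards [Ioo_mem_nhdsLT (zero_lt_one' ℝ)] with u hu
    exact gam_mem_strip hq hu.1.le hu.2
  have hlow : Corner (FF α μ κ T A B k) (gam q e 1) := by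
    rw [gam_one_eq_tP hq hB he]; exact h.corner_lower k
  have hup : Corner (FF α μ κ T A B k) (I * π - gam q e 1) := by
    rw [gam_one_eq_tP hq hB he]; exact h.corner_upper k
  have b1 := hlow.bounded_mul_sqrt hg1 hstrip (hdir.mono fun u hu => hu.2.2) hC
  have b2 := hup.bounded_mul_sqrt (tendsto_const_nhds.sub hg1)
    (hstrip.mono fun u hu => refl_mem_strip hu) (C := C) (hdir.mono fun u hu => by
      rw [sub_sub_sub_cancel_left, norm_sub_rev]; exact hu.2.2) hC
  obtain ⟨K₂, b0⟩ : ∃ K, ∀ᶠ u in 𝓝[>] (0 : ℝ), ‖FF α μ κ T A B k (gam q e u) +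
      FF α μ κ T A B k (I * π - gam q e u)‖ < K :=
    ⟨_, (((h.sheets_continuousAt (e := e) k hq le_rfl one_pos).norm.eventually
      (gt_mem_nhds (lt_add_one _))).filter_mono nhdsWithin_le_nhds)⟩
  refine intervalIntegrable_of_sqrt_bounds (K₀ := K₂ * K₀) (K₁ := (√C + √C) * K₁) (fun u hu =>
    ((h.sheets_continuousAt k hq hu.1.le hu.2).mul (deriv_gam_continuousAt hq hu.1
      (hu.2.trans one_lt_two))).continuousWithinAt)
    ((b0.and h0).mono fun u hu => ?_) ?_
  · rw [sheetSum, norm_mul, mul_assoc]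
    exact mul_le_mul hu.1.le hu.2 (by positivity) ((norm_nonneg _).trans hu.1.le)
  · filter_upwards [b1, b2, h1] with u hu1 hu2 hu3
    rw [sheetSum, norm_mul, mul_right_comm]
    refine mul_le_mul (le_trans ?_ (add_le_add hu1 hu2)) hu3 (norm_nonneg _) (by positivity)
    rw [← add_mul]
    gcongr
    exact norm_add_le _ _

lemma Prm.integral_sheetSum_im (h : Prm α μ κ T A B) {k : ℕ} (hk : k ≤ 1) (hq : 0 < q.im)
    (hB : B = 4 * q.im) (he : α * μ - A = 4 * (e - q.re)) :
    (∫ u in (0 : ℝ)..1, sheetSum α μ κ T A B k q e u).im = 0 := by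
  have h_int := h.sheetSum_intervalIntegrable k hq hB he
  have hdiff : DifferentiableOn ℂ (FF α μ κ T A B k) strip := fun t ht =>
    (h.FF_differentiableAt k ht).differentiableWithinAt
  obtain ⟨P, hP'⟩ := strip_convex.exists_forall_hasDerivWithinAt hdiff
  have hP : ∀ t ∈ strip, HasDerivAt P (FF α μ κ T A B k t) t := fun t ht =>
    (hP' t ht).hasDerivAt (strip_isOpen.mem_nhds ht)
  obtain ⟨C, hC, hdir⟩ := gam_direction (e := e) hq
  have hg1 := (gam_continuousAt (e := e) hq zero_le_one le_rfl).tendsto.mono_left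
    (nhdsWithin_le_nhds (s := Iio 1))
  have hg0 := (gam_continuousAt (e := e) hq le_rfl zero_le_one).tendsto.mono_left
    (nhdsWithin_le_nhds (s := Ioi 0))
  have hstrip : ∀ᶠ u in 𝓝[<] (1 : ℝ), gam q e u ∈ strip := by
    filter_upwards [Ioo_mem_nhdsLT (zero_lt_one' ℝ)] with u hu
    exact gam_mem_strip hq hu.1.le hu.2
  have hlow : Corner (FF α μ κ T A B k) (gam q e 1) := by
    rw [gam_one_eq_tP hq hB he]; exact h.corner_lower k
  have hup : Corner (FF α μ κ T A B k) (I * π - gam q e 1) := by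
    rw [gam_one_eq_tP hq hB he]; exact h.corner_upper k
  have hone := Corner.tendsto_im_sub hP hdiff.continuousOn (fun ε hε => h.FF_decay hk hε)
    hlow hg1 hstrip (hdir.mono fun u hu => hu.1) hup (tendsto_const_nhds.sub hg1)
    (hstrip.mono fun u hu => refl_mem_strip hu) (hdir.mono fun u hu => hu.2.1)
  have hzero : Tendsto (fun u => (P (gam q e u) - P (I * π - gam q e u)).im) (𝓝[>] 0) (𝓝 0) := by
    have hPc := (hP _ (gam_zero_mem (e := e) hq)).continuousAt.tendsto
    have h2 : Tendsto (fun u => I * π - gam q e u) (𝓝[>] 0) (𝓝 (gam q e 0)) := by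
      have := (tendsto_const_nhds (x := I * (π : ℂ))).sub hg0
      rwa [refl_gam_zero hq] at this
    have := (Complex.continuous_im.tendsto _).comp ((hPc.comp hg0).sub (hPc.comp h2))
    simpa [Function.comp_def] using this
  have hcomm : (∫ u in (0 : ℝ)..1, sheetSum α μ κ T A B k q e u).im =
      ∫ u in (0 : ℝ)..1, (sheetSum α μ κ T A B k q e u).im :=
    (Complex.imCLM.intervalIntegral_comp_comm h_int).symm
  rw [hcomm, intervalIntegral.integral_eq_sub_of_hasDerivAt_of_tendsto zero_lt_one
    (f := fun u => (P (gam q e u) - P (I * π - gam q e u)).im) ?_ ?_ hzero hone, sub_zero]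
  · intro u hu
    have hs := gam_mem_strip (e := e) hq hu.1.le hu.2
    have d := gam_hasDerivAt (e := e) hq hu.1 hu.2.le
    have d1 := (hP _ hs).comp u d
    have d2 := (hP _ (refl_mem_strip hs)).comp u (d.const_sub (I * π))
    have d3 := Complex.imCLM.hasFDerivAt.comp_hasDerivAt u (d1.sub d2)
    refine d3.congr_deriv ?_
    simp only [imCLM_apply, sheetSum]
    congr 1
    ring
  · exact ⟨h_int.1.im, h_int.2.im⟩

end

lemma log_one_add_tanh_div (x : ℝ) :
    Real.log ((1 + Real.tanh x) / (1 - Real.tanh x)) = 2 * x := by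
  have h : (1 + Real.tanh x) / (1 - Real.tanh x) = Real.exp (2 * x) := by
    have hc := (Real.cosh_pos x).ne'
    have h1 : Real.cosh x - Real.sinh x ≠ 0 := by
      rw [Real.cosh_sub_sinh]; exact (Real.exp_pos _).ne'
    have h2 : (1 + Real.tanh x) / (1 - Real.tanh x) =
        (Real.cosh x + Real.sinh x) / (Real.cosh x - Real.sinh x) := by
      rw [Real.tanh_eq_sinh_div_cosh, one_add_div hc, one_sub_div hc, div_div_div_cancel_right₀ hc]
    rw [h2, Real.cosh_add_sinh, Real.cosh_sub_sinh, ← Real.exp_sub]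
    congr 1; ring
  rw [h, Real.log_exp]

lemma rho0_eq (x : ℝ) : rho0 x = 1 - Real.tanh x ^ 2 := by
  have hc := (Real.cosh_pos x).ne'
  rw [rho0, sech, Real.tanh_eq_sinh_div_cosh]
  field_simp
  linarith [Real.cosh_sq x]

section

variable {α δ μ x : ℝ} {q : ℂ}

lemma chiC_coeffs (hroot : ∀ z : ℂ, chiC α δ μ x z = 16 * (z - q) * (z - conj q)) :
    4 * q.re - (1 - α * δ) = -α * (μ * Real.tanh x + 2 * α * (1 - Real.tanh x ^ 2)) ∧
    (α * μ * Real.tanh x - (1 - α * δ)) ^ 2 = 16 * (q.re ^ 2 + q.im ^ 2) := by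
  have h0 := congrArg Complex.re (hroot 0)
  have h1 := congrArg Complex.re (hroot 1)
  simp [chiC, pow_two] at h0 h1
  rw [u0] at h0 h1
  rw [rho0_eq] at h1
  constructor <;> linarith

lemma prm_of_root (hα : 0 < α) (hT1 : α * |μ| > |1 - α * δ|) (hT2 : μ ^ 2 > 4 * (1 - α * δ))
    (hT3 : 0 < μ) (hq : 0 < q.im)
    (hroot : ∀ z : ℂ, chiC α δ μ x z = 16 * (z - q) * (z - conj q)) :
    Prm α μ (μ ^ 2 - 4 * (1 - α * δ)) (Real.tanh x) (4 * q.re - (1 - α * δ)) (4 * q.im) := by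
  obtain ⟨h1, h2⟩ := chiC_coeffs hroot
  refine ⟨hα, hT3, by linarith, Real.neg_one_lt_tanh x, Real.tanh_lt_one x, by linarith, ?_, h1, ?_⟩
  · rw [abs_of_pos hT3] at hT1
    linarith [neg_abs_le (1 - α * δ)]
  · have : 4 * q.re = (1 - α * δ) - α * (μ * Real.tanh x + 2 * α * (1 - Real.tanh x ^ 2)) := by
      linarith
    linear_combination -h2 - 2 * (1 - α * δ) * this

/-- The integrand of the moments in terms of the two-sheeted sum. -/
lemma Ip_integrand_eq {S Splus : ℂ → ℂ} (hS : SSpec α δ μ q S Splus) (hκ : 0 < μ ^ 2 - 4 * (1 - α * δ))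
    (h : Prm α μ (μ ^ 2 - 4 * (1 - α * δ)) (Real.tanh x) (4 * q.re - (1 - α * δ)) (4 * q.im))
    (hq : 0 < q.im) (he : q.re < zP α δ μ) (k p : ℕ) {u : ℝ} (hu : u ∈ Ioo (0 : ℝ) 1) :
    deriv (Phi α δ μ) (segB α δ μ q u) * (segB α δ μ q u) ^ p * (segB α δ μ q u - q.re) ^ k /
        Splus (segB α δ μ q u) * ((zP α δ μ : ℂ) - q) =
      ((segB α δ μ q u) ^ p * (((1 / (2 * 4 ^ k * α) : ℝ) : ℂ) *
        sheetSum α μ (μ ^ 2 - 4 * (1 - α * δ)) (Real.tanh x) (4 * q.re - (1 - α * δ)) (4 * q.im) k q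
          (zP α δ μ) u + ((4 * x / α : ℝ) : ℂ) * ((segB α δ μ q u - q.re) ^ k *
            (((zP α δ μ : ℂ) - q) / ss q (zP α δ μ) u)))) := by
  have him : 0 < (segB α δ μ q u).im := by
    have := seg_im q (zP α δ μ) u
    change (segB α δ μ q u).im = _ at this
    rw [this]; exact mul_pos (by linarith [hu.2]) hq
  have hb : (q.im : ℂ) ≠ 0 := by exact_mod_cast hq.ne'
  have ha : (α : ℂ) ≠ 0 := by exact_mod_cast h.hα.ne'
  have hpt : pt (4 * q.re - (1 - α * δ)) (4 * q.im) (gam q (zP α δ μ) u) =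
      4 * segB α δ μ q u - (1 - α * δ) := by
    rw [pt, sinh_gam hq hu.1.le (hu.2.trans one_lt_two)]
    change _ + _ * ((segB α δ μ q u - _) / _) = _
    push_cast
    field_simp
    ring
  rw [(hasDerivAt_Phi h.hα h.hμ hκ him).deriv, hS.splus_eq hq he hu.1 hu.2, sheetSum,
    h.FF_add_refl k (gam_mem_strip hq hu.1.le hu.2), hpt, log_one_add_tanh_div]
  have h4 : (4 * segB α δ μ q u - (1 - α * δ) - ((4 * q.re - (1 - α * δ) : ℝ) : ℂ)) =
      4 * (segB α δ μ q u - q.re) := by push_cast; ring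
  have hss := ss_ne (e := zP α δ μ) hq hu.1
  rw [h4, mul_pow]
  push_cast
  field_simp
  ring

lemma Ip_zero_eq {S Splus : ℂ → ℂ} (hS : SSpec α δ μ q S Splus)
    (hκ : 0 < μ ^ 2 - 4 * (1 - α * δ))
    (h : Prm α μ (μ ^ 2 - 4 * (1 - α * δ)) (Real.tanh x) (4 * q.re - (1 - α * δ)) (4 * q.im))
    (hq : 0 < q.im) (he : q.re < zP α δ μ) : Ip α δ μ q Splus 0 = -(2 * π * x / α) := by
  have he' : α * μ - (4 * q.re - (1 - α * δ)) = 4 * (zP α δ μ - q.re) := by rw [zP]; ring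
  have hF := h.sheetSum_intervalIntegrable 0 hq rfl he'
  have hG := deriv_gam_intervalIntegrable (e := zP α δ μ) hq
  rw [Ip, intervalIntegral.integral_congr_Ioo_of_le zero_le_one (g := fun u =>
    ((1 / (2 * α) : ℝ) : ℂ) * sheetSum α μ (μ ^ 2 - 4 * (1 - α * δ)) (Real.tanh x)
      (4 * q.re - (1 - α * δ)) (4 * q.im) 0 q (zP α δ μ) u +
      ((4 * x / α : ℝ) : ℂ) * (((zP α δ μ : ℂ) - q) / ss q (zP α δ μ) u)),
    intervalIntegral.integral_add (hF.const_mul _) (hG.const_mul _),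
    intervalIntegral.integral_const_mul, intervalIntegral.integral_const_mul, add_im,
    im_ofReal_mul, im_ofReal_mul, h.integral_sheetSum_im zero_le_one hq rfl he',
    integral_deriv_gam_im hq]
  · ring
  · intro u hu
    simpa using Ip_integrand_eq hS hκ h hq he 0 0 hu

lemma Ip_one_eq {S Splus : ℂ → ℂ} (hS : SSpec α δ μ q S Splus)
    (hκ : 0 < μ ^ 2 - 4 * (1 - α * δ))
    (h : Prm α μ (μ ^ 2 - 4 * (1 - α * δ)) (Real.tanh x) (4 * q.re - (1 - α * δ)) (4 * q.im))
    (hq : 0 < q.im) (he : q.re < zP α δ μ) :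
    Ip α δ μ q Splus 1 = -(2 * π * x / α) * q.re := by
  have he' : α * μ - (4 * q.re - (1 - α * δ)) = 4 * (zP α δ μ - q.re) := by rw [zP]; ring
  have hF₀ := h.sheetSum_intervalIntegrable 0 hq rfl he'
  have hF₁ := h.sheetSum_intervalIntegrable 1 hq rfl he'
  have hG := deriv_gam_intervalIntegrable (e := zP α δ μ) hq
  have hS' := deriv_ss_intervalIntegrable (e := zP α δ μ) hq
  rw [Ip, intervalIntegral.integral_congr_Ioo_of_le zero_le_one (g := fun u =>
    (q.re : ℂ) * (((1 / (2 * α) : ℝ) : ℂ) * sheetSum α μ (μ ^ 2 - 4 * (1 - α * δ)) (Real.tanh x)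
      (4 * q.re - (1 - α * δ)) (4 * q.im) 0 q (zP α δ μ) u +
      ((4 * x / α : ℝ) : ℂ) * (((zP α δ μ : ℂ) - q) / ss q (zP α δ μ) u)) +
    (((1 / (2 * 4 * α) : ℝ) : ℂ) * sheetSum α μ (μ ^ 2 - 4 * (1 - α * δ)) (Real.tanh x)
      (4 * q.re - (1 - α * δ)) (4 * q.im) 1 q (zP α δ μ) u +
      ((4 * x / α : ℝ) : ℂ) * ((seg q (zP α δ μ) u - q.re) * ((zP α δ μ : ℂ) - q) /
        ss q (zP α δ μ) u))),
    intervalIntegral.integral_add (((hF₀.const_mul _).add (hG.const_mul _)).const_mul _)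
      ((hF₁.const_mul _).add (hS'.const_mul _)),
    intervalIntegral.integral_const_mul,
    intervalIntegral.integral_add (hF₀.const_mul _) (hG.const_mul _),
    intervalIntegral.integral_add (hF₁.const_mul _) (hS'.const_mul _),
    intervalIntegral.integral_const_mul, intervalIntegral.integral_const_mul,
    intervalIntegral.integral_const_mul, intervalIntegral.integral_const_mul, add_im,
    im_ofReal_mul, add_im, add_im, im_ofReal_mul, im_ofReal_mul, im_ofReal_mul, im_ofReal_mul,
    h.integral_sheetSum_im zero_le_one hq rfl he', h.integral_sheetSum_im le_rfl hq rfl he',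
    integral_deriv_gam_im hq, integral_deriv_ss_im hq]
  · ring
  · intro u hu
    have h0 := Ip_integrand_eq hS hκ h hq he 0 0 hu
    have h1 := Ip_integrand_eq hS hκ h hq he 1 0 hu
    simp only [pow_zero, pow_one, one_mul, mul_one] at h0 h1
    simp only [pow_one]
    rw [← h0]
    have h2 : ∀ x y z : ℂ, x * (y / z) = x * y / z := fun x y z => (mul_div_assoc x y z).symm
    rw [h2 (segB α δ μ q u - q.re)] at h1
    refine Eq.trans ?_ (congrArg _ h1)
    ring

end

/-- at `t = 0` the endpoint equations are solved by the complex turning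
point `q = 𝔷(x)` for every `x < x_c`. -/
theorem endpoint_equations_at_t_zero (α δ μ : ℝ) (hα : 0 < α)
    (hT1 : α * |μ| > |1 - α*δ|) (hT2 : μ^2 > 4*(1 - α*δ)) (hT3 : 0 < μ)
    (x : ℝ) (hx : x < arctanh (Tcrit α δ μ))
    (zx : ℂ) (him : 0 < zx.im)
    (hroot : ∀ z : ℂ, chiC α δ μ x z = 16 * (z - zx) * (z - conj zx))
    (S Splus : ℂ → ℂ) (hS : SSpec α δ μ zx S Splus) :
    M0 α δ μ zx Splus x 0 = 0 ∧ M1 α δ μ zx Splus x 0 = 0 ∧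
    Ip α δ μ zx Splus 0 = -(2*π*x/α) ∧
    Ip α δ μ zx Splus 1 = -(2*π*x/α) * zx.re := by
  have h := prm_of_root hα hT1 hT2 hT3 him hroot
  have hκ : 0 < μ ^ 2 - 4 * (1 - α * δ) := by linarith
  have he : zx.re < zP α δ μ := by
    have h1 := h.hA
    have h2 : 0 < α * (μ * (1 + Real.tanh x) + 2 * α * (1 - Real.tanh x ^ 2)) := by
      have h3 : 0 < 1 + Real.tanh x := by linarith [h.hT1]
      have h4 : 0 < 1 - Real.tanh x ^ 2 := by nlinarith [h.hT1, h.hT2]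
      positivity
    rw [zP]
    linarith
  have h0 := Ip_zero_eq hS hκ h him he
  have h1 := Ip_one_eq hS hκ h him he
  refine ⟨?_, ?_, h0, h1⟩
  · rw [M0, h0]
    field_simp
    ring
  · rw [M1, h1]
    field_simp
    ring
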